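/- arXiv:2311.03341 — 2 statements merged into one kernel-verified Lean document; each statement's English description precedes it below -/
import Mathlib

section
/- Let 𝒢 be a hereditary class of graphs for which there is a polynomial p such that for every positive integer s, every bipartite graph in 𝒢 with no K_{s,s} subgraph has average degree at most p(s). Then there is a polynomial p' such that for every positive integer s, every graph in 𝒢 with no K_{s,s} subgraph has average degree at most p'(s). -/
open SimpleGraph

/-- `G` contains a copy of `H` as a (not necessarily induced) subgraph. -/
def HasSubgraphCopy {V W : Type} (G : SimpleGraph V) (H : SimpleGraph W) : Prop :=
  ∃ f : H →g G, Function.Injective f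

/-- `G` contains an induced copy of `H`. -/
def HasInducedCopy {V W : Type} (G : SimpleGraph V) (H : SimpleGraph W) : Prop :=
  ∃ s : Set V, Nonempty ((G.induce s) ≃g H)

/-- The graph obtained from `G` by subdividing the edge `ab` once (`none` is the new vertex). -/
def edgeSubdiv {V : Type} (G : SimpleGraph V) (a b : V) : SimpleGraph (Option V) :=
  SimpleGraph.fromRel (fun x y =>
    (∃ x' y' : V, x = some x' ∧ y = some y' ∧ G.Adj x' y' ∧
      ¬((x' = a ∧ y' = b) ∨ (x' = b ∧ y' = a))) ∨
    (x = none ∧ (y = some a ∨ y = some b)))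

/-- `IsSubdivision H S` : `S` is obtained from `H` by a finite sequence of single edge
subdivisions (edges of `H` get replaced by possibly longer paths). -/
inductive IsSubdivision : {V : Type} → SimpleGraph V → {W : Type} → SimpleGraph W → Prop
  | refl {V : Type} (G : SimpleGraph V) : IsSubdivision G G
  | step {V W : Type} (G : SimpleGraph V) (H : SimpleGraph W) (a b : W) :
      IsSubdivision G H → H.Adj a b → IsSubdivision G (edgeSubdiv H a b)

/-- `G` contains an induced subdivision of `H`, i.e. some induced subgraph of `G` is
isomorphic to a subdivision of `H`. -/
def HasInducedSubdivision {V W : Type} (G : SimpleGraph V) (H : SimpleGraph W) : Prop :=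
  ∃ (U : Type) (S : SimpleGraph U), IsSubdivision H S ∧ HasInducedCopy G S

/-- The average degree `2e(G)/|V(G)|` of a finite graph. -/
noncomputable def avgDeg {V : Type} (G : SimpleGraph V) [Fintype V] : ℝ :=
  2 * G.edgeSet.ncard / Fintype.card V

namespace PolyDeg
open Finset
open scoped Classical

def KFree {V : Type} (G : SimpleGraph V) (s : ℕ) : Prop :=
  ∀ X Y : Finset V, X.card = s → Y.card = s → (∀ x ∈ X, ∀ y ∈ Y, G.Adj x y) → False

def Indep {V : Type} (G : SimpleGraph V) (A : Finset V) : Prop :=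
  ∀ x ∈ A, ∀ y ∈ A, ¬ G.Adj x y

def NoDense {V : Type} (G : SimpleGraph V) (P : ℕ) : Prop :=
  ∀ A B : Finset V, Indep G A → Indep G B → A.card ≤ B.card → B.Nonempty →
    (∀ b ∈ B, P ≤ (A.filter (fun a => G.Adj b a)).card) → False

def NoSparse {V : Type} (G : SimpleGraph V) (K : ℕ) : Prop :=
  ∀ A B : Finset V, Indep G A → Indep G B → A.card ≤ B.card → B.Nonempty →
    (∀ b ∈ B, K ≤ (A.filter (fun a => G.Adj b a)).card) →
    (∀ b ∈ B, ∀ b' ∈ B, b ≠ b' → ∀ a ∈ A, ∀ a' ∈ A, a ≠ a' → G.Adj b a → G.Adj b a' →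
      G.Adj b' a → G.Adj b' a' → False) → False

lemma few_bad {V : Type} [Fintype V] {G : SimpleGraph V} {s : ℕ} (hK : KFree G s) (hs : 1 ≤ s)
    (W : Finset V) (hW : 2 * s ≤ W.card) :
    (univ.filter fun v => 2 * s * (W.filter (fun w => ¬ G.Adj v w)).card < W.card).card < s := by
  by_contra hcon
  push Not at hcon
  obtain ⟨Z, hZsub, hZ⟩ := Finset.exists_subset_card_eq hcon
  set Cm := W.filter (fun w => ∀ z ∈ Z, G.Adj z w) with hCm
  have h1 : W ⊆ Cm ∪ Z.biUnion (fun z => W.filter (fun w => ¬ G.Adj z w)) := by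
    intro w hw
    by_cases h : ∀ z ∈ Z, G.Adj z w
    · exact mem_union_left _ (mem_filter.2 ⟨hw, h⟩)
    · push Not at h
      obtain ⟨z, hz, hzw⟩ := h
      exact mem_union_right _ (mem_biUnion.2 ⟨z, hz, mem_filter.2 ⟨hw, hzw⟩⟩)
  have h2 : W.card ≤ Cm.card + ∑ z ∈ Z, (W.filter (fun w => ¬ G.Adj z w)).card :=
    (card_le_card h1).trans ((card_union_le _ _).trans (Nat.add_le_add_left card_biUnion_le _))
  have h3 : 2 * s * ∑ z ∈ Z, (W.filter (fun w => ¬ G.Adj z w)).card ≤ s * W.card := by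
    rw [mul_sum]
    calc _ ≤ ∑ z ∈ Z, W.card := sum_le_sum (fun z hz => (mem_filter.1 (hZsub hz)).2.le)
      _ = s * W.card := by rw [sum_const, hZ, smul_eq_mul]
  have h4 : s ≤ Cm.card := by
    have : s * W.card ≤ s * (2 * Cm.card) := by nlinarith
    have := Nat.le_of_mul_le_mul_left this hs
    omega
  obtain ⟨Y, hY, hYc⟩ := Finset.exists_subset_card_eq h4
  exact hK Z Y hZ hYc (fun x hx y hy => (mem_filter.1 (hY hy)).2 x hx)

lemma indep_transversal {V : Type} [Fintype V] {G : SimpleGraph V} {s : ℕ} (hK : KFree G s)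
    (hs : 1 ≤ s) (v0 : V) {ι : Type} (c : ℕ) (hc : 2 ≤ c) (F : Finset ι) :
    ∀ (W : ι → Finset V), F.card ≤ c → (∀ l ∈ F, s * c * (2 * s) ^ F.card ≤ (W l).card) →
    ∃ w : ι → V, (∀ l ∈ F, w l ∈ W l) ∧ ∀ l ∈ F, ∀ l' ∈ F, ¬ G.Adj (w l) (w l') := by
  induction F using Finset.induction_on with
  | empty => intro W _ _; exact ⟨fun _ => v0, by simp, by simp⟩
  | insert x F hx ih =>
    intro W hF hW
    rw [card_insert_of_notMem hx] at hF hW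
    have hpow : 1 ≤ (2 * s) ^ F.card := Nat.one_le_pow _ _ (by omega)
    have hbig : ∀ l ∈ insert x F, 2 * s ≤ (W l).card := by
      intro l hl
      refine le_trans ?_ (hW l hl)
      rw [pow_succ]
      have : 1 ≤ s * c := Nat.mul_pos hs (by omega)
      nlinarith [Nat.mul_le_mul this hpow]
    set Bad : Finset V := F.biUnion (fun l => univ.filter fun v =>
      2 * s * ((W l).filter (fun w => ¬ G.Adj v w)).card < (W l).card) with hBad
    have hBc : Bad.card ≤ F.card * s := by
      refine card_biUnion_le_card_mul _ _ _ (fun l hl => ?_)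
      exact (few_bad hK hs (W l) (hbig l (mem_insert_of_mem hl))).le
    have : ∃ v ∈ W x, v ∉ Bad := by
      by_contra hcon
      push Not at hcon
      have h1 : (W x).card ≤ Bad.card := card_le_card hcon
      have h2 := hW x (mem_insert_self _ _)
      have h3 : s * c * 2 ≤ s * c * (2 * s) ^ (F.card + 1) := by
        apply Nat.mul_le_mul_left
        rw [pow_succ]; nlinarith
      have h4 : F.card * s < c * s := Nat.mul_lt_mul_of_pos_right (by omega) hs
      nlinarith
    obtain ⟨v, hv, hvB⟩ := this
    obtain ⟨w, hw1, hw2⟩ := ih (fun l => (W l).filter (fun y => ¬ G.Adj v y)) (by omega) (by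
      intro l hl
      have h1 : ¬ (2 * s * ((W l).filter (fun w => ¬ G.Adj v w)).card < (W l).card) := by
        intro h
        exact hvB (mem_biUnion.2 ⟨l, hl, mem_filter.2 ⟨mem_univ _, h⟩⟩)
      push Not at h1
      have h2 := (hW l (mem_insert_of_mem hl)).trans h1
      rw [pow_succ] at h2
      have h3 : (2 * s) * (s * c * (2 * s) ^ F.card) ≤
        2 * s * ((W l).filter (fun w => ¬ G.Adj v w)).card := by
        refine le_trans (le_of_eq ?_) h2; ring
      exact Nat.le_of_mul_le_mul_left h3 (by omega))
    refine ⟨Function.update w x v, ?_, ?_⟩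
    · intro l hl
      by_cases hlx : l = x
      · subst hlx; simpa using hv
      · rw [Function.update_of_ne hlx]
        exact (mem_filter.1 (hw1 l ((mem_insert.1 hl).resolve_left hlx))).1
    · intro l hl l' hl'
      by_cases hlx : l = x <;> by_cases hlx' : l' = x
      · subst hlx; subst hlx'; simp
      · subst hlx
        rw [Function.update_of_ne hlx', Function.update_self]
        exact (mem_filter.1 (hw1 l' ((mem_insert.1 hl').resolve_left hlx'))).2
      · subst hlx'
        rw [Function.update_of_ne hlx, Function.update_self]
        intro h
        exact (mem_filter.1 (hw1 l ((mem_insert.1 hl).resolve_left hlx))).2 h.symm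
      · rw [Function.update_of_ne hlx, Function.update_of_ne hlx']
        exact hw2 l ((mem_insert.1 hl).resolve_left hlx) l' ((mem_insert.1 hl').resolve_left hlx')

lemma count_upd {ι U : Type} [DecidableEq ι] [DecidableEq U] [Fintype ι] [Fintype U] (S : Finset (ι → U)) (x : ι) :
    ∑ u : ι → U, (univ.filter fun y => Function.update u x y ∈ S).card = S.card * Fintype.card U := by
  rw [← card_univ (α := U), ← card_product, ← card_sigma]
  refine Finset.card_bij' (fun p _ => (Function.update p.1 x p.2, p.1 x))
    (fun p _ => ⟨Function.update p.1 x p.2, p.1 x⟩) ?_ ?_ ?_ ?_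
  · rintro ⟨u, y⟩ h
    simp at h ⊢; exact h
  · rintro ⟨u, y⟩ h
    simp at h ⊢; exact h
  · rintro ⟨u, y⟩ h; simp
  · rintro ⟨u, y⟩ h; simp

lemma count_upd_le {ι U : Type} [DecidableEq ι] [DecidableEq U] [Fintype ι] [Fintype U] (S : Finset (ι → U)) (x : ι) (s : ℕ)
    (h : ∀ u, (univ.filter fun y => Function.update u x y ∈ S).card ≤ s) :
    S.card * Fintype.card U ≤ s * Fintype.card U ^ Fintype.card ι := by
  rw [← count_upd S x]
  refine (sum_le_sum (fun u _ => h u)).trans ?_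
  simp [mul_comm]

lemma count_upd_ge {ι U : Type} [DecidableEq ι] [DecidableEq U] [Fintype ι] [Fintype U] (S T : Finset (ι → U)) (x : ι) (m : ℕ)
    (h : ∀ u ∈ T, m ≤ (univ.filter fun y => Function.update u x y ∈ S).card) :
    m * T.card ≤ S.card * Fintype.card U := by
  rw [← count_upd S x]
  calc m * T.card = ∑ u ∈ T, m := by simp [mul_comm]
    _ ≤ ∑ u ∈ T, (univ.filter fun y => Function.update u x y ∈ S).card := sum_le_sum h
    _ ≤ _ := sum_le_sum_of_subset (subset_univ _)

end PolyDeg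

namespace PolyDeg
open Finset
open scoped Classical

lemma drc {V : Type} [Fintype V] (G : SimpleGraph V) {ι : Type} [Fintype ι] (X Y : Finset V)
    (d R M a r : ℕ) (hr : Fintype.card ι = r) (hX : X.card ≤ d) (hY : Y.card ≤ d)
    (he : d ^ 2 < R * ∑ x ∈ X, (Y.filter (fun y => G.Adj x y)).card)
    (hd : R ^ (r + 1) * (M ^ (r + 1) + a) ≤ d) (ha : 1 ≤ a) :
    ∃ U ⊆ X, a ≤ U.card ∧ ∀ S : ι → V, (∀ i, S i ∈ U) →
      M ≤ (Y.filter (fun y => ∀ i, G.Adj (S i) y)).card := by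
  have hR : 1 ≤ R := by
    rcases Nat.eq_zero_or_pos R with h | h
    · subst h; simp at he
    · exact h
  have hd0 : 1 ≤ d := le_trans (Nat.mul_pos (pow_pos hR _) (by omega)) hd
  set e := ∑ x ∈ X, (Y.filter (fun y => G.Adj x y)).card with hedef
  set UT : (Fin (r+1) → V) → Finset V := fun T => X.filter (fun x => ∀ j, G.Adj x (T j)) with hUT
  set PY := Fintype.piFinset (fun _ : Fin (r+1) => Y) with hPY
  have hPYc : PY.card ≤ d ^ (r+1) := by
    rw [hPY, Fintype.card_piFinset]; simp; exact Nat.pow_le_pow_left hY _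
  -- total size
  have hsum : ∑ T ∈ PY, (UT T).card = ∑ x ∈ X, (Y.filter (fun y => G.Adj x y)).card ^ (r+1) := by
    have : ∀ x ∈ X, (Y.filter (fun y => G.Adj x y)).card ^ (r+1)
        = (PY.filter (fun T => ∀ j, G.Adj x (T j))).card := by
      intro x _
      have h1 : PY.filter (fun T => ∀ j, G.Adj x (T j)) =
          Fintype.piFinset (fun _ : Fin (r+1) => Y.filter (fun y => G.Adj x y)) := by
        ext T; simp [hPY, Fintype.mem_piFinset, forall_and]
      rw [h1, Fintype.card_piFinset]; simp
    rw [sum_congr rfl this]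
    simp only [hUT, card_filter]
    rw [sum_comm]
  have hpm : e ^ (r+1) ≤ X.card ^ r * ∑ x ∈ X, (Y.filter (fun y => G.Adj x y)).card ^ (r+1) := by
    have hXpos : 0 < X.card := by
      rw [card_pos]
      by_contra hne
      rw [not_nonempty_iff_eq_empty] at hne
      rw [hedef, hne] at he; simp at he
    have := pow_sum_div_card_le_sum_pow (s := X)
      (f := fun x => ((Y.filter (fun y => G.Adj x y)).card : ℚ)) (fun _ _ => by positivity) r
    rw [div_le_iff₀ (by positivity)] at this
    rw [hedef]
    have h2 : ((∑ x ∈ X, (Y.filter (fun y => G.Adj x y)).card : ℕ) : ℚ) ^ (r+1) ≤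
      ((X.card ^ r * ∑ x ∈ X, (Y.filter (fun y => G.Adj x y)).card ^ (r+1) : ℕ) : ℚ) := by
      push_cast; rw [mul_comm]; exact this
    exact_mod_cast h2
  have htot : d ^ (r+2) ≤ R ^ (r+1) * ∑ T ∈ PY, (UT T).card := by
    rw [hsum]
    have h1 : (d^2)^(r+1) ≤ (R * e)^(r+1) := Nat.pow_le_pow_left he.le _
    rw [mul_pow] at h1
    have h2 : d ^ r * d ^ (r+2) ≤ d ^ r * (R ^ (r+1) *
        ∑ x ∈ X, (Y.filter (fun y => G.Adj x y)).card ^ (r+1)) := by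
      calc d ^ r * d ^ (r+2) = (d^2)^(r+1) := by ring
        _ ≤ R^(r+1) * e^(r+1) := h1
        _ ≤ R^(r+1) * (X.card ^ r * ∑ x ∈ X, (Y.filter (fun y => G.Adj x y)).card ^ (r+1)) :=
          Nat.mul_le_mul_left _ hpm
        _ ≤ R^(r+1) * (d ^ r * ∑ x ∈ X, (Y.filter (fun y => G.Adj x y)).card ^ (r+1)) :=
          Nat.mul_le_mul_left _ (Nat.mul_le_mul_right _ (Nat.pow_le_pow_left hX _))
        _ = _ := by ring
    exact Nat.le_of_mul_le_mul_left h2 (by positivity)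
  -- bad tuples
  set BS := (Fintype.piFinset (fun _ : ι => X)).filter
    (fun S => (Y.filter (fun y => ∀ i, G.Adj (S i) y)).card < M) with hBS
  have hBSc : BS.card ≤ d ^ r := by
    refine (card_filter_le _ _).trans ?_
    rw [Fintype.card_piFinset]; simp [hr]; exact Nat.pow_le_pow_left hX _
  have hbad : ∑ T ∈ PY, (BS.filter (fun S => ∀ i, S i ∈ UT T)).card ≤ d ^ r * M ^ (r+1) := by
    have : ∑ T ∈ PY, (BS.filter (fun S => ∀ i, S i ∈ UT T)).card =
        ∑ S ∈ BS, (PY.filter (fun T => ∀ i, S i ∈ UT T)).card := by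
      simp only [card_filter]; rw [sum_comm]
    rw [this]
    calc _ ≤ ∑ S ∈ BS, M ^ (r+1) := by
          refine sum_le_sum (fun S hS => ?_)
          have h1 : PY.filter (fun T => ∀ i, S i ∈ UT T) ⊆
              Fintype.piFinset (fun _ : Fin (r+1) => Y.filter (fun y => ∀ i, G.Adj (S i) y)) := by
            intro T hT
            rw [mem_filter] at hT
            rw [Fintype.mem_piFinset]
            intro j
            rw [mem_filter]
            exact ⟨Fintype.mem_piFinset.1 hT.1 j, fun i => (mem_filter.1 (hT.2 i)).2 j⟩
          refine (card_le_card h1).trans ?_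
          rw [Fintype.card_piFinset]
          simp
          exact Nat.pow_le_pow_left (mem_filter.1 hS).2.le _
      _ = BS.card * M ^ (r+1) := by simp
      _ ≤ _ := Nat.mul_le_mul_right _ hBSc
  by_contra hcon
  push Not at hcon
  have hT : ∀ T ∈ PY, (UT T).card ≤ (a - 1) + d * (BS.filter (fun S => ∀ i, S i ∈ UT T)).card := by
    intro T _
    by_cases hlt : (UT T).card < a
    · omega
    · obtain ⟨S, hS1, hS2⟩ := hcon (UT T) (filter_subset _ _) (by omega)
      have : 1 ≤ (BS.filter (fun S => ∀ i, S i ∈ UT T)).card := by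
        rw [Nat.one_le_iff_ne_zero, ← Nat.pos_iff_ne_zero, card_pos]
        refine ⟨S, mem_filter.2 ⟨mem_filter.2 ⟨Fintype.mem_piFinset.2 (fun i => ?_), hS2⟩, hS1⟩⟩
        exact (mem_filter.1 (hS1 i)).1
      have h2 : (UT T).card ≤ d := (card_le_card (filter_subset _ _)).trans hX
      nlinarith
  have h1 : ∑ T ∈ PY, (UT T).card ≤ d ^ (r+1) * (a - 1) + d * (d ^ r * M ^ (r+1)) := by
    refine (sum_le_sum hT).trans ?_
    rw [sum_add_distrib, ← mul_sum]
    refine Nat.add_le_add ?_ (Nat.mul_le_mul_left _ hbad)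
    simp; exact Nat.mul_le_mul_right _ hPYc
  have h2 : d ^ (r+2) ≤ d ^ (r+1) * (R^(r+1) * (M^(r+1) + (a-1))) := by
    refine htot.trans ((Nat.mul_le_mul_left _ h1).trans (le_of_eq ?_))
    ring
  have h3 : d ≤ R^(r+1) * (M^(r+1) + (a-1)) := by
    rw [pow_succ] at h2
    exact Nat.le_of_mul_le_mul_left h2 (by positivity)
  have h4 : R^(r+1) * (M^(r+1) + (a-1)) < R^(r+1) * (M^(r+1) + a) :=
    Nat.mul_lt_mul_of_pos_left (by omega) (pow_pos hR _)
  omega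

lemma pattern_count {V : Type} [Fintype V] {G : SimpleGraph V} {s : ℕ} (hK : KFree G s)
    (hs : 1 ≤ s) {Pt : Type} [DecidableEq Pt] [Fintype Pt] (U Y : Finset V) (l : Finset Pt) (M : ℕ)
    (hM : ∀ u : Pt → U, M ≤ (Y.filter (fun y => ∀ x ∈ l, G.Adj (u x) y)).card)
    (hMs : (2 * s) ^ (Fintype.card Pt + 1) ≤ M) (F : Finset Pt) :
    Disjoint F l → (univ.filter (fun u : Pt → U => (2 * s) ^ F.card *
      (Y.filter (fun y => (∀ x ∈ l, G.Adj (u x) y) ∧ ∀ x ∈ F, ¬ G.Adj (u x) y)).card < M)).card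
      * U.card ≤ F.card * s * U.card ^ Fintype.card Pt := by
  induction F using Finset.induction_on with
  | empty =>
    intro _
    rw [filter_false_of_mem]
    · simp
    · intro u _; simpa using hM u
  | insert x F hx ih =>
    intro hdis
    have hdis' : Disjoint F l := disjoint_of_subset_left (subset_insert _ _) hdis
    have hxl : x ∉ l := fun h => (Finset.disjoint_left.1 hdis (mem_insert_self _ _)) h
    set W : (Pt → U) → Finset V := fun u =>
      Y.filter (fun y => (∀ x ∈ l, G.Adj (u x) y) ∧ ∀ x ∈ F, ¬ G.Adj (u x) y) with hW
    set S := univ.filter (fun u : Pt → U => M ≤ (2 * s) ^ F.card * (W u).card ∧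
      2 * s * ((W u).filter (fun y => ¬ G.Adj (u x) y)).card < (W u).card) with hS
    have hWu : ∀ u y, W (Function.update u x y) = W u := by
      intro u y
      simp only [hW]
      apply filter_congr
      intro z _
      have e1 : ∀ x' ∈ l, Function.update u x y x' = u x' := fun x' hx' =>
        Function.update_of_ne (by rintro rfl; exact hxl hx') _ _
      have e2 : ∀ x' ∈ F, Function.update u x y x' = u x' := fun x' hx' =>
        Function.update_of_ne (by rintro rfl; exact hx hx') _ _
      constructor
      · rintro ⟨h1, h2⟩
        exact ⟨fun x' hx' => e1 x' hx' ▸ h1 x' hx', fun x' hx' => e2 x' hx' ▸ h2 x' hx'⟩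
      · rintro ⟨h1, h2⟩
        exact ⟨fun x' hx' => (e1 x' hx').symm ▸ h1 x' hx', fun x' hx' => (e2 x' hx').symm ▸ h2 x' hx'⟩
    have hScard : S.card * U.card ≤ s * U.card ^ Fintype.card Pt := by
      have := count_upd_le S x s (by
        intro u
        by_cases hb : M ≤ (2 * s) ^ F.card * (W u).card
        · have hWbig : 2 * s ≤ (W u).card := by
            have h1 : (2*s)^F.card * (2 * s) ≤ (2*s)^F.card * (W u).card := by
              refine le_trans ?_ (hMs.trans hb)
              rw [← pow_succ]
              exact Nat.pow_le_pow_right (by omega) (Nat.succ_le_succ (card_le_univ _))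
            exact Nat.le_of_mul_le_mul_left h1 (pow_pos (by omega) _)
          have h2 := few_bad hK hs (W u) hWbig
          rw [← card_image_of_injective _ Subtype.val_injective]
          refine le_trans (card_le_card ?_) h2.le
          intro v hv
          rw [mem_image] at hv
          obtain ⟨y, hy, rfl⟩ := hv
          rw [mem_filter] at hy
          have := (mem_filter.1 hy.2).2.2
          rw [hWu] at this
          rw [mem_filter]
          refine ⟨mem_univ _, ?_⟩
          simpa using this
        · rw [filter_false_of_mem]
          · simp
          · intro y _ hy
            have := (mem_filter.1 hy).2.1
            rw [hWu] at this
            exact hb this)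
      simpa using this
    have hsub : (univ.filter (fun u : Pt → U => (2 * s) ^ (insert x F).card *
        (Y.filter (fun y => (∀ x ∈ l, G.Adj (u x) y) ∧ ∀ x' ∈ insert x F, ¬ G.Adj (u x') y)).card < M))
        ⊆ (univ.filter (fun u : Pt → U => (2 * s) ^ F.card * (W u).card < M)) ∪ S := by
      intro u hu
      rw [mem_filter] at hu
      rw [mem_union]
      by_cases hb : (2 * s) ^ F.card * (W u).card < M
      · left; exact mem_filter.2 ⟨mem_univ _, hb⟩
      · right
        push Not at hb
        refine mem_filter.2 ⟨mem_univ _, hb, ?_⟩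
        have heq : Y.filter (fun y => (∀ x ∈ l, G.Adj (u x) y) ∧ ∀ x' ∈ insert x F, ¬ G.Adj (u x') y)
          = (W u).filter (fun y => ¬ G.Adj (u x) y) := by
          ext y; simp only [hW, mem_filter, forall_mem_insert]; tauto
        rw [heq, card_insert_of_notMem hx, pow_succ, mul_assoc] at hu
        have := hu.2.trans_le hb
        exact lt_of_mul_lt_mul_left this (Nat.zero_le _)
    calc _ ≤ ((univ.filter (fun u : Pt → U => (2 * s) ^ F.card * (W u).card < M)).card + S.card)
          * U.card := Nat.mul_le_mul_right _ ((card_le_card hsub).trans (card_union_le _ _))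
      _ ≤ F.card * s * U.card ^ Fintype.card Pt + s * U.card ^ Fintype.card Pt := by
          rw [add_mul]; exact Nat.add_le_add (ih hdis') hScard
      _ = _ := by rw [card_insert_of_notMem hx]; ring

lemma indep_count {V : Type} [Fintype V] {G : SimpleGraph V} {s : ℕ} (hK : KFree G s)
    (hs : 1 ≤ s) {Pt : Type} [DecidableEq Pt] [Fintype Pt] (U : Finset V)
    (hU : 2 * s * (2 * s) ^ Fintype.card Pt ≤ U.card) (F : Finset Pt) :
    U.card ^ Fintype.card Pt ≤ (2 * (2 * s) ^ Fintype.card Pt) ^ F.card *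
      (univ.filter (fun u : Pt → U => (∀ x ∈ F, ∀ y ∈ F, ¬ G.Adj (u x) (u y)) ∧
      U.card ≤ (2 * s) ^ F.card * (U.filter (fun y => ∀ x ∈ F, ¬ G.Adj (u x) y)).card)).card := by
  induction F using Finset.induction_on with
  | empty => simp
  | insert x F hx ih =>
    set C : (Pt → U) → Finset V := fun u => U.filter (fun y => ∀ x ∈ F, ¬ G.Adj (u x) y) with hC
    set T := univ.filter (fun u : Pt → U => (∀ x ∈ F, ∀ y ∈ F, ¬ G.Adj (u x) (u y)) ∧
      U.card ≤ (2 * s) ^ F.card * (C u).card) with hT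
    set S := (univ.filter (fun u : Pt → U => (∀ x' ∈ insert x F, ∀ y ∈ insert x F, ¬ G.Adj (u x') (u y)) ∧
      U.card ≤ (2 * s) ^ (insert x F).card *
        (U.filter (fun y => ∀ x' ∈ insert x F, ¬ G.Adj (u x') y)).card)) with hS
    have hUpos : 0 < U.card := lt_of_lt_of_le (by positivity) hU
    have key : ∀ u ∈ T, U.card ≤ (2 * (2 * s) ^ Fintype.card Pt) *
        (univ.filter fun y : U => Function.update u x y ∈ S).card := by
      intro u hu
      rw [hT, mem_filter] at hu
      obtain ⟨-, hu1, hu2⟩ := hu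
      have hpw : (2*s)^F.card ≤ (2*s)^Fintype.card Pt :=
        Nat.pow_le_pow_right (by omega) (card_le_univ _)
      have hCU : U.card ≤ (2*s)^Fintype.card Pt * (C u).card :=
        hu2.trans (Nat.mul_le_mul_right _ hpw)
      have hCbig : 2 * s ≤ (C u).card := by
        have : (2*s)^Fintype.card Pt * (2 * s) ≤ (2*s)^Fintype.card Pt * (C u).card := by
          refine le_trans (le_of_eq (mul_comm _ _)) (hU.trans hCU)
        exact Nat.le_of_mul_le_mul_left this (by positivity)
      have hfb := few_bad hK hs (C u) hCbig
      set Bad := (univ.filter fun v => 2 * s * ((C u).filter (fun w => ¬ G.Adj v w)).card < (C u).card)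
      have hsub : C u \ Bad ⊆ (univ.filter fun y : U => Function.update u x y ∈ S).image Subtype.val := by
        intro v hv
        rw [mem_sdiff] at hv
        obtain ⟨hvC, hvB⟩ := hv
        have hvU : v ∈ U := (mem_filter.1 hvC).1
        have hvF := (mem_filter.1 hvC).2
        rw [mem_image]
        refine ⟨⟨v, hvU⟩, ?_, rfl⟩
        rw [mem_filter]
        refine ⟨mem_univ _, ?_⟩
        have e2 : ∀ x' ∈ F, Function.update u x ⟨v, hvU⟩ x' = u x' := fun x' hx' =>
          Function.update_of_ne (by rintro rfl; exact hx hx') _ _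
        rw [hS, mem_filter]
        refine ⟨mem_univ _, ?_, ?_⟩
        · intro a ha b hb
          rw [mem_insert] at ha hb
          rcases ha with rfl | ha <;> rcases hb with rfl | hb
          · simp
          · rw [e2 b hb, Function.update_self]; exact fun h => hvF b hb h.symm
          · rw [e2 a ha, Function.update_self]; exact hvF a ha
          · rw [e2 a ha, e2 b hb]; exact hu1 a ha b hb
        · have heq : U.filter (fun y => ∀ x' ∈ insert x F,
              ¬ G.Adj (Function.update u x ⟨v, hvU⟩ x') y) = (C u).filter (fun w => ¬ G.Adj v w) := by
            ext y
            simp only [hC, mem_filter, forall_mem_insert, Function.update_self]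
            constructor
            · rintro ⟨h1, h2, h3⟩
              exact ⟨⟨h1, fun x' hx' => e2 x' hx' ▸ h3 x' hx'⟩, h2⟩
            · rintro ⟨⟨h1, h3⟩, h2⟩
              exact ⟨h1, h2, fun x' hx' => (e2 x' hx').symm ▸ h3 x' hx'⟩
          rw [heq, card_insert_of_notMem hx, pow_succ, mul_assoc]
          refine hu2.trans (Nat.mul_le_mul_left _ ?_)
          by_contra hlt
          push Not at hlt
          exact hvB (mem_filter.2 ⟨mem_univ _, hlt⟩)
      have h1 : (C u \ Bad).card ≤ (univ.filter fun y : U => Function.update u x y ∈ S).card :=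
        (card_le_card hsub).trans card_image_le
      have h2 : (C u).card ≤ (C u \ Bad).card + Bad.card := by
        have := le_card_sdiff Bad (C u); omega
      have h3 : (C u).card ≤ 2 * (univ.filter fun y : U => Function.update u x y ∈ S).card := by omega
      calc U.card ≤ (2*s)^Fintype.card Pt * (C u).card := hCU
        _ ≤ (2*s)^Fintype.card Pt * (2 * (univ.filter fun y : U => Function.update u x y ∈ S).card) :=
          Nat.mul_le_mul_left _ h3
        _ = _ := by ring
    have hTS : T.card ≤ (2 * (2 * s) ^ Fintype.card Pt) * S.card := by
      have h1 : U.card * T.card ≤ U.card * ((2 * (2 * s) ^ Fintype.card Pt) * S.card) := by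
        calc U.card * T.card = ∑ u ∈ T, U.card := by simp [mul_comm]
          _ ≤ ∑ u ∈ T, (2 * (2 * s) ^ Fintype.card Pt) *
            (univ.filter fun y : U => Function.update u x y ∈ S).card := sum_le_sum key
          _ ≤ ∑ u, (2 * (2 * s) ^ Fintype.card Pt) *
            (univ.filter fun y : U => Function.update u x y ∈ S).card :=
              sum_le_sum_of_subset (subset_univ _)
          _ = _ := by
            rw [← mul_sum, count_upd]; simp; ring
      exact Nat.le_of_mul_le_mul_left h1 hUpos
    rw [card_insert_of_notMem hx, pow_succ, mul_assoc]
    exact ih.trans (Nat.mul_le_mul_left _ hTS)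

end PolyDeg

namespace PolyDeg
open Finset
open scoped Classical

/-- polynomially bounded -/
def PB (f : ℕ → ℕ) : Prop := ∃ c : ℕ, ∀ x, 1 ≤ x → f x ≤ c * x ^ c

lemma PB.mono {f g : ℕ → ℕ} (hg : PB g) (h : ∀ x, 1 ≤ x → f x ≤ g x) : PB f := by
  obtain ⟨c, hc⟩ := hg
  exact ⟨c, fun x hx => (h x hx).trans (hc x hx)⟩

lemma PB.const (k : ℕ) : PB (fun _ => k) := ⟨k, fun _ hx => Nat.le_mul_of_pos_right _ (pow_pos hx _)⟩

lemma PB.id : PB (fun x => x) := ⟨1, fun x _ => by simp⟩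

lemma PB.add {f g : ℕ → ℕ} (hf : PB f) (hg : PB g) : PB (fun x => f x + g x) := by
  obtain ⟨a, ha⟩ := hf
  obtain ⟨b, hb⟩ := hg
  refine ⟨a + b, fun x hx => ?_⟩
  have h1 : x ^ a ≤ x ^ (a + b) := Nat.pow_le_pow_right hx (by omega)
  have h2 : x ^ b ≤ x ^ (a + b) := Nat.pow_le_pow_right hx (by omega)
  have h3 := Nat.mul_le_mul_left a h1
  have h4 := Nat.mul_le_mul_left b h2
  have := ha x hx
  have := hb x hx
  simp only
  rw [add_mul]
  omega

lemma PB.mul {f g : ℕ → ℕ} (hf : PB f) (hg : PB g) : PB (fun x => f x * g x) := by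
  obtain ⟨a, ha⟩ := hf
  obtain ⟨b, hb⟩ := hg
  refine ⟨a * b + a + b, fun x hx => ?_⟩
  calc f x * g x ≤ (a * x ^ a) * (b * x ^ b) := Nat.mul_le_mul (ha x hx) (hb x hx)
    _ = (a * b) * x ^ (a + b) := by ring
    _ ≤ (a * b + a + b) * x ^ (a * b + a + b) :=
      Nat.mul_le_mul (by omega) (Nat.pow_le_pow_right hx (by omega))

lemma PB.pow {f : ℕ → ℕ} (hf : PB f) (k : ℕ) : PB (fun x => f x ^ k) := by
  induction k with
  | zero => simpa using PB.const 1
  | succ k ih => simpa [pow_succ] using ih.mul hf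

lemma PB.comp {f g : ℕ → ℕ} (hf : PB f) (hg : PB g) (h1 : ∀ x, 1 ≤ x → 1 ≤ g x) :
    PB (fun x => f (g x)) := by
  obtain ⟨a, ha⟩ := hf
  exact ((PB.const a).mul (hg.pow a)).mono (fun x hx => ha _ (h1 x hx))

def kM (π s : ℕ) : ℕ := (2 * s) ^ (π ^ 2 + 1) * (s * π ^ 2 * (2 * s) ^ (π ^ 2))
def ka (π s : ℕ) : ℕ :=
  (2 * (2 * s) ^ (π ^ 2)) ^ (π ^ 2) * ((π ^ 2) * (π ^ 2 * s)) + 1 + 2 * s * (2 * s) ^ (π ^ 2)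

def ln {π : ℕ} [Fact π.Prime] (l : ZMod π × ZMod π) : Finset (ZMod π × ZMod π) :=
  univ.filter (fun p => p.2 = l.1 * p.1 + l.2)

lemma kst_core {V : Type} [Fintype V] {G : SimpleGraph V} {s K : ℕ} (hK : KFree G s)
    (hs : 1 ≤ s) (hN : NoSparse G K) (π : ℕ) [hp : Fact π.Prime] (hπ : K ≤ π) (d R : ℕ)
    (hd : R ^ (π + 1) * (kM π s ^ (π + 1) + ka π s) ≤ d) (X Y : Finset V) (hX : X.card ≤ d)
    (hY : Y.card ≤ d) : R * ∑ x ∈ X, (Y.filter (fun y => G.Adj x y)).card ≤ d ^ 2 := by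
  by_contra hcon
  push Not at hcon
  have hπ2 : 2 ≤ π := hp.out.two_le
  obtain ⟨U, hUX, hUa, hU⟩ := drc (ι := ZMod π) G X Y d R (kM π s) (ka π s) π (ZMod.card π) hX hY hcon hd
    (by unfold ka; omega)
  have hcPt : Fintype.card (ZMod π × ZMod π) = π ^ 2 := by
    rw [Fintype.card_prod, ZMod.card, sq]
  set h := π ^ 2 with hh
  have hh2 : 4 ≤ h := by rw [hh]; nlinarith
  have hUpos : 0 < U.card := lt_of_lt_of_le (by unfold ka; omega) hUa
  have hM1 : (2 * s) ^ (h + 1) ≤ kM π s := by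
    unfold kM
    exact Nat.le_mul_of_pos_right _ (by positivity)
  set Wf : ((ZMod π × ZMod π) → U) → (ZMod π × ZMod π) → Finset V := fun u l =>
    Y.filter (fun y => (∀ x ∈ ln l, G.Adj (u x) y) ∧ ∀ x ∈ (ln l)ᶜ, ¬ G.Adj (u x) y) with hWf
  set Bad : (ZMod π × ZMod π) → Finset ((ZMod π × ZMod π) → U) := fun l =>
    univ.filter (fun u => (2 * s) ^ ((ln l)ᶜ).card * (Wf u l).card < kM π s) with hBad
  have hbad : ∀ l, (Bad l).card * U.card ≤ h * s * U.card ^ h := by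
    intro l
    have := pattern_count hK hs U Y (ln l) (kM π s) (by
      intro u
      refine (hU (fun i => u (i, l.1 * i + l.2)) (fun i => (u _).2)).trans (card_le_card ?_)
      intro y hy
      rw [mem_filter] at hy ⊢
      refine ⟨hy.1, fun x hx => ?_⟩
      have e : x.2 = l.1 * x.1 + l.2 := (mem_filter.1 hx).2
      have := hy.2 x.1
      rw [← e] at this
      exact this) (by rw [hcPt]; exact hM1) (ln l)ᶜ disjoint_compl_left
    rw [hcPt] at this
    refine this.trans ?_
    have h1 : ((ln l)ᶜ).card ≤ h := by rw [← hcPt]; exact card_le_univ _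
    gcongr
  have hind := indep_count hK hs (Pt := ZMod π × ZMod π) U (by
    rw [hcPt]; refine le_trans ?_ hUa; unfold ka; rw [← hh]; omega) univ
  rw [card_univ, hcPt] at hind
  set N := (univ.filter (fun u : (ZMod π × ZMod π) → U => (∀ x ∈ univ, ∀ y ∈ univ, ¬ G.Adj (u x) (u y)) ∧
      U.card ≤ (2 * s) ^ h * (U.filter (fun y => ∀ x ∈ univ, ¬ G.Adj (u x) y)).card)) with hNdef
  have hex : ∃ u ∈ N, ∀ l, u ∉ Bad l := by
    by_contra hno
    push Not at hno
    have h1 : N ⊆ univ.biUnion Bad := by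
      intro u hu
      obtain ⟨l, hl⟩ := hno u hu
      exact mem_biUnion.2 ⟨l, mem_univ _, hl⟩
    have h2 : N.card * U.card ≤ h * (h * s * U.card ^ h) := by
      calc N.card * U.card ≤ (∑ l, (Bad l).card) * U.card :=
            Nat.mul_le_mul_right _ ((card_le_card h1).trans card_biUnion_le)
        _ = ∑ l, (Bad l).card * U.card := by rw [sum_mul]
        _ ≤ ∑ l : ZMod π × ZMod π, h * s * U.card ^ h := sum_le_sum (fun l _ => hbad l)
        _ = _ := by rw [sum_const, card_univ, hcPt, smul_eq_mul]
    have h3 : U.card ^ h * U.card ≤ U.card ^ h * ((2 * (2 * s) ^ h) ^ h * (h * (h * s))) := by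
      calc U.card ^ h * U.card ≤ (2 * (2 * s) ^ h) ^ h * N.card * U.card :=
            Nat.mul_le_mul_right _ hind
        _ = (2 * (2 * s) ^ h) ^ h * (N.card * U.card) := by ring
        _ ≤ (2 * (2 * s) ^ h) ^ h * (h * (h * s * U.card ^ h)) := Nat.mul_le_mul_left _ h2
        _ = _ := by ring
    have h4 := Nat.le_of_mul_le_mul_left h3 (by positivity)
    unfold ka at hUa
    rw [← hh] at hUa
    omega
  obtain ⟨u, huN, huB⟩ := hex
  have huI : ∀ x y, ¬ G.Adj (u x) (u y) := fun x y =>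
    (mem_filter.1 huN).2.1 x (mem_univ _) y (mem_univ _)
  have hWbig : ∀ l, s * h * (2 * s) ^ h ≤ (Wf u l).card := by
    intro l
    have h1 : kM π s ≤ (2 * s) ^ ((ln l)ᶜ).card * (Wf u l).card := by
      by_contra hlt
      push Not at hlt
      exact huB l (mem_filter.2 ⟨mem_univ _, hlt⟩)
    have h2 : (2 * s) ^ ((ln l)ᶜ).card ≤ (2 * s) ^ (h + 1) := by
      refine Nat.pow_le_pow_right (by omega) ?_
      have : ((ln l)ᶜ).card ≤ h := by rw [← hcPt]; exact card_le_univ _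
      omega
    have h3 := h1.trans (Nat.mul_le_mul_right _ h2)
    exact Nat.le_of_mul_le_mul_left h3 (by positivity)
  obtain ⟨v0, hv0⟩ := card_pos.1 hUpos
  obtain ⟨w, hw, hwI⟩ := indep_transversal hK hs v0 (ι := ZMod π × ZMod π) h (by omega) univ
    (Wf u) (by rw [card_univ, hcPt]) (by
      intro l _
      rw [card_univ, hcPt]
      exact hWbig l)
  have hadj : ∀ l x, G.Adj (u x) (w l) ↔ x ∈ ln l := by
    intro l x
    have := (mem_filter.1 (hw l (mem_univ _))).2
    constructor
    · intro h1
      by_contra h2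
      exact this.2 x (mem_compl.2 h2) h1
    · exact this.1 x
  have hln : ∀ l x : ZMod π × ZMod π, x ∈ ln l ↔ x.2 = l.1 * x.1 + l.2 := by
    intro l x; simp [ln]
  have huinj : Function.Injective (fun x => (u x : V)) := by
    intro x y hxy
    simp only at hxy
    have h1 : ∀ l, x ∈ ln l ↔ y ∈ ln l := by
      intro l; rw [← hadj, ← hadj, hxy]
    have h2 := (h1 (0, x.2)).1 (by rw [hln]; simp)
    have h3 := (h1 (1, x.2 - x.1)).1 (by rw [hln]; simp)
    rw [hln] at h2 h3
    simp at h2 h3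
    refine Prod.ext ?_ h2.symm
    rw [h2] at h3
    have : y.1 = x.1 := by linear_combination -h3
    exact this.symm
  have huniq : ∀ l l' x x' : ZMod π × ZMod π, x ≠ x' → x ∈ ln l → x' ∈ ln l → x ∈ ln l' → x' ∈ ln l' → l = l' := by
    intro l l' x x' hne h1 h2 h3 h4
    rw [hln] at h1 h2 h3 h4
    have hx1 : x.1 ≠ x'.1 := by
      intro h
      apply hne
      refine Prod.ext h ?_
      rw [h1, h2, h]
    have h5 : (l.1 - l'.1) * (x.1 - x'.1) = 0 := by linear_combination -h1 + h2 + h3 - h4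
    have h6 : l.1 = l'.1 := by
      rcases mul_eq_zero.1 h5 with h | h
      · exact sub_eq_zero.1 h
      · exact absurd (sub_eq_zero.1 h) hx1
    refine Prod.ext h6 ?_
    rw [h6] at h1
    linear_combination h3 - h1
  have hlcard : ∀ l : ZMod π × ZMod π, π ≤ (ln l).card := by
    intro l
    have : (univ : Finset (ZMod π)).image (fun i => (i, l.1 * i + l.2)) ⊆ ln l := by
      intro x hx
      obtain ⟨i, _, rfl⟩ := mem_image.1 hx
      rw [hln]
    refine le_trans (le_of_eq ?_) (card_le_card this)
    rw [card_image_of_injective, card_univ, ZMod.card]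
    intro i j hij
    exact (Prod.ext_iff.1 hij).1
  have hwinj : Function.Injective w := by
    intro l l' hll
    have h1 : ∀ x, x ∈ ln l ↔ x ∈ ln l' := by
      intro x; rw [← hadj, ← hadj, hll]
    refine huniq l l' (0, l.2) (1, l.1 + l.2) ?_ ?_ ?_ ?_ ?_
    · intro h; exact zero_ne_one (Prod.ext_iff.1 h).1
    · rw [hln]; simp
    · rw [hln]; simp
    · rw [← h1, hln]; simp
    · rw [← h1, hln]; simp
  refine hN (univ.image (fun x => (u x : V))) (univ.image w) ?_ ?_ ?_ ?_ ?_ ?_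
  · intro a ha b hb
    obtain ⟨x, _, rfl⟩ := mem_image.1 ha
    obtain ⟨y, _, rfl⟩ := mem_image.1 hb
    exact huI x y
  · intro a ha b hb
    obtain ⟨x, _, rfl⟩ := mem_image.1 ha
    obtain ⟨y, _, rfl⟩ := mem_image.1 hb
    exact hwI x (mem_univ _) y (mem_univ _)
  · rw [card_image_of_injective _ huinj, card_image_of_injective _ hwinj]
  · exact ⟨w 0, mem_image_of_mem _ (mem_univ _)⟩
  · intro b hb
    obtain ⟨l, _, rfl⟩ := mem_image.1 hb
    have : (ln l).image (fun x => (u x : V)) ⊆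
        (univ.image (fun x => (u x : V))).filter (fun a => G.Adj (w l) a) := by
      intro a ha
      obtain ⟨x, hx, rfl⟩ := mem_image.1 ha
      exact mem_filter.2 ⟨mem_image_of_mem _ (mem_univ _), ((hadj l x).2 hx).symm⟩
    refine le_trans ?_ (card_le_card this)
    rw [card_image_of_injective _ huinj]
    exact hπ.trans (hlcard l)
  · intro b hb b' hb' hbb a ha a' ha' haa h1 h2 h3 h4
    obtain ⟨l, _, rfl⟩ := mem_image.1 hb
    obtain ⟨l', _, rfl⟩ := mem_image.1 hb'
    obtain ⟨x, _, rfl⟩ := mem_image.1 ha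
    obtain ⟨x', _, rfl⟩ := mem_image.1 ha'
    apply hbb
    rw [huniq l l' x x' (fun h => haa (by rw [h])) ((hadj _ _).1 h1.symm) ((hadj _ _).1 h2.symm)
      ((hadj _ _).1 h3.symm) ((hadj _ _).1 h4.symm)]

lemma kst (K : ℕ) : ∃ c : ℕ, ∀ (V : Type) [Fintype V] (G : SimpleGraph V) (s d R : ℕ), 1 ≤ s →
    1 ≤ R → KFree G s → NoSparse G K → c * (s * R) ^ c ≤ d → ∀ X Y : Finset V, X.card ≤ d →
    Y.card ≤ d → R * ∑ x ∈ X, (Y.filter (fun y => G.Adj x y)).card ≤ d ^ 2 := by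
  obtain ⟨π, hπ, hp⟩ := Nat.exists_infinite_primes K
  have : Fact π.Prime := ⟨hp⟩
  have hPB : PB (fun x => x ^ (π + 1) * (kM π x ^ (π + 1) + ka π x)) := by
    have hx := PB.id
    have h2x : PB (fun x => 2 * x) := (PB.const 2).mul hx
    have hM : PB (fun x => kM π x) :=
      (h2x.pow _).mul ((hx.mul (PB.const _)).mul (h2x.pow _))
    have ha : PB (fun x => ka π x) :=
      (((((PB.const 2).mul (h2x.pow _)).pow _).mul ((PB.const _).mul ((PB.const _).mul hx))).add
        (PB.const 1)).add (h2x.mul (h2x.pow _))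
    exact (hx.pow _).mul ((hM.pow _).add ha)
  obtain ⟨c, hc⟩ := hPB
  refine ⟨c, fun V _ G s d R hs hR hK hN hd X Y hX hY => ?_⟩
  refine kst_core hK hs hN π hπ d R ?_ X Y hX hY
  refine le_trans ?_ ((hc (s * R) (Nat.mul_pos hs hR)).trans hd)
  have h1 : R ≤ s * R := Nat.le_mul_of_pos_left _ hs
  have h2 : s ≤ s * R := Nat.le_mul_of_pos_right _ hR
  beta_reduce
  unfold kM ka
  gcongr

end PolyDeg

namespace PolyDeg
open Finset
open scoped Classical

lemma greedy {V : Type} (G : SimpleGraph V) (δ m0 : ℕ) (X : Finset V) :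
    (∀ U ⊆ X, m0 < U.card → ∃ v ∈ U, (U.filter (fun w => G.Adj v w)).card ≤ δ) →
    ∃ I ⊆ X, Indep G I ∧ X.card ≤ I.card * (δ + 1) + m0 := by
  induction X using Finset.strongInduction with
  | H X ih =>
    intro h
    by_cases hX : X.card ≤ m0
    · exact ⟨∅, empty_subset _, by intro x hx; simp at hx, by simpa using hX⟩
    · push Not at hX
      obtain ⟨v, hv, hvd⟩ := h X (Subset.refl _) hX
      set X' := (X.filter (fun w => ¬ G.Adj v w)).erase v with hX'
      have hsub : X' ⊆ X := (erase_subset _ _).trans (filter_subset _ _)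
      have hss : X' ⊂ X := by
        refine (ssubset_iff_of_subset hsub).2 ⟨v, hv, by simp [hX']⟩
      obtain ⟨I, hI, hInd, hc⟩ := ih X' hss (fun U hU => h U (hU.trans hsub))
      have hvI : v ∉ I := fun hh => by
        have := hI hh
        simp [hX'] at this
      have hnadj : ∀ y ∈ I, ¬ G.Adj v y := fun y hy =>
        (mem_filter.1 (mem_of_mem_erase (hI hy))).2
      refine ⟨insert v I, ?_, ?_, ?_⟩
      · intro x hx
        rcases mem_insert.1 hx with rfl | hx
        · exact hv
        · exact hsub (hI hx)
      · intro x hx y hy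
        rcases mem_insert.1 hx with h1 | h1 <;> rcases mem_insert.1 hy with h2 | h2
        · rw [h1, h2]; exact G.loopless.irrefl _
        · rw [h1]; exact hnadj y h2
        · rw [h2]; exact fun hh => hnadj x h1 hh.symm
        · exact hInd x h1 y h2
      · rw [card_insert_of_notMem hvI]
        have h1 : X'.card + 1 = (X.filter (fun w => ¬ G.Adj v w)).card :=
          card_erase_add_one (mem_filter.2 ⟨hv, G.loopless.irrefl _⟩)
        have h2 := card_filter_add_card_filter_not (s := X) (fun w => G.Adj v w)
        rw [add_mul]
        omega

/-- weight of a set in the product measure -/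
noncomputable def wt {V : Type} [Fintype V] (q : ℝ) (A : Finset V) : ℝ :=
  q ^ A.card * (1 - q) ^ (univ \ A).card

noncomputable def Ex {V : Type} [Fintype V] (q : ℝ) (f : Finset V → ℝ) : ℝ := ∑ A, wt q A * f A

lemma wt_nonneg {V : Type} [Fintype V] {q : ℝ} (h0 : 0 ≤ q) (h1 : q ≤ 1) (A : Finset V) :
    0 ≤ wt q A := mul_nonneg (pow_nonneg h0 _) (pow_nonneg (by linarith) _)

lemma Ex_mono {V : Type} [Fintype V] {q : ℝ} (h0 : 0 ≤ q) (h1 : q ≤ 1) {f g : Finset V → ℝ}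
    (h : ∀ A, f A ≤ g A) : Ex q f ≤ Ex q g :=
  sum_le_sum (fun A _ => mul_le_mul_of_nonneg_left (h A) (wt_nonneg h0 h1 A))

lemma Ex_add {V : Type} [Fintype V] (q : ℝ) (f g : Finset V → ℝ) :
    Ex q (fun A => f A + g A) = Ex q f + Ex q g := by
  simp [Ex, mul_add, sum_add_distrib]

lemma Ex_sub {V : Type} [Fintype V] (q : ℝ) (f g : Finset V → ℝ) :
    Ex q (fun A => f A - g A) = Ex q f - Ex q g := by
  simp [Ex, mul_sub, sum_sub_distrib]

lemma Ex_mul {V : Type} [Fintype V] (q c : ℝ) (f : Finset V → ℝ) :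
    Ex q (fun A => c * f A) = c * Ex q f := by
  simp only [Ex, mul_sum]
  exact sum_congr rfl (fun A _ => by ring)

lemma Ex_sum {V ι : Type} [Fintype V] (q : ℝ) (s : Finset ι) (f : ι → Finset V → ℝ) :
    Ex q (fun A => ∑ i ∈ s, f i A) = ∑ i ∈ s, Ex q (f i) := by
  simp only [Ex, mul_sum]
  rw [sum_comm]

lemma Ex_ind {V : Type} [Fintype V] (q : ℝ) (S T : Finset V) (h : Disjoint S T) :
    Ex q (fun A => if S ⊆ A ∧ Disjoint T A then 1 else 0) = q ^ S.card * (1 - q) ^ T.card := by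
  have key := Finset.prod_add (fun i => if i ∈ T then (0:ℝ) else q)
    (fun i => if i ∈ S then (0:ℝ) else 1 - q) (univ : Finset V)
  have hl : ∏ i : V, ((if i ∈ T then (0:ℝ) else q) + (if i ∈ S then (0:ℝ) else 1 - q)) =
      q ^ S.card * (1 - q) ^ T.card := by
    have : ∀ i : V, ((if i ∈ T then (0:ℝ) else q) + (if i ∈ S then (0:ℝ) else 1 - q)) =
        (if i ∈ S then q else 1) * (if i ∈ T then 1 - q else 1) := by
      intro i
      by_cases hS : i ∈ S
      · have hT : i ∉ T := Finset.disjoint_left.1 h hS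
        simp [hS, hT]
      · by_cases hT : i ∈ T <;> simp [hS, hT]
    rw [prod_congr rfl (fun i _ => this i), prod_mul_distrib, prod_ite_mem, prod_ite_mem]
    simp
  rw [hl] at key
  rw [key, Ex, powerset_univ]
  refine sum_congr rfl (fun A _ => ?_)
  by_cases hA : S ⊆ A ∧ Disjoint T A
  · rw [if_pos hA, mul_one, wt]
    congr 1
    · rw [prod_congr rfl (g := fun _ => q), prod_const]
      intro i hi
      rw [if_neg]
      exact fun hT => Finset.disjoint_left.1 hA.2 hT hi
    · rw [prod_congr rfl (g := fun _ => 1 - q), prod_const]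
      intro i hi
      rw [if_neg]
      exact fun hS => (mem_sdiff.1 hi).2 (hA.1 hS)
  · rw [if_neg hA, mul_zero]
    by_cases h1 : S ⊆ A
    · have h2 : ¬ Disjoint T A := fun hh => hA ⟨h1, hh⟩
      rw [not_disjoint_iff] at h2
      obtain ⟨i, hT, hiA⟩ := h2
      rw [prod_eq_zero hiA (by simp [hT]), zero_mul]
    · rw [not_subset] at h1
      obtain ⟨i, hS, hiA⟩ := h1
      rw [prod_eq_zero (i := i) (s := univ \ A) (by simp [hiA]) (by simp [hS]), mul_zero]

lemma Ex_sub_ind {V : Type} [Fintype V] (q : ℝ) (S : Finset V) :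
    Ex q (fun A => if S ⊆ A then 1 else 0) = q ^ S.card := by
  have := Ex_ind q S ∅ (disjoint_empty_right _)
  simpa using this

lemma Ex_one {V : Type} [Fintype V] (q : ℝ) : Ex q (fun _ : Finset V => 1) = 1 := by
  have := Ex_sub_ind q (∅ : Finset V)
  simpa using this

lemma Ex_mem {V : Type} [Fintype V] (q : ℝ) (v : V) :
    Ex q (fun A => if v ∈ A then 1 else 0) = q := by
  have := Ex_sub_ind q ({v} : Finset V)
  simpa using this

/-- degeneracy data -/
structure Deg {V : Type} (G : SimpleGraph V) (d : ℕ) where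
  Nb : V → Finset V
  f : V → ℕ
  adj_iff : ∀ u v, G.Adj u v ↔ u ∈ Nb v ∨ v ∈ Nb u
  lt : ∀ u v, u ∈ Nb v → f u < f v
  card_le : ∀ v, (Nb v).card ≤ d

lemma Deg.indep {V : Type} {G : SimpleGraph V} {d : ℕ} (D : Deg G d) (X : Finset V) :
    ∃ I ⊆ X, Indep G I ∧ X.card ≤ I.card * (d + 1) := by
  have := greedy G d 0 X (by
    intro U _ hU
    obtain ⟨v, hv, hmax⟩ := exists_max_image U D.f (card_pos.1 hU)
    refine ⟨v, hv, (card_le_card ?_).trans (D.card_le v)⟩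
    intro w hw
    rw [mem_filter, D.adj_iff] at hw
    rcases hw.2 with h | h
    · have := D.lt _ _ h
      have := hmax w hw.1
      omega
    · exact h)
  simpa using this

lemma case1 {V : Type} [Fintype V] {G : SimpleGraph V} {d P : ℕ} (D : Deg G d) (hd : 1 ≤ d)
    (hND : NoDense G P) (H L : Finset V)
    (hI : ∀ v ∈ L, ∃ I ⊆ D.Nb v ∩ H, Indep G I ∧ I.card = P) :
    L.card ≤ (4 * d) ^ P * (d + 1) * H.card := by
  choose! I hIs hIi hIc using hI
  set A : Finset V → Finset V := fun A0 => (H ∩ A0).filter (fun u => Disjoint (D.Nb u ∩ H) A0) with hA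
  have hAi : ∀ A0, Indep G (A A0) := by
    have : ∀ A0, ∀ x ∈ A A0, ∀ y ∈ A A0, x ∉ D.Nb y := by
      intro A0 x hx y hy hxy
      rw [hA, mem_filter, mem_inter] at hx hy
      exact Finset.disjoint_left.1 hy.2 (mem_inter.2 ⟨hxy, hx.1.1⟩) hx.1.2
    intro A0 x hx y hy h
    rw [D.adj_iff] at h
    exact h.elim (this A0 x hx y hy) (this A0 y hy x hx)
  have hdet : ∀ A0, (L.filter (fun v => I v ⊆ A A0)).card ≤ H.card * (d + 1) := by
    intro A0
    obtain ⟨B, hBs, hBi, hBc⟩ := D.indep (L.filter (fun v => I v ⊆ A A0))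
    refine hBc.trans (Nat.mul_le_mul_right _ ?_)
    by_contra hlt
    push Not at hlt
    have hAH : (A A0).card ≤ H.card :=
      card_le_card ((filter_subset _ _).trans inter_subset_left)
    refine hND (A A0) B (hAi A0) hBi (by omega) (card_pos.1 (by omega)) ?_
    intro b hb
    have hb' := mem_filter.1 (hBs hb)
    rw [← hIc b hb'.1]
    refine card_le_card (fun a ha => mem_filter.2 ⟨hb'.2 ha, ?_⟩)
    rw [D.adj_iff]
    exact Or.inr (mem_inter.1 (hIs b hb'.1 ha)).1
  have hd' : (1:ℝ) ≤ d := by exact_mod_cast hd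
  set q : ℝ := 1 / (2 * d) with hq
  have hq0 : 0 < q := by positivity
  have hq1 : q ≤ 1 / 2 := by
    rw [hq]; exact one_div_le_one_div_of_le (by norm_num) (by linarith)
  have hlow : ∀ v ∈ L, (1 / (4 * d : ℝ)) ^ P ≤ Ex q (fun A0 => if I v ⊆ A A0 then 1 else 0) := by
    intro v hv
    set T := (I v).biUnion (fun u => D.Nb u ∩ H) with hT
    have hdis : Disjoint (I v) T := by
      rw [Finset.disjoint_left]
      intro x hx hxT
      obtain ⟨u, hu, hxu⟩ := mem_biUnion.1 hxT
      exact hIi v hv x hx u hu ((D.adj_iff _ _).2 (Or.inl (mem_inter.1 hxu).1))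
    have heq : ∀ A0, (I v ⊆ A0 ∧ Disjoint T A0) ↔ I v ⊆ A A0 := by
      intro A0
      constructor
      · rintro ⟨h1, h2⟩ u hu
        refine mem_filter.2 ⟨mem_inter.2 ⟨(mem_inter.1 (hIs v hv hu)).2, h1 hu⟩, ?_⟩
        exact disjoint_of_subset_left (subset_biUnion_of_mem (fun u => D.Nb u ∩ H) hu) h2
      · intro h
        refine ⟨fun u hu => (mem_inter.1 (mem_filter.1 (h hu)).1).2, ?_⟩
        rw [hT, disjoint_biUnion_left]
        exact fun u hu => (mem_filter.1 (h hu)).2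
    have := Ex_ind q (I v) T hdis
    simp only [heq] at this
    rw [this, hIc v hv]
    have hTc : T.card ≤ d * P := by
      rw [mul_comm, ← hIc v hv]
      exact card_biUnion_le_card_mul _ _ _ (fun u _ =>
        (card_le_card inter_subset_left).trans (D.card_le u))
    have hbern : (1:ℝ) / 2 ≤ (1 - q) ^ d := by
      have := one_add_mul_le_pow (a := -q) (by linarith) d
      have h2 : (d:ℝ) * q = 1 / 2 := by rw [hq]; field_simp
      calc (1:ℝ)/2 = 1 + d * (-q) := by linarith
        _ ≤ _ := by simpa [sub_eq_add_neg] using this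
    calc (1 / (4 * d : ℝ)) ^ P = q ^ P * (1 / 2) ^ P := by
          rw [← mul_pow, hq]; congr 1; field_simp; norm_num
      _ ≤ q ^ P * ((1 - q) ^ d) ^ P := by gcongr
      _ = q ^ P * (1 - q) ^ (d * P) := by rw [pow_mul]
      _ ≤ q ^ P * (1 - q) ^ T.card := by
        gcongr ?_ * ?_
        exact pow_le_pow_of_le_one (by linarith) (by linarith) hTc
  have hE : (L.card : ℝ) * (1 / (4 * d : ℝ)) ^ P ≤ H.card * (d + 1) := by
    calc (L.card : ℝ) * (1 / (4 * d : ℝ)) ^ P = ∑ v ∈ L, (1 / (4 * d : ℝ)) ^ P := by simp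
      _ ≤ ∑ v ∈ L, Ex q (fun A0 => if I v ⊆ A A0 then 1 else 0) := sum_le_sum hlow
      _ = Ex q (fun A0 => ∑ v ∈ L, if I v ⊆ A A0 then 1 else 0) := (Ex_sum _ _ _).symm
      _ ≤ Ex q (fun _ => (H.card * (d + 1)) * 1) := by
        refine Ex_mono hq0.le (by linarith) (fun A0 => ?_)
        have h1 := hdet A0
        rw [mul_one]
        have h2 : ((L.filter (fun v => I v ⊆ A A0)).card : ℝ) ≤ H.card * (d + 1) := by
          exact_mod_cast h1
        rw [card_filter] at h2
        push_cast at h2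
        exact h2
      _ = H.card * (d + 1) := by rw [Ex_mul, Ex_one, mul_one]
  have h4 : (0:ℝ) < (4 * d) ^ P := by positivity
  rw [one_div, inv_pow, ← div_eq_mul_inv, div_le_iff₀ h4] at hE
  have h5 : (L.card : ℝ) ≤ ((4 * d) ^ P * (d + 1) * H.card : ℕ) := by
    push_cast; linarith
  exact_mod_cast h5

/-- the consequence of KST we use -/
def KST {V : Type} (G : SimpleGraph V) (d R : ℕ) : Prop :=
  ∀ X Y : Finset V, X.card ≤ d → Y.card ≤ d →
    R * ∑ x ∈ X, (Y.filter (fun y => G.Adj x y)).card ≤ d ^ 2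

lemma indep_in {V : Type} {G : SimpleGraph V} {d R P : ℕ} (hK : KST G d R) (hP : 1 ≤ P)
    (hR : 4096 * P < R) (hdP : 64 * P ≤ d) (X : Finset V) (hX : X.card ≤ d)
    (hX2 : d ≤ 16 * X.card) : ∃ I ⊆ X, Indep G I ∧ I.card = P := by
  obtain ⟨I, hI, hInd, hc⟩ := greedy G (d / (64 * P)) (d / 64) X (by
    intro U hU hUc
    by_contra hcon
    push Not at hcon
    have h1 := hK U U ((card_le_card hU).trans hX) ((card_le_card hU).trans hX)
    have h2 : U.card * (d / (64 * P) + 1) ≤ ∑ x ∈ U, (U.filter (fun y => G.Adj x y)).card := by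
      calc U.card * (d / (64 * P) + 1) = ∑ x ∈ U, (d / (64 * P) + 1) := by simp
        _ ≤ _ := sum_le_sum (fun x hx => hcon x hx)
    have h3 : d ≤ 64 * U.card := by omega
    have h4 : d ≤ 64 * P * (d / (64 * P) + 1) := (Nat.lt_mul_div_succ d (by omega)).le
    have h5 : d * d ≤ 4096 * P * (U.card * (d / (64 * P) + 1)) := by
      calc d * d ≤ (64 * U.card) * (64 * P * (d / (64 * P) + 1)) := Nat.mul_le_mul h3 h4
        _ = _ := by ring
    have h6 : 0 < U.card * (d / (64 * P) + 1) := Nat.mul_pos (by omega) (Nat.succ_pos _)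
    have h7 : 4096 * P * (U.card * (d / (64 * P) + 1)) < R * (U.card * (d / (64 * P) + 1)) :=
      Nat.mul_lt_mul_of_pos_right hR h6
    have h8 := Nat.mul_le_mul_left R h2
    rw [sq] at h1
    omega)
  have hIP : P ≤ I.card := by
    by_contra hlt
    push Not at hlt
    have h1 : I.card * (d / (64 * P) + 1) ≤ P * (d / (64 * P) + 1) := Nat.mul_le_mul_right _ hlt.le
    have h2 : P * (d / (64 * P)) ≤ d / 64 := by
      rw [← Nat.div_div_eq_div_mul]; exact Nat.mul_div_le _ _
    have h3 : P * (d / (64 * P) + 1) = P * (d / (64 * P)) + P := by ring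
    omega
  obtain ⟨I', hI', hc'⟩ := exists_subset_card_eq hIP
  exact ⟨I', hI'.trans hI, fun x hx y hy => hInd x (hI' hx) y (hI' hy), hc'⟩

end PolyDeg

namespace PolyDeg
open Finset
open scoped Classical

noncomputable def ind (p : Prop) : ℝ := if p then 1 else 0

lemma ind_nonneg (p : Prop) : 0 ≤ ind p := by unfold ind; split_ifs <;> norm_num
lemma ind_le_one (p : Prop) : ind p ≤ 1 := by unfold ind; split_ifs <;> norm_num
lemma ind_true {p : Prop} (h : p) : ind p = 1 := by unfold ind; rw [if_pos h]
lemma ind_false {p : Prop} (h : ¬ p) : ind p = 0 := by unfold ind; rw [if_neg h]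
lemma sum_ind {α : Type} (s : Finset α) (p : α → Prop) [DecidablePred p] :
    ∑ x ∈ s, ind (p x) = ((s.filter p).card : ℝ) := by
  rw [card_filter]
  push_cast
  refine sum_congr rfl (fun x _ => ?_)
  unfold ind
  split_ifs <;> rfl

/-! counting subsets -/
lemma card_sup {V : Type} (T Z : Finset V) (k : ℕ) (hZ : Z ⊆ T) :
    ((powersetCard (k + Z.card) T).filter (fun S => Z ⊆ S)).card = (T.card - Z.card).choose k := by
  rw [← card_sdiff_of_subset hZ, ← card_powersetCard]
  refine card_bij' (fun S _ => S \ Z) (fun S _ => S ∪ Z) ?_ ?_ ?_ ?_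
  · intro S hS
    rw [mem_filter, mem_powersetCard] at hS
    rw [mem_powersetCard]
    refine ⟨sdiff_subset_sdiff hS.1.1 (Subset.refl _), ?_⟩
    rw [card_sdiff_of_subset hS.2]; omega
  · intro S hS
    rw [mem_powersetCard] at hS
    rw [mem_filter, mem_powersetCard]
    refine ⟨⟨union_subset (hS.1.trans sdiff_subset) hZ, ?_⟩, subset_union_right⟩
    rw [card_union_of_disjoint, hS.2]
    exact disjoint_of_subset_left hS.1 sdiff_disjoint
  · intro S hS
    rw [mem_filter] at hS
    exact sdiff_union_of_subset hS.2
  · intro S hS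
    rw [mem_powersetCard] at hS
    exact union_sdiff_cancel_right (disjoint_of_subset_left hS.1 sdiff_disjoint)

lemma count_one {V : Type} (T : Finset V) (K : ℕ) (a : V) (ha : a ∈ T) :
    (T.card : ℝ) * ∑ S ∈ powersetCard K T, ind (a ∈ S) ≤ K * (T.card.choose K) := by
  rw [sum_ind]
  rcases K with _ | k
  · simp [filter_singleton]
  · have h := card_sup T {a} k (by simpa using ha)
    simp only [card_singleton, singleton_subset_iff] at h
    rw [h]
    obtain ⟨m, hm⟩ : ∃ m, T.card = m + 1 := ⟨T.card - 1, by
      have := card_pos.2 ⟨a, ha⟩; omega⟩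
    rw [hm, Nat.add_sub_cancel]
    have := Nat.add_one_mul_choose_eq m k
    have h2 : ((m + 1 : ℕ) : ℝ) * (m.choose k) = ((k + 1 : ℕ) : ℝ) * ((m+1).choose (k+1)) := by
      rw [mul_comm ((k+1 : ℕ) : ℝ)]
      exact_mod_cast this
    exact h2.le

lemma count_two {V : Type} (T : Finset V) (K : ℕ) (a b : V) (ha : a ∈ T) (hb : b ∈ T) (hab : a ≠ b) :
    (T.card : ℝ) ^ 2 * ∑ S ∈ powersetCard K T, ind (a ∈ S ∧ b ∈ S) ≤ K ^ 2 * (T.card.choose K) := by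
  rw [sum_ind]
  rcases K with _ | _ | k
  · simp [filter_singleton]
  · rw [filter_false_of_mem]
    · simp
    · rintro S hS ⟨h1, h2⟩
      rw [mem_powersetCard, zero_add, card_eq_one] at hS
      obtain ⟨x, hx⟩ := hS.2
      rw [hx, mem_singleton] at h1 h2
      exact hab (h1.trans h2.symm)
  · have hc : ({a, b} : Finset V).card = 2 := card_pair hab
    have hsub : ({a, b} : Finset V) ⊆ T := by
      intro x hx; simp at hx; rcases hx with rfl | rfl <;> assumption
    have h := card_sup T {a, b} k hsub
    simp only [hc, insert_subset_iff, singleton_subset_iff] at h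
    have ht := card_le_card hsub
    rw [hc] at ht
    rw [show k + 1 + 1 = k + 2 by omega, h]
    obtain ⟨m, hm⟩ : ∃ m, T.card = m + 2 := ⟨T.card - 2, by omega⟩
    rw [hm, Nat.add_sub_cancel]
    rcases lt_or_ge m k with hlt | hge
    · rw [Nat.choose_eq_zero_of_lt hlt]; simp; positivity
    · have h1 := Nat.add_one_mul_choose_eq m k
      have h2 := Nat.add_one_mul_choose_eq (m+1) (k+1)
      rw [show m + 1 + 1 = m + 2 by omega, show k + 1 + 1 = k + 2 by omega] at h2
      have h3 : (m + 1) * ((m + 2) ^ 2 * m.choose k) ≤ (m + 1) * ((k + 2) ^ 2 * (m + 2).choose (k + 2)) := by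
        calc (m + 1) * ((m + 2) ^ 2 * m.choose k) = (m + 2) * ((m + 2) * ((m + 1) * m.choose k)) := by ring
          _ = (m + 2) * (k + 1) * ((m + 2) * (m+1).choose (k+1)) := by rw [h1]; ring
          _ = ((m + 2) * (k + 1)) * ((k + 2) * (m + 2).choose (k + 2)) := by rw [h2]; ring
          _ ≤ ((m + 1) * (k + 2)) * ((k + 2) * (m + 2).choose (k + 2)) := by
            apply Nat.mul_le_mul_right; nlinarith
          _ = _ := by ring
      have h4 := Nat.le_of_mul_le_mul_left h3 (by omega)
      exact_mod_cast h4

lemma wcount_one {V : Type} (T : Finset V) (K : ℕ) (w : V → ℝ) (hw : ∀ a, 0 ≤ w a) :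
    ∑ S ∈ powersetCard K T, ∑ a ∈ S, w a ≤
      ((K : ℝ) / T.card) * (T.card.choose K) * ∑ a ∈ T, w a := by
  have h1 : ∑ S ∈ powersetCard K T, ∑ a ∈ S, w a =
      ∑ a ∈ T, w a * ∑ S ∈ powersetCard K T, ind (a ∈ S) := by
    simp_rw [mul_sum]
    rw [sum_comm]
    refine sum_congr rfl (fun S hS => ?_)
    rw [mem_powersetCard] at hS
    rw [← sum_subset hS.1 (fun a _ ha => by rw [ind_false ha, mul_zero])]
    exact sum_congr rfl (fun a ha => by rw [ind_true ha, mul_one])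
  rw [h1, mul_sum]
  refine sum_le_sum (fun a ha => ?_)
  rw [mul_comm (w a)]
  refine mul_le_mul_of_nonneg_right ?_ (hw a)
  have ht : (0:ℝ) < T.card := by exact_mod_cast card_pos.2 ⟨a, ha⟩
  have := count_one T K a ha
  rw [div_mul_eq_mul_div, le_div_iff₀ ht]
  linarith

lemma wcount_two {V : Type} (T : Finset V) (K : ℕ) (w : V → V → ℝ) (hw : ∀ a b, 0 ≤ w a b)
    (hd : ∀ a, w a a = 0) :
    ∑ S ∈ powersetCard K T, ∑ a ∈ S, ∑ b ∈ S, w a b ≤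
      ((K : ℝ) / T.card) ^ 2 * (T.card.choose K) * ∑ a ∈ T, ∑ b ∈ T, w a b := by
  have h1 : ∑ S ∈ powersetCard K T, ∑ a ∈ S, ∑ b ∈ S, w a b =
      ∑ a ∈ T, ∑ b ∈ T, w a b * ∑ S ∈ powersetCard K T, ind (a ∈ S ∧ b ∈ S) := by
    simp_rw [mul_sum]
    have : ∀ a ∈ T, ∑ b ∈ T, ∑ S ∈ powersetCard K T, w a b * ind (a ∈ S ∧ b ∈ S) =
      ∑ S ∈ powersetCard K T, ∑ b ∈ T, w a b * ind (a ∈ S ∧ b ∈ S) := fun a _ => sum_comm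
    rw [sum_congr rfl this, sum_comm]
    refine sum_congr rfl (fun S hS => ?_)
    rw [mem_powersetCard] at hS
    rw [← sum_subset hS.1 (fun a _ ha => sum_eq_zero (fun b _ => by
      rw [ind_false (fun h => ha h.1), mul_zero]))]
    refine sum_congr rfl (fun a ha => ?_)
    rw [← sum_subset hS.1 (fun b _ hb => by rw [ind_false (fun h => hb h.2), mul_zero])]
    exact sum_congr rfl (fun b hb => by rw [ind_true ⟨ha, hb⟩, mul_one])
  rw [h1, mul_sum]
  refine sum_le_sum (fun a ha => ?_)
  rw [mul_sum]
  refine sum_le_sum (fun b hb => ?_)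
  rw [mul_comm (w a b)]
  by_cases hab : a = b
  · subst hab; rw [hd]; simp
  refine mul_le_mul_of_nonneg_right ?_ (hw a b)
  have ht : (0:ℝ) < T.card := by exact_mod_cast card_pos.2 ⟨a, ha⟩
  have := count_two T K a b ha hb hab
  rw [div_pow, div_mul_eq_mul_div, le_div_iff₀ (by positivity)]
  linarith

section case2
variable {V : Type} [Fintype V] {G : SimpleGraph V} {d : ℕ}

noncomputable def Tb (D : Deg G d) (H : Finset V) (v : V) : Finset V := D.Nb v ∩ H

def act (D : Deg G d) (H L : Finset V) (K : ℕ) (A B : Finset V) (u : V) : Prop :=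
  u ∈ L ∧ u ∈ B ∧ K ≤ (Tb D H u ∩ A).card

def inB (D : Deg G d) (H L : Finset V) (K : ℕ) (A B : Finset V) (v : V) : Prop :=
  v ∈ L ∧ v ∈ B ∧ (Tb D H v ∩ A).card = K ∧
  (∀ a ∈ Tb D H v ∩ A, Disjoint (Tb D H a) A) ∧
  (∀ u ∈ D.Nb v, ¬ act D H L K A B u) ∧
  (∀ a ∈ Tb D H v ∩ A, ∀ u ∈ D.Nb a, ¬ act D H L K A B u) ∧
  (∀ v' ∈ L, v' ∈ B → v' ≠ v → ∀ a ∈ Tb D H v ∩ A, ∀ b ∈ Tb D H v ∩ A, a ≠ b →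
    a ∈ Tb D H v' → b ∈ Tb D H v' → False)

lemma det2 (D : Deg G d) (H L : Finset V) (K : ℕ) (hN : NoSparse G K) (A0 B0 : Finset V) :
    (univ.filter (fun v => inB D H L K A0 B0 v)).card ≤ (H ∩ A0).card := by
  set B := univ.filter (fun v => inB D H L K A0 B0 v) with hB
  set A := (H ∩ A0).filter (fun a => Disjoint (Tb D H a) A0 ∧ ∀ u ∈ D.Nb a, ¬ act D H L K A0 B0 u) with hA
  have hAc : A.card ≤ (H ∩ A0).card := card_le_card (filter_subset _ _)
  have hact : ∀ b ∈ B, act D H L K A0 B0 b := by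
    intro b hb
    obtain ⟨h1, h2, h3, -⟩ := (mem_filter.1 hb).2
    exact ⟨h1, h2, h3.ge⟩
  by_contra hlt
  push Not at hlt
  have hBA : ∀ b ∈ B, ∀ a ∈ A, G.Adj b a → a ∈ Tb D H b ∩ A0 := by
    intro b hb a ha hadj
    have ha' := mem_filter.1 ha
    have haH := mem_inter.1 ha'.1
    rcases (D.adj_iff _ _).1 hadj with h | h
    · exact absurd (hact b hb) (ha'.2.2 b h)
    · exact mem_inter.2 ⟨mem_inter.2 ⟨h, haH.1⟩, haH.2⟩
  refine hN A B ?_ ?_ (by omega) (card_pos.1 (by omega)) ?_ ?_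
  · have : ∀ x ∈ A, ∀ y ∈ A, x ∉ D.Nb y := by
      intro x hx y hy hxy
      have hx' := mem_inter.1 (mem_filter.1 hx).1
      exact Finset.disjoint_left.1 (mem_filter.1 hy).2.1 (mem_inter.2 ⟨hxy, hx'.1⟩) hx'.2
    intro x hx y hy h
    exact ((D.adj_iff _ _).1 h).elim (this x hx y hy) (this y hy x hx)
  · have : ∀ x ∈ B, ∀ y ∈ B, x ∉ D.Nb y := by
      intro x hx y hy hxy
      obtain ⟨-, -, -, -, h5, -⟩ := (mem_filter.1 hy).2
      exact h5 x hxy (hact x hx)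
    intro x hx y hy h
    exact ((D.adj_iff _ _).1 h).elim (this x hx y hy) (this y hy x hx)
  · intro b hb
    obtain ⟨h1, h2, h3, h4, h5, h6, h7⟩ := (mem_filter.1 hb).2
    rw [← h3]
    refine card_le_card (fun a ha => ?_)
    have ha1 := mem_inter.1 ha
    have ha2 := mem_inter.1 ha1.1
    refine mem_filter.2 ⟨mem_filter.2 ⟨mem_inter.2 ⟨ha2.2, ha1.2⟩, h4 a ha, h6 a ha⟩, ?_⟩
    exact (D.adj_iff _ _).2 (Or.inr ha2.1)
  · intro b hb b' hb' hbb a ha a' ha' haa e1 e2 e3 e4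
    obtain ⟨h1, h2, h3, h4, h5, h6, h7⟩ := (mem_filter.1 hb).2
    obtain ⟨g1, g2, -⟩ := (mem_filter.1 hb').2
    exact h7 b' g1 g2 (Ne.symm hbb) a (hBA b hb a ha e1) a' (hBA b hb a' ha' e2) haa
      (mem_inter.1 (hBA b' hb' a ha e3)).1 (mem_inter.1 (hBA b' hb' a' ha' e4)).1

end case2

end PolyDeg

namespace PolyDeg
open Finset
open scoped Classical

section case2
variable {V : Type} [Fintype V] {G : SimpleGraph V} {d : ℕ}

def evt (D : Deg G d) (H : Finset V) (v : V) (S0 A : Finset V) : Prop :=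
  S0 ⊆ A ∧ Disjoint (Tb D H v \ S0) A

noncomputable def xf (D : Deg G d) (H : Finset V) (v : V) (S0 A : Finset V) : ℝ :=
  ∑ a ∈ S0, ∑ b ∈ S0, ind (b ∈ D.Nb a) + ∑ a ∈ S0, ∑ c ∈ Tb D H a \ Tb D H v, ind ({c} ⊆ A)

noncomputable def h1 (D : Deg G d) (H : Finset V) (v : V) (S0 : Finset V) (u : V) : ℝ :=
  ∑ b ∈ S0, ind (u ∈ D.Nb v ∧ b ∈ Tb D H u)

noncomputable def h2 (D : Deg G d) (H : Finset V) (S0 : Finset V) (u : V) : ℝ :=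
  ∑ a ∈ S0, ∑ b ∈ S0, (ind (u ∈ D.Nb a ∧ b ∈ Tb D H u) + ind (a ≠ b ∧ a ∈ Tb D H u ∧ b ∈ Tb D H u))

noncomputable def h3 (D : Deg G d) (v : V) (S0 : Finset V) (u : V) : ℝ :=
  ind (u ∈ D.Nb v) + ∑ a ∈ S0, ind (u ∈ D.Nb a)

noncomputable def hf (D : Deg G d) (H : Finset V) (K : ℕ) (v : V) (S0 : Finset V) (u : V) (A : Finset V) : ℝ :=
  h1 D H v S0 u + h2 D H S0 u +
    h3 D v S0 u * ∑ S ∈ powersetCard K (Tb D H u \ Tb D H v), ind (S ⊆ A)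

lemma xf_nonneg (D : Deg G d) (H : Finset V) (v : V) (S0 A : Finset V) : 0 ≤ xf D H v S0 A :=
  add_nonneg (sum_nonneg (fun _ _ => sum_nonneg (fun _ _ => ind_nonneg _)))
    (sum_nonneg (fun _ _ => sum_nonneg (fun _ _ => ind_nonneg _)))

lemma h1_nonneg (D : Deg G d) (H : Finset V) (v : V) (S0 : Finset V) (u : V) : 0 ≤ h1 D H v S0 u :=
  sum_nonneg (fun _ _ => ind_nonneg _)

lemma h2_nonneg (D : Deg G d) (H : Finset V) (S0 : Finset V) (u : V) : 0 ≤ h2 D H S0 u :=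
  sum_nonneg (fun _ _ => sum_nonneg (fun _ _ => add_nonneg (ind_nonneg _) (ind_nonneg _)))

lemma h3_nonneg (D : Deg G d) (v : V) (S0 : Finset V) (u : V) : 0 ≤ h3 D v S0 u :=
  add_nonneg (ind_nonneg _) (sum_nonneg (fun _ _ => ind_nonneg _))

lemma hs_nonneg (T A : Finset V) (K : ℕ) :
    (0:ℝ) ≤ ∑ S ∈ powersetCard K T, ind (S ⊆ A) := sum_nonneg (fun _ _ => ind_nonneg _)

lemma hf_nonneg (D : Deg G d) (H : Finset V) (K : ℕ) (v : V) (S0 : Finset V) (u : V) (A : Finset V) :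
    0 ≤ hf D H K v S0 u A :=
  add_nonneg (add_nonneg (h1_nonneg _ _ _ _ _) (h2_nonneg _ _ _ _))
    (mul_nonneg (h3_nonneg _ _ _ _) (hs_nonneg _ _ _))

lemma ind_le_sum {α : Type} {s : Finset α} {f : α → ℝ} (hf : ∀ i ∈ s, 0 ≤ f i) {a : α} (ha : a ∈ s)
    (h : 1 ≤ f a) : 1 ≤ ∑ i ∈ s, f i := h.trans (single_le_sum hf ha)

lemma evt_eq {D : Deg G d} {H : Finset V} {v : V} {S0 A : Finset V} (hS : S0 ⊆ Tb D H v)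
    (h : evt D H v S0 A) : Tb D H v ∩ A = S0 := by
  ext x
  rw [mem_inter]
  constructor
  · rintro ⟨h1, h2⟩
    by_contra h3
    exact Finset.disjoint_left.1 h.2 (mem_sdiff.2 ⟨h1, h3⟩) h2
  · intro hx; exact ⟨hS hx, h.1 hx⟩

lemma hf_act {D : Deg G d} {H L : Finset V} {K : ℕ} {v : V} {S0 A B : Finset V} {u : V}
    (hS : S0 ⊆ Tb D H v)
    (he : evt D H v S0 A) (hact : act D H L K A B u)
    (hu : u ∈ D.Nb v ∨ ∃ a ∈ S0, u ∈ D.Nb a) : 1 ≤ hf D H K v S0 u A := by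
  have hTA := evt_eq hS he
  by_cases hb : ∃ b ∈ S0, b ∈ Tb D H u
  · obtain ⟨b, hb, hbu⟩ := hb
    rcases hu with hu | ⟨a, ha, hu⟩
    · have : 1 ≤ h1 D H v S0 u := ind_le_sum (fun _ _ => ind_nonneg _) hb (ind_true ⟨hu, hbu⟩).ge
      have := h2_nonneg D H S0 u
      have := mul_nonneg (h3_nonneg D v S0 u) (hs_nonneg (Tb D H u \ Tb D H v) A K)
      unfold hf; linarith
    · have : 1 ≤ h2 D H S0 u := by
        refine ind_le_sum (fun _ _ => sum_nonneg (fun _ _ => add_nonneg (ind_nonneg _) (ind_nonneg _))) ha ?_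
        refine ind_le_sum (fun _ _ => add_nonneg (ind_nonneg _) (ind_nonneg _)) hb ?_
        rw [ind_true ⟨hu, hbu⟩]
        linarith [ind_nonneg (a ≠ b ∧ a ∈ Tb D H u ∧ b ∈ Tb D H u)]
      have := h1_nonneg D H v S0 u
      have := mul_nonneg (h3_nonneg D v S0 u) (hs_nonneg (Tb D H u \ Tb D H v) A K)
      unfold hf; linarith
  · push Not at hb
    obtain ⟨S, hSs, hSc⟩ := exists_subset_card_eq hact.2.2
    have h4 : 1 ≤ ∑ S ∈ powersetCard K (Tb D H u \ Tb D H v), ind (S ⊆ A) := by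
      refine ind_le_sum (fun _ _ => ind_nonneg _) (a := S) ?_ (ind_true ?_).ge
      · rw [mem_powersetCard]
        refine ⟨fun c hc => ?_, hSc⟩
        have hc' := mem_inter.1 (hSs hc)
        refine mem_sdiff.2 ⟨hc'.1, fun hcv => hb c ?_ hc'.1⟩
        rw [← hTA]; exact mem_inter.2 ⟨hcv, hc'.2⟩
      · exact fun c hc => (mem_inter.1 (hSs hc)).2
    have h5 : 1 ≤ h3 D v S0 u := by
      unfold h3
      rcases hu with hu | ⟨a, ha, hu⟩
      · rw [ind_true hu]
        linarith [sum_nonneg (fun a (_ : a ∈ S0) => ind_nonneg (u ∈ D.Nb a))]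
      · have := ind_le_sum (s := S0) (f := fun a => ind (u ∈ D.Nb a)) (fun _ _ => ind_nonneg _) ha
          (ind_true hu).ge
        linarith [ind_nonneg (u ∈ D.Nb v)]
    have := h1_nonneg D H v S0 u
    have := h2_nonneg D H S0 u
    have := one_le_mul_of_one_le_of_one_le h5 h4
    unfold hf; linarith

lemma pointwise (D : Deg G d) (H L : Finset V) (K : ℕ) (v : V) (hv : v ∈ L) (S0 A B : Finset V)
    (hS : S0 ⊆ Tb D H v) (hSc : S0.card = K) :
    ind (v ∈ B) * (ind (evt D H v S0 A) * (1 - xf D H v S0 A -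
      ∑ u ∈ univ.erase v, ind (u ∈ B) * hf D H K v S0 u A)) ≤
    ind (evt D H v S0 A) * ind (inB D H L K A B v) := by
  have hsum0 : 0 ≤ ∑ u ∈ univ.erase v, ind (u ∈ B) * hf D H K v S0 u A :=
    sum_nonneg (fun _ _ => mul_nonneg (ind_nonneg _) (hf_nonneg _ _ _ _ _ _ _))
  have hx0 := xf_nonneg D H v S0 A
  by_cases hvB : v ∈ B
  swap
  · rw [ind_false hvB, zero_mul]; exact mul_nonneg (ind_nonneg _) (ind_nonneg _)
  by_cases he : evt D H v S0 A
  swap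
  · rw [ind_false he]; simp
  rw [ind_true hvB, ind_true he, one_mul, one_mul, one_mul]
  have hTA := evt_eq hS he
  by_cases hin : inB D H L K A B v
  · rw [ind_true hin]; linarith
  rw [ind_false hin]
  suffices hsuf : 1 ≤ xf D H v S0 A ∨ ∃ u, u ≠ v ∧ u ∈ B ∧ 1 ≤ hf D H K v S0 u A by
    rcases hsuf with h | ⟨u, hne, huB, hu⟩
    · linarith
    · have : 1 ≤ ∑ u ∈ univ.erase v, ind (u ∈ B) * hf D H K v S0 u A := by
        refine ind_le_sum (fun _ _ => mul_nonneg (ind_nonneg _) (hf_nonneg _ _ _ _ _ _ _))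
          (a := u) (mem_erase.2 ⟨hne, mem_univ _⟩) ?_
        rw [ind_true huB, one_mul]; exact hu
      linarith
  unfold inB at hin
  rw [hTA] at hin
  have hin2 : ¬ ((∀ a ∈ S0, Disjoint (Tb D H a) A) ∧
      (∀ u ∈ D.Nb v, ¬ act D H L K A B u) ∧
      (∀ a ∈ S0, ∀ u ∈ D.Nb a, ¬ act D H L K A B u) ∧
      (∀ v' ∈ L, v' ∈ B → v' ≠ v → ∀ a ∈ S0, ∀ b ∈ S0, a ≠ b →
        a ∈ Tb D H v' → b ∈ Tb D H v' → False)) := fun h => hin ⟨hv, hvB, hSc, h⟩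
  by_cases c1 : ∀ a ∈ S0, Disjoint (Tb D H a) A
  swap
  · left
    push Not at c1
    obtain ⟨a, ha, hdis⟩ := c1
    rw [not_disjoint_iff] at hdis
    obtain ⟨c, hc, hcA⟩ := hdis
    unfold xf
    by_cases hcv : c ∈ Tb D H v
    · have hcS : c ∈ S0 := by rw [← hTA]; exact mem_inter.2 ⟨hcv, hcA⟩
      have h3 : 1 ≤ ∑ a ∈ S0, ∑ b ∈ S0, ind (b ∈ D.Nb a) :=
        ind_le_sum (fun _ _ => sum_nonneg (fun _ _ => ind_nonneg _)) ha
          (ind_le_sum (fun _ _ => ind_nonneg _) hcS (ind_true (mem_inter.1 hc).1).ge)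
      have h4 : 0 ≤ ∑ a ∈ S0, ∑ c ∈ Tb D H a \ Tb D H v, ind ({c} ⊆ A) :=
        sum_nonneg (fun _ _ => sum_nonneg (fun _ _ => ind_nonneg _))
      linarith
    · have h3 : 0 ≤ ∑ a ∈ S0, ∑ b ∈ S0, ind (b ∈ D.Nb a) :=
        sum_nonneg (fun _ _ => sum_nonneg (fun _ _ => ind_nonneg _))
      have h4 : 1 ≤ ∑ a ∈ S0, ∑ c ∈ Tb D H a \ Tb D H v, ind ({c} ⊆ A) :=
        ind_le_sum (fun _ _ => sum_nonneg (fun _ _ => ind_nonneg _)) ha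
          (ind_le_sum (fun _ _ => ind_nonneg _) (mem_sdiff.2 ⟨hc, hcv⟩)
            (ind_true (singleton_subset_iff.2 hcA)).ge)
      linarith
  right
  by_cases c2 : ∀ u ∈ D.Nb v, ¬ act D H L K A B u
  swap
  · push Not at c2
    obtain ⟨u, hu, hact⟩ := c2
    refine ⟨u, ?_, hact.2.1, hf_act hS he hact (Or.inl hu)⟩
    rintro rfl
    exact lt_irrefl _ (D.lt _ _ hu)
  by_cases c3 : ∀ a ∈ S0, ∀ u ∈ D.Nb a, ¬ act D H L K A B u
  swap
  · push Not at c3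
    obtain ⟨a, ha, u, hu, hact⟩ := c3
    refine ⟨u, ?_, hact.2.1, hf_act hS he hact (Or.inr ⟨a, ha, hu⟩)⟩
    rintro rfl
    have h1 := D.lt _ _ hu
    have h2 := D.lt _ _ (mem_inter.1 (hS ha)).1
    omega
  by_contra hno
  refine hin2 ⟨c1, c2, c3, ?_⟩
  intro u _ huB hne a ha b hb hab hau hbu
  refine hno ⟨u, hne, huB, ?_⟩
  have : 1 ≤ h2 D H S0 u := by
    refine ind_le_sum (fun _ _ => sum_nonneg (fun _ _ => add_nonneg (ind_nonneg _) (ind_nonneg _))) ha ?_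
    refine ind_le_sum (fun _ _ => add_nonneg (ind_nonneg _) (ind_nonneg _)) hb ?_
    rw [ind_true (p := a ≠ b ∧ a ∈ Tb D H u ∧ b ∈ Tb D H u) ⟨hab, hau, hbu⟩]
    linarith [ind_nonneg (u ∈ D.Nb a ∧ b ∈ Tb D H u)]
  have := h1_nonneg D H v S0 u
  have := mul_nonneg (h3_nonneg D v S0 u) (hs_nonneg (Tb D H u \ Tb D H v) A K)
  unfold hf; linarith

lemma pointwise_sum (D : Deg G d) (H L : Finset V) (K : ℕ) (v : V) (hv : v ∈ L) (A B : Finset V) :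
    ∑ S0 ∈ powersetCard K (Tb D H v), ind (v ∈ B) * (ind (evt D H v S0 A) * (1 - xf D H v S0 A -
      ∑ u ∈ univ.erase v, ind (u ∈ B) * hf D H K v S0 u A)) ≤ ind (inB D H L K A B v) := by
  calc _ ≤ ∑ S0 ∈ powersetCard K (Tb D H v), ind (evt D H v S0 A) * ind (inB D H L K A B v) := by
        refine sum_le_sum (fun S0 hS0 => ?_)
        rw [mem_powersetCard] at hS0
        exact pointwise D H L K v hv S0 A B hS0.1 hS0.2
    _ = (∑ S0 ∈ powersetCard K (Tb D H v), ind (evt D H v S0 A)) * ind (inB D H L K A B v) := by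
        rw [sum_mul]
    _ ≤ 1 * ind (inB D H L K A B v) := by
        refine mul_le_mul_of_nonneg_right ?_ (ind_nonneg _)
        rw [sum_ind]
        have : ((powersetCard K (Tb D H v)).filter (fun S0 => evt D H v S0 A)).card ≤ 1 := by
          rw [card_le_one]
          intro S1 h1 S2 h2
          rw [mem_filter, mem_powersetCard] at h1 h2
          rw [← evt_eq h1.1.1 h1.2, ← evt_eq h2.1.1 h2.2]
        exact_mod_cast this
    _ = _ := one_mul _

/-! expectations -/

lemma Ex_two {V : Type} [Fintype V] (q : ℝ) (u v : V) (h : u ≠ v) :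
    Ex q (fun A => ind (v ∈ A) * ind (u ∈ A)) = q ^ 2 := by
  have := Ex_sub_ind q ({v, u} : Finset V)
  rw [card_pair h.symm] at this
  rw [← this]
  congr 1
  funext A
  unfold ind
  by_cases h1 : v ∈ A <;> by_cases h2 : u ∈ A <;> simp [h1, h2, insert_subset_iff]

lemma Ex_mem' {V : Type} [Fintype V] (q : ℝ) (v : V) : Ex q (fun A => ind (v ∈ A)) = q := by
  have := Ex_mem q v
  unfold ind
  convert this

lemma EE_gen {V : Type} [Fintype V] (q ρ : ℝ) (v : V) (e x : Finset V → ℝ) (h : V → Finset V → ℝ) :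
    Ex ρ (fun B => Ex q (fun A => ind (v ∈ B) * (e A * (1 - x A -
      ∑ u ∈ univ.erase v, ind (u ∈ B) * h u A)))) =
    ρ * (Ex q e - Ex q (fun A => e A * x A) -
      ρ * ∑ u ∈ univ.erase v, Ex q (fun A => e A * h u A)) := by
  have h1 : ∀ B : Finset V, Ex q (fun A => ind (v ∈ B) * (e A * (1 - x A -
      ∑ u ∈ univ.erase v, ind (u ∈ B) * h u A))) =
      (Ex q e - Ex q (fun A => e A * x A)) * ind (v ∈ B) -
      ∑ u ∈ univ.erase v, Ex q (fun A => e A * h u A) * (ind (v ∈ B) * ind (u ∈ B)) := by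
    intro B
    rw [Ex_mul]
    have : (fun A => e A * (1 - x A - ∑ u ∈ univ.erase v, ind (u ∈ B) * h u A)) =
        (fun A => (e A - e A * x A) - ∑ u ∈ univ.erase v, ind (u ∈ B) * (e A * h u A)) := by
      funext A
      rw [mul_sub, mul_sub, mul_one, mul_sum]
      congr 1
      exact sum_congr rfl (fun u _ => by ring)
    rw [this, Ex_sub, Ex_sub, Ex_sum]
    simp_rw [Ex_mul]
    rw [mul_sub, mul_sum, mul_comm]
    congr 1
    exact sum_congr rfl (fun u _ => by ring)
  simp_rw [h1]
  rw [Ex_sub, Ex_sum, Ex_mul, Ex_mem']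
  simp_rw [Ex_mul]
  rw [sum_congr rfl (fun u hu => by rw [Ex_two ρ u v (ne_of_mem_erase hu)]), ← sum_mul]
  ring

end case2
end PolyDeg

namespace PolyDeg
open Finset
open scoped Classical

section case2
variable {V : Type} [Fintype V] {G : SimpleGraph V} {d : ℕ}

noncomputable def pE (q : ℝ) (K t : ℕ) : ℝ := q ^ K * (1 - q) ^ (t - K)

lemma Ex_evt (D : Deg G d) (H : Finset V) (v : V) (q : ℝ) (S0 S : Finset V) (hS : S0 ⊆ Tb D H v)
    (hdis : Disjoint S (Tb D H v)) :
    Ex q (fun A => ind (evt D H v S0 A) * ind (S ⊆ A)) = pE q S0.card (Tb D H v).card * q ^ S.card := by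
  have h1 : Disjoint (S0 ∪ S) (Tb D H v \ S0) := by
    rw [disjoint_union_left]
    exact ⟨disjoint_sdiff, disjoint_of_subset_right sdiff_subset hdis⟩
  have h2 := Ex_ind q (S0 ∪ S) (Tb D H v \ S0) h1
  rw [card_union_of_disjoint (disjoint_of_subset_left hS hdis.symm), card_sdiff_of_subset hS] at h2
  have h3 : (fun A : Finset V => ind (evt D H v S0 A) * ind (S ⊆ A)) =
      (fun A => if S0 ∪ S ⊆ A ∧ Disjoint (Tb D H v \ S0) A then 1 else 0) := by
    funext A
    unfold ind evt
    by_cases a1 : S0 ⊆ A <;> by_cases a2 : Disjoint (Tb D H v \ S0) A <;> by_cases a3 : S ⊆ A <;>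
      simp [a1, a2, a3, union_subset_iff]
  rw [h3, h2, pE, pow_add]
  ring

lemma Ex_evt0 (D : Deg G d) (H : Finset V) (v : V) (q : ℝ) (S0 : Finset V) (hS : S0 ⊆ Tb D H v) :
    Ex q (fun A => ind (evt D H v S0 A)) = pE q S0.card (Tb D H v).card := by
  have := Ex_evt D H v q S0 ∅ hS (disjoint_empty_left _)
  simpa [ind_true] using this

lemma pE_nonneg {q : ℝ} (h0 : 0 ≤ q) (h1 : q ≤ 1) (K t : ℕ) : 0 ≤ pE q K t :=
  mul_nonneg (pow_nonneg h0 _) (pow_nonneg (by linarith) _)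

lemma Ex_x (D : Deg G d) (H : Finset V) (v : V) {q : ℝ} (h0 : 0 ≤ q) (h1 : q ≤ 1) (S0 : Finset V)
    (hS : S0 ⊆ Tb D H v) (K : ℕ) (hK : S0.card = K) :
    Ex q (fun A => ind (evt D H v S0 A) * xf D H v S0 A) ≤ pE q K (Tb D H v).card *
      (∑ a ∈ S0, ∑ b ∈ S0, ind (b ∈ D.Nb a) + K * d * q) := by
  have e1 : (fun A => ind (evt D H v S0 A) * xf D H v S0 A) = (fun A =>
      (∑ a ∈ S0, ∑ b ∈ S0, ind (b ∈ D.Nb a)) * ind (evt D H v S0 A) +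
      ∑ a ∈ S0, ∑ c ∈ Tb D H a \ Tb D H v, ind (evt D H v S0 A) * ind ({c} ⊆ A)) := by
    funext A
    unfold xf
    rw [mul_add, mul_comm]
    simp_rw [mul_sum]
  rw [e1, Ex_add, Ex_mul, Ex_evt0 _ _ _ _ _ hS, Ex_sum, hK, mul_add, mul_comm]
  gcongr
  calc ∑ a ∈ S0, Ex q (fun A => ∑ c ∈ Tb D H a \ Tb D H v, ind (evt D H v S0 A) * ind ({c} ⊆ A))
      = ∑ a ∈ S0, ∑ c ∈ Tb D H a \ Tb D H v, pE q K (Tb D H v).card * q := by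
        refine sum_congr rfl (fun a _ => ?_)
        rw [Ex_sum]
        refine sum_congr rfl (fun c hc => ?_)
        rw [Ex_evt D H v q S0 {c} hS (disjoint_singleton_left.2 (mem_sdiff.1 hc).2), hK]
        simp
    _ ≤ ∑ a ∈ S0, d * (pE q K (Tb D H v).card * q) := by
        refine sum_le_sum (fun a _ => ?_)
        rw [sum_const, nsmul_eq_mul]
        refine mul_le_mul_of_nonneg_right ?_ (mul_nonneg (pE_nonneg h0 h1 _ _) h0)
        have : (Tb D H a \ Tb D H v).card ≤ d :=
          (card_le_card (sdiff_subset.trans inter_subset_left)).trans (D.card_le a)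
        exact_mod_cast this
    _ = _ := by rw [sum_const, hK, nsmul_eq_mul]; ring

lemma Ex_h (D : Deg G d) (H : Finset V) (v u : V) {q : ℝ} (h0 : 0 ≤ q) (hq1 : q ≤ 1) (S0 : Finset V)
    (hS : S0 ⊆ Tb D H v) (K : ℕ) (hK : S0.card = K) :
    Ex q (fun A => ind (evt D H v S0 A) * hf D H K v S0 u A) ≤ pE q K (Tb D H v).card *
      (h1 D H v S0 u + h2 D H S0 u + h3 D v S0 u * (d * q) ^ K) := by
  have e1 : (fun A => ind (evt D H v S0 A) * hf D H K v S0 u A) = (fun A =>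
      (h1 D H v S0 u + h2 D H S0 u) * ind (evt D H v S0 A) + h3 D v S0 u *
      ∑ S ∈ powersetCard K (Tb D H u \ Tb D H v), ind (evt D H v S0 A) * ind (S ⊆ A)) := by
    funext A
    unfold hf
    rw [← mul_sum]
    ring
  rw [e1, Ex_add, Ex_mul, Ex_evt0 _ _ _ _ _ hS, Ex_mul, Ex_sum, hK]
  have e2 : ∑ S ∈ powersetCard K (Tb D H u \ Tb D H v),
      Ex q (fun A => ind (evt D H v S0 A) * ind (S ⊆ A)) ≤ pE q K (Tb D H v).card * (d * q) ^ K := by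
    calc _ = ∑ S ∈ powersetCard K (Tb D H u \ Tb D H v), pE q K (Tb D H v).card * q ^ K := by
          refine sum_congr rfl (fun S hSm => ?_)
          rw [mem_powersetCard] at hSm
          rw [Ex_evt D H v q S0 S hS (disjoint_of_subset_left hSm.1 sdiff_disjoint), hK, hSm.2]
      _ = ((Tb D H u \ Tb D H v).card.choose K : ℝ) * (pE q K (Tb D H v).card * q ^ K) := by
          rw [sum_const, card_powersetCard, nsmul_eq_mul]
      _ ≤ (d : ℝ) ^ K * (pE q K (Tb D H v).card * q ^ K) := by
          refine mul_le_mul_of_nonneg_right ?_ (mul_nonneg (pE_nonneg h0 hq1 _ _) (pow_nonneg h0 _))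
          have h4 : (Tb D H u \ Tb D H v).card ≤ d :=
            (card_le_card (sdiff_subset.trans inter_subset_left)).trans (D.card_le u)
          have h5 := (Nat.choose_le_pow (Tb D H u \ Tb D H v).card K).trans (Nat.pow_le_pow_left h4 K)
          exact_mod_cast h5
      _ = _ := by rw [mul_pow]; ring
  have := mul_le_mul_of_nonneg_left e2 (h3_nonneg D v S0 u)
  linarith

lemma sum_h3 (D : Deg G d) (v : V) (S0 : Finset V) (s : Finset V) :
    ∑ u ∈ s, h3 D v S0 u ≤ (S0.card + 1) * d := by
  have key : ∀ a, ∑ u ∈ s, ind (u ∈ D.Nb a) ≤ d := by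
    intro a
    rw [sum_ind]
    have : (s.filter (fun u => u ∈ D.Nb a)).card ≤ d :=
      (card_le_card (fun u hu => (mem_filter.1 hu).2)).trans (D.card_le a)
    exact_mod_cast this
  unfold h3
  rw [sum_add_distrib, sum_comm]
  have h1 := key v
  have h2 : ∑ a ∈ S0, ∑ u ∈ s, ind (u ∈ D.Nb a) ≤ S0.card * d := by
    calc _ ≤ ∑ a ∈ S0, (d:ℝ) := sum_le_sum (fun a _ => key a)
      _ = _ := by simp
  linarith

lemma vbound (D : Deg G d) (H L : Finset V) (K : ℕ) (v : V) (hv : v ∈ L) {q ρ : ℝ} (h0 : 0 ≤ q)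
    (hq1 : q ≤ 1) (r0 : 0 ≤ ρ) (r1 : ρ ≤ 1) (E1 E2 E3 : ℝ)
    (hE1 : ∑ a ∈ Tb D H v, ∑ b ∈ Tb D H v, ind (b ∈ D.Nb a) ≤ E1)
    (hE2 : ∑ u ∈ univ.erase v, h1 D H v (Tb D H v) u ≤ E2)
    (hE3 : ∑ u ∈ univ.erase v, h2 D H (Tb D H v) u ≤ E3) :
    ρ * pE q K (Tb D H v).card * ((Tb D H v).card.choose K) *
      (1 - K * d * q - ((K:ℝ) / (Tb D H v).card) ^ 2 * E1 -
        ρ * ((K + 1) * d * (d * q) ^ K + ((K:ℝ) / (Tb D H v).card) * E2 +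
          ((K:ℝ) / (Tb D H v).card) ^ 2 * E3)) ≤
    Ex ρ (fun B => Ex q (fun A => ind (inB D H L K A B v))) := by
  set T := Tb D H v with hT
  set t := T.card with ht
  set κ : ℝ := (K:ℝ) / t with hκ
  have hκ0 : 0 ≤ κ := by positivity
  set p := pE q K t with hp
  have hp0 : 0 ≤ p := pE_nonneg h0 hq1 _ _
  set C : ℝ := (t.choose K : ℝ) with hC
  have hC0 : 0 ≤ C := by positivity
  have hdq : 0 ≤ (d * q) ^ K := by positivity
  have s1 : ∑ S0 ∈ powersetCard K T, ∑ a ∈ S0, ∑ b ∈ S0, ind (b ∈ D.Nb a) ≤ κ ^ 2 * C * E1 := by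
    refine (wcount_two T K (fun a b => ind (b ∈ D.Nb a)) (fun _ _ => ind_nonneg _)
      (fun a => ind_false (fun h => lt_irrefl _ (D.lt _ _ h)))).trans ?_
    exact mul_le_mul_of_nonneg_left hE1 (by positivity)
  have s2 : ∑ S0 ∈ powersetCard K T, ∑ u ∈ univ.erase v, h1 D H v S0 u ≤ κ * C * E2 := by
    rw [sum_comm]
    calc _ ≤ ∑ u ∈ univ.erase v, κ * C * h1 D H v T u := by
          refine sum_le_sum (fun u _ => ?_)
          exact wcount_one T K (fun b => ind (u ∈ D.Nb v ∧ b ∈ Tb D H u)) (fun _ => ind_nonneg _)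
      _ = κ * C * ∑ u ∈ univ.erase v, h1 D H v T u := by rw [mul_sum]
      _ ≤ _ := mul_le_mul_of_nonneg_left hE2 (by positivity)
  have s3 : ∑ S0 ∈ powersetCard K T, ∑ u ∈ univ.erase v, h2 D H S0 u ≤ κ ^ 2 * C * E3 := by
    rw [sum_comm]
    calc _ ≤ ∑ u ∈ univ.erase v, κ ^ 2 * C * h2 D H T u := by
          refine sum_le_sum (fun u _ => ?_)
          refine wcount_two T K (fun a b => ind (u ∈ D.Nb a ∧ b ∈ Tb D H u) +
            ind (a ≠ b ∧ a ∈ Tb D H u ∧ b ∈ Tb D H u))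
            (fun _ _ => add_nonneg (ind_nonneg _) (ind_nonneg _)) (fun a => ?_)
          rw [ind_false, ind_false, add_zero]
          · exact fun h => h.1 rfl
          · rintro ⟨h, h'⟩
            have g1 := D.lt _ _ h
            have g2 := D.lt _ _ (mem_inter.1 h').1
            omega
      _ = κ ^ 2 * C * ∑ u ∈ univ.erase v, h2 D H T u := by rw [mul_sum]
      _ ≤ _ := mul_le_mul_of_nonneg_left hE3 (by positivity)
  have hlow : ∀ S0 ∈ powersetCard K T, ρ * p * (1 - (∑ a ∈ S0, ∑ b ∈ S0, ind (b ∈ D.Nb a) + K * d * q) -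
      ρ * (∑ u ∈ univ.erase v, h1 D H v S0 u + ∑ u ∈ univ.erase v, h2 D H S0 u + (K + 1) * d * (d * q) ^ K))
      ≤ Ex ρ (fun B => Ex q (fun A => ind (v ∈ B) * (ind (evt D H v S0 A) * (1 - xf D H v S0 A -
      ∑ u ∈ univ.erase v, ind (u ∈ B) * hf D H K v S0 u A)))) := by
    intro S0 hS0
    rw [mem_powersetCard] at hS0
    rw [EE_gen, Ex_evt0 _ _ _ _ _ hS0.1, hS0.2, mul_assoc]
    refine mul_le_mul_of_nonneg_left ?_ r0
    have g1 := Ex_x D H v h0 hq1 S0 hS0.1 K hS0.2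
    have g2 : ∑ u ∈ univ.erase v, Ex q (fun A => ind (evt D H v S0 A) * hf D H K v S0 u A) ≤
        p * (∑ u ∈ univ.erase v, h1 D H v S0 u + ∑ u ∈ univ.erase v, h2 D H S0 u +
          (K + 1) * d * (d * q) ^ K) := by
      calc _ ≤ ∑ u ∈ univ.erase v, p * (h1 D H v S0 u + h2 D H S0 u + h3 D v S0 u * (d * q) ^ K) :=
            sum_le_sum (fun u _ => Ex_h D H v u h0 hq1 S0 hS0.1 K hS0.2)
        _ = p * (∑ u ∈ univ.erase v, h1 D H v S0 u + ∑ u ∈ univ.erase v, h2 D H S0 u +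
            (∑ u ∈ univ.erase v, h3 D v S0 u) * (d * q) ^ K) := by
            rw [← mul_sum, sum_add_distrib, sum_add_distrib, sum_mul]
        _ ≤ _ := by
            have := sum_h3 D v S0 (univ.erase v)
            rw [hS0.2] at this
            gcongr
    have g3 := mul_le_mul_of_nonneg_left g2 r0
    linarith
  calc _ ≤ ∑ S0 ∈ powersetCard K T, ρ * p * (1 - (∑ a ∈ S0, ∑ b ∈ S0, ind (b ∈ D.Nb a) + K * d * q) -
      ρ * (∑ u ∈ univ.erase v, h1 D H v S0 u + ∑ u ∈ univ.erase v, h2 D H S0 u + (K + 1) * d * (d * q) ^ K)) := by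
        rw [← mul_sum, sum_sub_distrib, sum_sub_distrib, ← mul_sum, sum_add_distrib, sum_add_distrib,
          sum_add_distrib, sum_const, sum_const, sum_const, card_powersetCard, nsmul_eq_mul, nsmul_eq_mul,
          nsmul_eq_mul, mul_assoc (ρ * p)]
        refine mul_le_mul_of_nonneg_left ?_ (mul_nonneg r0 hp0)
        have g4 := mul_le_mul_of_nonneg_left s2 r0
        have g5 := mul_le_mul_of_nonneg_left s3 r0
        linarith
    _ ≤ ∑ S0 ∈ powersetCard K T, Ex ρ (fun B => Ex q (fun A => ind (v ∈ B) *
        (ind (evt D H v S0 A) * (1 - xf D H v S0 A -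
        ∑ u ∈ univ.erase v, ind (u ∈ B) * hf D H K v S0 u A)))) := sum_le_sum hlow
    _ = Ex ρ (fun B => Ex q (fun A => ∑ S0 ∈ powersetCard K T, ind (v ∈ B) *
        (ind (evt D H v S0 A) * (1 - xf D H v S0 A -
        ∑ u ∈ univ.erase v, ind (u ∈ B) * hf D H K v S0 u A)))) := by
        rw [← Ex_sum]
        congr 1
        funext B
        rw [Ex_sum]
    _ ≤ _ := Ex_mono r0 r1 (fun B => Ex_mono h0 hq1 (fun A => pointwise_sum D H L K v hv A B))

lemma total (D : Deg G d) (H L : Finset V) (K : ℕ) (hN : NoSparse G K) {q ρ : ℝ} (h0 : 0 ≤ q)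
    (hq1 : q ≤ 1) (r0 : 0 ≤ ρ) (r1 : ρ ≤ 1) :
    ∑ v ∈ L, Ex ρ (fun B => Ex q (fun A => ind (inB D H L K A B v))) ≤ q * H.card := by
  calc ∑ v ∈ L, Ex ρ (fun B => Ex q (fun A => ind (inB D H L K A B v)))
      = Ex ρ (fun B => Ex q (fun A => ∑ v ∈ L, ind (inB D H L K A B v))) := by
        rw [← Ex_sum]
        congr 1
        funext B
        rw [Ex_sum]
    _ ≤ Ex ρ (fun _ => Ex q (fun A => ∑ a ∈ H, ind (a ∈ A))) := by
        refine Ex_mono r0 r1 (fun B => Ex_mono h0 hq1 (fun A => ?_))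
        rw [sum_ind, sum_ind]
        have h1 := det2 D H L K hN A B
        have h2 : (L.filter (fun v => inB D H L K A B v)).card ≤
            (univ.filter (fun v => inB D H L K A B v)).card :=
          card_le_card (filter_subset_filter _ (subset_univ _))
        have h3 : H.filter (fun a => a ∈ A) = H ∩ A := filter_mem_eq_inter
        rw [h3]
        exact_mod_cast h2.trans h1
    _ = Ex ρ (fun _ => (q * H.card) * 1) := by
        congr 1
        funext B
        rw [Ex_sum]
        simp_rw [Ex_mem']
        rw [sum_const, nsmul_eq_mul]; ring
    _ = _ := by rw [Ex_mul, Ex_one, mul_one]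

end case2
end PolyDeg

namespace PolyDeg
open Finset
open scoped Classical

section case2b
variable {V : Type} [Fintype V] {G : SimpleGraph V} {d : ℕ}

noncomputable def fd (D : Deg G d) (u : V) : ℕ := (univ.filter (fun v => u ∈ D.Nb v)).card

lemma sum_inter_fd (D : Deg G d) (X : Finset V) :
    ∑ v, (D.Nb v ∩ X).card = ∑ u ∈ X, fd D u := by
  have h : ∀ v, (D.Nb v ∩ X).card = ∑ u ∈ X, if u ∈ D.Nb v then 1 else 0 := by
    intro v
    rw [← card_filter, inter_comm, filter_mem_eq_inter]
  simp_rw [h]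
  rw [sum_comm]
  refine sum_congr rfl (fun u _ => ?_)
  rw [fd, card_filter]

lemma sum_fd_le (D : Deg G d) (X : Finset V) : ∑ u ∈ X, fd D u ≤ d * Fintype.card V := by
  rw [← sum_inter_fd]
  calc _ ≤ ∑ v : V, d := sum_le_sum (fun v _ => (card_le_card inter_subset_left).trans (D.card_le v))
    _ = _ := by rw [sum_const, smul_eq_mul, card_univ, mul_comm]

lemma Tb_card (D : Deg G d) (H : Finset V) (v : V) : (Tb D H v).card ≤ d :=
  (card_le_card inter_subset_left).trans (D.card_le v)

lemma kst_ind {R : ℕ} (hK : KST G d R) (X Y : Finset V) (hX : X.card ≤ d) (hY : Y.card ≤ d) :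
    (R : ℝ) * ∑ x ∈ X, ∑ y ∈ Y, ind (G.Adj x y) ≤ (d : ℝ) ^ 2 := by
  have h := hK X Y hX hY
  have : ((R * ∑ x ∈ X, (Y.filter (fun y => G.Adj x y)).card : ℕ) : ℝ) ≤ ((d ^ 2 : ℕ) : ℝ) := by
    exact_mod_cast h
  push_cast at this
  simp_rw [sum_ind]
  exact this

lemma ind_mono {p q : Prop} (h : p → q) : ind p ≤ ind q := by
  by_cases hp : p
  · rw [ind_true hp, ind_true (h hp)]
  · rw [ind_false hp]; exact ind_nonneg _

lemma estE1 (D : Deg G d) (H : Finset V) (v : V) {R : ℕ} (hK : KST G d R) :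
    (R : ℝ) * ∑ a ∈ Tb D H v, ∑ b ∈ Tb D H v, ind (b ∈ D.Nb a) ≤ (d : ℝ) ^ 2 := by
  refine le_trans ?_ (kst_ind hK (Tb D H v) (Tb D H v) (Tb_card D H v) (Tb_card D H v))
  refine mul_le_mul_of_nonneg_left ?_ (Nat.cast_nonneg _)
  refine sum_le_sum (fun a _ => sum_le_sum (fun b _ => ind_mono (fun h => ?_)))
  exact (D.adj_iff _ _).2 (Or.inr h)

lemma estN (D : Deg G d) (H : Finset V) (v w : V) {R : ℕ} (hK : KST G d R) (s : Finset V) :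
    (R : ℝ) * ∑ u ∈ s, ∑ b ∈ Tb D H v, ind (u ∈ D.Nb w ∧ b ∈ Tb D H u) ≤ (d : ℝ) ^ 2 := by
  refine le_trans ?_ (kst_ind hK (D.Nb w) (Tb D H v) (D.card_le w) (Tb_card D H v))
  refine mul_le_mul_of_nonneg_left ?_ (Nat.cast_nonneg _)
  calc ∑ u ∈ s, ∑ b ∈ Tb D H v, ind (u ∈ D.Nb w ∧ b ∈ Tb D H u)
      ≤ ∑ u, ∑ b ∈ Tb D H v, ind (u ∈ D.Nb w ∧ b ∈ Tb D H u) :=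
        sum_le_sum_of_subset_of_nonneg (subset_univ _)
          (fun _ _ _ => sum_nonneg (fun _ _ => ind_nonneg _))
    _ = ∑ u ∈ D.Nb w, ∑ b ∈ Tb D H v, ind (u ∈ D.Nb w ∧ b ∈ Tb D H u) := by
        symm
        refine sum_subset (subset_univ _) (fun u _ hu => sum_eq_zero (fun b _ => ind_false (fun h => hu h.1)))
    _ ≤ _ := by
        refine sum_le_sum (fun a _ => sum_le_sum (fun b _ => ind_mono (fun h => ?_)))
        exact (D.adj_iff _ _).2 (Or.inr (mem_inter.1 h.2).1)

lemma few_big (D : Deg G d) (H : Finset V) (v : V) {r : ℕ} (hr : 2 ≤ r) (hd : 1 ≤ d)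
    (hK : KST G d (r ^ 2)) :
    r * (univ.filter (fun u => d ≤ r * (Tb D H v ∩ Tb D H u).card)).card ≤ d := by
  set Bv := univ.filter (fun u => d ≤ r * (Tb D H v ∩ Tb D H u).card) with hBv
  have key : ∀ X ⊆ Bv, X.card ≤ d → r * X.card ≤ d := by
    intro X hX hXd
    have h := hK X (Tb D H v) hXd (Tb_card D H v)
    have h2 : X.card * d ≤ r * ∑ x ∈ X, ((Tb D H v).filter (fun y => G.Adj x y)).card := by
      rw [mul_sum, ← smul_eq_mul, ← sum_const]
      refine sum_le_sum (fun u hu => ?_)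
      refine (mem_filter.1 (hX hu)).2.trans (Nat.mul_le_mul_left _ (card_le_card ?_))
      intro b hb
      rw [mem_inter] at hb
      exact mem_filter.2 ⟨hb.1, (D.adj_iff _ _).2 (Or.inr (mem_inter.1 hb.2).1)⟩
    have h3 : d * (r * X.card) ≤ d * d := by nlinarith
    exact Nat.le_of_mul_le_mul_left h3 hd
  by_cases hc : Bv.card ≤ d
  · exact key Bv (Subset.refl _) hc
  · obtain ⟨X, hX, hXc⟩ := Finset.exists_subset_card_eq (show d ≤ Bv.card by omega)
    have := key X hX hXc.le
    rw [hXc] at this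
    nlinarith

lemma estE3 (D : Deg G d) (H : Finset V) (v : V) {r N : ℕ} (hr : 2 ≤ r) (hd : 1 ≤ d) (hN1 : 1 ≤ N)
    (hK : KST G d (r ^ 2)) (hH : ∀ a ∈ H, fd D a ≤ 2 * N * d) :
    (r : ℝ) * ∑ u ∈ univ.erase v, h2 D H (Tb D H v) u ≤ 8 * N * (d : ℝ) ^ 3 := by
  set T := Tb D H v with hT
  have hTd : T.card ≤ d := Tb_card D H v
  have hTd' : (T.card : ℝ) ≤ d := by exact_mod_cast hTd
  have hr' : (2 : ℝ) ≤ r := by exact_mod_cast hr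
  have hd' : (1 : ℝ) ≤ d := by exact_mod_cast hd
  have hN' : (1 : ℝ) ≤ N := by exact_mod_cast hN1
  have e3 : (r : ℝ) * ∑ u ∈ univ.erase v, ∑ a ∈ T, ∑ b ∈ T, ind (u ∈ D.Nb a ∧ b ∈ Tb D H u) ≤ (d : ℝ) ^ 3 := by
    rw [sum_comm, mul_sum]
    calc _ ≤ ∑ a ∈ T, (d : ℝ) ^ 2 := by
          refine sum_le_sum (fun a _ => ?_)
          have h := estN D H v a hK (univ.erase v)
          have h0 : 0 ≤ ∑ u ∈ univ.erase v, ∑ b ∈ Tb D H v, ind (u ∈ D.Nb a ∧ b ∈ Tb D H u) :=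
            sum_nonneg (fun _ _ => sum_nonneg (fun _ _ => ind_nonneg _))
          push_cast at h
          refine le_trans ?_ h
          exact mul_le_mul_of_nonneg_right (by nlinarith) h0
      _ = T.card * (d : ℝ) ^ 2 := by rw [sum_const, nsmul_eq_mul]
      _ ≤ d * (d : ℝ) ^ 2 := by gcongr
      _ = _ := by ring
  have e4 : (r : ℝ) * ∑ u ∈ univ.erase v, ∑ a ∈ T, ∑ b ∈ T, ind (a ≠ b ∧ a ∈ Tb D H u ∧ b ∈ Tb D H u)
      ≤ 3 * N * (d : ℝ) ^ 3 := by
    have g1 : ∀ u, ∑ a ∈ T, ∑ b ∈ T, ind (a ≠ b ∧ a ∈ Tb D H u ∧ b ∈ Tb D H u) ≤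
        ((T ∩ Tb D H u).card : ℝ) * (T ∩ Tb D H u).card := by
      intro u
      calc _ ≤ ∑ a ∈ T, ∑ b ∈ T, ind (a ∈ Tb D H u) * ind (b ∈ Tb D H u) := by
            refine sum_le_sum (fun a _ => sum_le_sum (fun b _ => ?_))
            by_cases h : a ∈ Tb D H u ∧ b ∈ Tb D H u
            · rw [ind_true h.1, ind_true h.2, mul_one]; exact ind_le_one _
            · rw [ind_false (fun g => h g.2)]; exact mul_nonneg (ind_nonneg _) (ind_nonneg _)
        _ = _ := by
            rw [← sum_mul_sum, sum_ind, filter_mem_eq_inter]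
    have g2 : ∀ u, r * ((T ∩ Tb D H u).card * (T ∩ Tb D H u).card) ≤
        d * (T ∩ Tb D H u).card + (if d ≤ r * (T ∩ Tb D H u).card then r * d ^ 2 else 0) := by
      intro u
      have hle : (T ∩ Tb D H u).card ≤ d := (card_le_card inter_subset_left).trans hTd
      split_ifs with h
      · have : (T ∩ Tb D H u).card * (T ∩ Tb D H u).card ≤ d ^ 2 := by nlinarith
        have := Nat.mul_le_mul_left r this
        omega
      · push Not at h
        nlinarith
    have g3 : r * ∑ u, (T ∩ Tb D H u).card * (T ∩ Tb D H u).card ≤ 3 * N * d ^ 3 := by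
      rw [mul_sum]
      refine (sum_le_sum (fun u _ => g2 u)).trans ?_
      rw [sum_add_distrib, ← mul_sum]
      have k1 : ∑ u, (T ∩ Tb D H u).card ≤ d * (2 * N * d) := by
        calc _ ≤ ∑ u, (D.Nb u ∩ T).card := sum_le_sum (fun u _ => card_le_card (fun x hx => by
              rw [mem_inter] at hx ⊢
              exact ⟨(mem_inter.1 hx.2).1, hx.1⟩))
          _ = ∑ u ∈ T, fd D u := sum_inter_fd D T
          _ ≤ ∑ u ∈ T, 2 * N * d := sum_le_sum (fun u hu => hH u (mem_inter.1 hu).2)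
          _ = T.card * (2 * N * d) := by rw [sum_const, smul_eq_mul]
          _ ≤ _ := Nat.mul_le_mul_right _ hTd
      have k2 : (∑ u, if d ≤ r * (T ∩ Tb D H u).card then r * d ^ 2 else 0) ≤ d * d ^ 2 := by
        rw [← sum_filter, sum_const, smul_eq_mul, ← mul_assoc, mul_comm _ r]
        exact Nat.mul_le_mul_right _ (few_big D H v hr hd hK)
      have k3 : d * ∑ u, (T ∩ Tb D H u).card ≤ d * (d * (2 * N * d)) := Nat.mul_le_mul_left _ k1
      have k4 : d * d ^ 2 ≤ N * (d * d ^ 2) := Nat.le_mul_of_pos_left _ hN1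
      calc _ ≤ d * (d * (2 * N * d)) + d * d ^ 2 := Nat.add_le_add k3 k2
        _ ≤ d * (d * (2 * N * d)) + N * (d * d ^ 2) := Nat.add_le_add_left k4 _
        _ = _ := by ring
    have g4 : (r : ℝ) * ∑ u, ((T ∩ Tb D H u).card : ℝ) * (T ∩ Tb D H u).card ≤ 3 * N * (d : ℝ) ^ 3 := by
      exact_mod_cast g3
    refine le_trans ?_ g4
    refine mul_le_mul_of_nonneg_left ?_ (by positivity)
    calc _ ≤ ∑ u ∈ univ.erase v, ((T ∩ Tb D H u).card : ℝ) * (T ∩ Tb D H u).card :=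
          sum_le_sum (fun u _ => g1 u)
      _ ≤ _ := sum_le_sum_of_subset_of_nonneg (subset_univ _) (fun _ _ _ => by positivity)
  have hsum : ∑ u ∈ univ.erase v, h2 D H T u =
      ∑ u ∈ univ.erase v, ∑ a ∈ T, ∑ b ∈ T, ind (u ∈ D.Nb a ∧ b ∈ Tb D H u) +
      ∑ u ∈ univ.erase v, ∑ a ∈ T, ∑ b ∈ T, ind (a ≠ b ∧ a ∈ Tb D H u ∧ b ∈ Tb D H u) := by
    rw [← sum_add_distrib]
    refine sum_congr rfl (fun u _ => ?_)
    unfold h2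
    rw [← sum_add_distrib]
    refine sum_congr rfl (fun a _ => ?_)
    rw [← sum_add_distrib]
  rw [hsum, mul_add]
  have h5 : (d : ℝ) ^ 3 ≤ N * (d : ℝ) ^ 3 := le_mul_of_one_le_left (by positivity) hN'
  have h6 : 0 ≤ N * (d : ℝ) ^ 3 := by positivity
  calc _ ≤ (d : ℝ) ^ 3 + 3 * N * (d : ℝ) ^ 3 := add_le_add e3 e4
    _ ≤ _ := by linarith

end case2b
end PolyDeg

namespace PolyDeg
open Finset
open scoped Classical

lemma choose_lb (t K : ℕ) (hK : 1 ≤ K) (ht : 2 * K ≤ t) :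
    ((t : ℝ) / (2 * K)) ^ K ≤ (t.choose K : ℝ) := by
  have hK' : (0 : ℝ) < K := by exact_mod_cast hK
  have h := Nat.pow_le_choose (α := ℝ) K t
  refine le_trans ?_ h
  have h1 : ((K.factorial : ℕ) : ℝ) ≤ (K : ℝ) ^ K := by exact_mod_cast Nat.factorial_le_pow K
  have h2 : (t : ℝ) / 2 ≤ ((t + 1 - K : ℕ) : ℝ) := by
    rw [div_le_iff₀ (by norm_num)]
    have : t ≤ (t + 1 - K) * 2 := by omega
    exact_mod_cast this
  have h3 : (0 : ℝ) < (K.factorial : ℕ) := by exact_mod_cast Nat.factorial_pos K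
  calc ((t : ℝ) / (2 * K)) ^ K = ((t : ℝ) / 2) ^ K / (K : ℝ) ^ K := by
        rw [← div_pow, div_div]
    _ ≤ (((t + 1 - K : ℕ) : ℝ)) ^ K / ((K.factorial : ℕ) : ℝ) := by gcongr
    _ = _ := rfl

section case2c
variable {V : Type} [Fintype V] {G : SimpleGraph V} {d : ℕ}

set_option maxHeartbeats 1000000 in
/-- per-vertex bound. -/
lemma vb (D : Deg G d) (H L : Finset V) (K : ℕ) (v : V) (hv : v ∈ L) (hK1 : 1 ≤ K)
    {r N x Q : ℕ} (hN1 : 1 ≤ N) (hx : 1 ≤ x) (hQ : 16 * K ≤ Q) (hQx : 2 * K * x ≤ Q)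
    (hr : 16 * Q ^ K * K ^ 2 * x ^ 2 ≤ r) (hd : Q ^ K ≤ d)
    (hK : KST G d (r ^ 2)) (hH : ∀ a ∈ H, fd D a ≤ 2 * N * d) (hT : d ≤ x * (Tb D H v).card)
    (q ρ : ℝ) (hqd : q = 1 / (d * Q)) (hρd : ρ = Q ^ K / (8 * (K + 1) * (N * d))) :
    1 / (32 * (K + 1) * N * d * (2 * K * x) ^ K : ℝ) ≤
      Ex ρ (fun B => Ex q (fun A => ind (inB D H L K A B v))) := by
  set t := (Tb D H v).card with ht
  have hQ1 : 1 ≤ Q := by omega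
  have hQd : Q ≤ d := le_trans (Nat.le_self_pow (by omega) Q) hd
  have hd1 : 1 ≤ d := by omega
  have htd : t ≤ d := Tb_card D H v
  have ht2 : 2 * K ≤ t := by
    have : x * (2 * K) ≤ x * t := by nlinarith
    exact Nat.le_of_mul_le_mul_left this hx
  have hrr : 2 ≤ r := by
    have h1 : 0 < Q ^ K * K ^ 2 * x ^ 2 := by positivity
    nlinarith
  have cK : (1 : ℝ) ≤ K := by exact_mod_cast hK1
  have cN : (1 : ℝ) ≤ N := by exact_mod_cast hN1
  have cx : (1 : ℝ) ≤ x := by exact_mod_cast hx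
  have cQ : (16 : ℝ) * K ≤ Q := by exact_mod_cast hQ
  have cQ1 : (1 : ℝ) ≤ Q := by exact_mod_cast hQ1
  have cd : (Q : ℝ) ^ K ≤ d := by exact_mod_cast hd
  have cd1 : (1 : ℝ) ≤ d := by exact_mod_cast hd1
  have cr : (16 : ℝ) * Q ^ K * K ^ 2 * x ^ 2 ≤ r := by exact_mod_cast hr
  have cT : (d : ℝ) ≤ x * t := by exact_mod_cast hT
  have ctd : (t : ℝ) ≤ d := by exact_mod_cast htd
  have ct2 : (2 : ℝ) * K ≤ t := by exact_mod_cast ht2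
  have ct : (0 : ℝ) < t := by linarith
  have crr : (2 : ℝ) ≤ r := by exact_mod_cast hrr
  have cQK : (1 : ℝ) ≤ (Q : ℝ) ^ K := one_le_pow₀ cQ1
  have hdQ : (1 : ℝ) ≤ d * Q := by nlinarith
  have q0 : 0 ≤ q := by rw [hqd]; positivity
  have q1 : q ≤ 1 := by rw [hqd]; exact (div_le_one (by positivity)).2 hdQ
  have r0 : 0 ≤ ρ := by rw [hρd]; positivity
  have hND : (d : ℝ) ≤ N * d := le_mul_of_one_le_left (by positivity) cN
  have r1 : ρ ≤ 1 := by
    rw [hρd, div_le_one (by positivity)]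
    have : (1 : ℝ) * (N * d) ≤ 8 * (K + 1) * (N * d) :=
      mul_le_mul_of_nonneg_right (by linarith) (by positivity)
    linarith
  have hrpos : (0 : ℝ) < r := by linarith
  have hE1 := estE1 D H v hK
  have hE2 : ((r ^ 2 : ℕ) : ℝ) * ∑ u ∈ univ.erase v, h1 D H v (Tb D H v) u ≤ (d : ℝ) ^ 2 :=
    estN D H v v hK (univ.erase v)
  have hE3 := estE3 D H v hrr hd1 hN1 hK hH
  have hR : (r : ℝ) ≤ ((r ^ 2 : ℕ) : ℝ) := by push_cast; nlinarith
  have hE1' : ∑ a ∈ Tb D H v, ∑ b ∈ Tb D H v, ind (b ∈ D.Nb a) ≤ (d : ℝ) ^ 2 / r := by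
    rw [le_div_iff₀ hrpos, mul_comm]
    exact (mul_le_mul_of_nonneg_right hR
      (sum_nonneg (fun _ _ => sum_nonneg (fun _ _ => ind_nonneg _)))).trans hE1
  have hE2' : ∑ u ∈ univ.erase v, h1 D H v (Tb D H v) u ≤ (d : ℝ) ^ 2 / r := by
    rw [le_div_iff₀ hrpos, mul_comm]
    exact (mul_le_mul_of_nonneg_right hR (sum_nonneg (fun _ _ => h1_nonneg _ _ _ _ _))).trans hE2
  have hE3' : ∑ u ∈ univ.erase v, h2 D H (Tb D H v) u ≤ 8 * N * (d : ℝ) ^ 3 / r := by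
    rw [le_div_iff₀ hrpos, mul_comm]; exact hE3
  have hvb := vbound D H L K v hv q0 q1 r0 r1 _ _ _ hE1' hE2' hE3'
  refine le_trans ?_ hvb
  rw [← ht]
  -- κ
  have hκ : (K : ℝ) / t ≤ K * x / d := by
    rw [div_le_div_iff₀ ct (by linarith)]
    nlinarith
  have hκ0 : (0 : ℝ) ≤ K / t := by positivity
  have dq : (d : ℝ) * q = 1 / Q := by rw [hqd]; field_simp
  have b1 : (K : ℝ) * d * q ≤ 1 / 16 := by
    rw [mul_assoc, dq, mul_one_div, div_le_div_iff₀ (by linarith) (by norm_num)]; linarith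
  have bx : (Q : ℝ) ^ K * K ^ 2 * x ^ 2 / r ≤ 1 / 16 := by
    rw [div_le_div_iff₀ hrpos (by norm_num)]; linarith
  have hKx : (1 : ℝ) ≤ K * x := one_le_mul_of_one_le_of_one_le cK cx
  have b2 : ((K : ℝ) / t) ^ 2 * ((d : ℝ) ^ 2 / r) ≤ 1 / 16 := by
    calc ((K : ℝ) / t) ^ 2 * ((d : ℝ) ^ 2 / r) ≤ ((K : ℝ) * x / d) ^ 2 * ((d : ℝ) ^ 2 / r) := by gcongr
      _ = 1 * (K : ℝ) ^ 2 * x ^ 2 / r := by field_simp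
      _ ≤ (Q : ℝ) ^ K * K ^ 2 * x ^ 2 / r := by gcongr
      _ ≤ _ := bx
  have hρle : ρ ≤ Q ^ K / (8 * (N * d)) := by
    rw [hρd]
    gcongr
    nlinarith
  have b3 : ρ * ((K + 1) * d * (d * q) ^ K) ≤ 1 / 8 := by
    rw [dq, hρd]
    have : (Q : ℝ) ^ K / (8 * (K + 1) * (N * d)) * ((K + 1) * d * (1 / Q) ^ K) = 1 / (8 * N) := by
      rw [one_div, inv_pow]
      field_simp
    rw [this]
    gcongr
    linarith
  have b4 : ρ * ((K / t) * ((d : ℝ) ^ 2 / r)) ≤ 1 / 16 := by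
    calc ρ * ((K / t) * ((d : ℝ) ^ 2 / r)) ≤ (Q : ℝ) ^ K / (8 * (N * d)) * (((K : ℝ) * x / d) * ((d : ℝ) ^ 2 / r)) := by
          gcongr
      _ = (Q : ℝ) ^ K * (K * x) / r / (8 * N) := by field_simp
      _ ≤ (Q : ℝ) ^ K * (K * x) / r / 1 := by gcongr; linarith
      _ = (Q : ℝ) ^ K * (K * x) / r := by rw [div_one]
      _ ≤ (Q : ℝ) ^ K * ((K * x) ^ 2) / r := by gcongr; nlinarith
      _ = (Q : ℝ) ^ K * K ^ 2 * x ^ 2 / r := by ring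
      _ ≤ _ := bx
  have b5 : ρ * ((K / t) ^ 2 * (8 * N * (d : ℝ) ^ 3 / r)) ≤ 1 / 16 := by
    calc ρ * ((K / t) ^ 2 * (8 * N * (d : ℝ) ^ 3 / r))
          ≤ (Q : ℝ) ^ K / (8 * (N * d)) * (((K : ℝ) * x / d) ^ 2 * (8 * N * (d : ℝ) ^ 3 / r)) := by gcongr
      _ = (Q : ℝ) ^ K * K ^ 2 * x ^ 2 / r := by field_simp
      _ ≤ _ := bx
  have hbr : (1 : ℝ) / 2 ≤ 1 - K * d * q - ((K : ℝ) / t) ^ 2 * ((d : ℝ) ^ 2 / r) -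
      ρ * ((K + 1) * d * (d * q) ^ K + (K / t) * ((d : ℝ) ^ 2 / r) +
        (K / t) ^ 2 * (8 * N * (d : ℝ) ^ 3 / r)) := by
    rw [mul_add, mul_add]; linarith
  have hpow : (1 : ℝ) / 2 ≤ (1 - q) ^ (t - K) := by
    have h1 := one_add_mul_le_pow (show (-2 : ℝ) ≤ -q by linarith) (t - K)
    have h2 : ((t - K : ℕ) : ℝ) ≤ d := by
      have : t - K ≤ d := by omega
      exact_mod_cast this
    have h3 : ((t - K : ℕ) : ℝ) * q ≤ d * q := by gcongr
    have h4 : (1 : ℝ) / Q ≤ 1 / 2 := by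
      gcongr; linarith
    rw [dq] at h3
    have : (1 : ℝ) + -q = 1 - q := by ring
    rw [this] at h1
    linarith
  have hch := choose_lb t K hK1 ht2
  have hch2 : ((d : ℝ) / (2 * K * x)) ^ K ≤ (t.choose K : ℝ) := by
    refine le_trans ?_ hch
    have : (d : ℝ) / (2 * K * x) ≤ t / (2 * K) := by
      rw [div_le_div_iff₀ (by positivity) (by positivity)]
      nlinarith
    gcongr
  have hpE : q ^ K * (1 / 2) ≤ pE q K t := by
    unfold pE
    gcongr
  calc 1 / (32 * (K + 1) * N * d * (2 * K * x) ^ K : ℝ)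
      = ρ * (q ^ K * (1 / 2)) * ((d : ℝ) / (2 * K * x)) ^ K * (1 / 2) := by
        rw [hρd, hqd, div_pow, div_pow, one_pow, mul_pow (d : ℝ)]
        field_simp
        norm_num
    _ ≤ ρ * pE q K t * (t.choose K) * (1 / 2) := by
        have := pE_nonneg q0 q1 K t
        gcongr
    _ ≤ _ := by
        refine mul_le_mul_of_nonneg_left hbr ?_
        have := pE_nonneg q0 q1 K t
        positivity

lemma case2_false (D : Deg G d) (H : Finset V) (K : ℕ) (hK1 : 1 ≤ K) (hNS : NoSparse G K)
    {r N x Q : ℕ} (hN1 : 1 ≤ N) (hx : 1 ≤ x) (hQ : Q = 64 * (K + 1) * x * (2 * K * x) ^ K)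
    (hr : 16 * Q ^ K * K ^ 2 * x ^ 2 ≤ r) (hd : Q ^ K ≤ d) (hn : 0 < Fintype.card V)
    (hK : KST G d (r ^ 2)) (hH : ∀ a ∈ H, fd D a ≤ 2 * N * d) (hHc : N * H.card ≤ Fintype.card V)
    (hsum : 2 * (d * Fintype.card V) ≤ x * ∑ v, (Tb D H v).card) : False := by
  have hp : 1 ≤ (2 * K * x) ^ K := Nat.one_le_pow _ _ (by positivity)
  have hp2 : 2 * K * x ≤ (2 * K * x) ^ K := Nat.le_self_pow (by omega) _
  have hQ1 : 16 * K ≤ Q := by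
    rw [hQ]
    calc 16 * K ≤ 64 * (K + 1) * 1 * 1 := by omega
      _ ≤ _ := by gcongr
  have hQ2 : 2 * K * x ≤ Q := by
    rw [hQ]
    calc 2 * K * x ≤ 1 * (2 * K * x) ^ K := by omega
      _ ≤ _ := by
        refine Nat.mul_le_mul_right _ ?_
        have : 0 < (K + 1) * x := by positivity
        nlinarith
  have hd1 : 1 ≤ d := le_trans (Nat.one_le_pow _ _ (by omega)) hd
  set L := univ.filter (fun v => d ≤ x * (Tb D H v).card) with hL
  have hLc : Fintype.card V ≤ x * L.card := by
    have h1 : x * ∑ v, (Tb D H v).card ≤ d * Fintype.card V + x * L.card * d := by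
      rw [mul_sum]
      calc _ ≤ ∑ v, (d + if d ≤ x * (Tb D H v).card then x * d else 0) := by
            refine sum_le_sum (fun v _ => ?_)
            have := Tb_card D H v
            split_ifs with h
            · have := Nat.mul_le_mul_left x this
              omega
            · omega
        _ = _ := by
            rw [sum_add_distrib, ← sum_filter, sum_const, sum_const, smul_eq_mul, smul_eq_mul, card_univ]
            ring
    have h2 : d * Fintype.card V ≤ d * (x * L.card) := by nlinarith
    exact Nat.le_of_mul_le_mul_left h2 hd1
  set q : ℝ := 1 / (d * Q) with hqd
  set ρ : ℝ := Q ^ K / (8 * (K + 1) * (N * d)) with hρd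
  have cN : (1 : ℝ) ≤ N := by exact_mod_cast hN1
  have cK : (1 : ℝ) ≤ K := by exact_mod_cast hK1
  have cd1 : (1 : ℝ) ≤ d := by exact_mod_cast hd1
  have cx : (1 : ℝ) ≤ x := by exact_mod_cast hx
  have cQ1 : (1 : ℝ) ≤ Q := by
    have : 1 ≤ Q := by omega
    exact_mod_cast this
  have cd : (Q : ℝ) ^ K ≤ d := by exact_mod_cast hd
  have hdQ : (1 : ℝ) ≤ d * Q := by nlinarith
  have q0 : 0 ≤ q := by rw [hqd]; positivity
  have q1 : q ≤ 1 := by rw [hqd]; exact (div_le_one (by positivity)).2 hdQ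
  have r0 : 0 ≤ ρ := by rw [hρd]; positivity
  have hND : (d : ℝ) ≤ N * d := le_mul_of_one_le_left (by positivity) cN
  have r1 : ρ ≤ 1 := by
    rw [hρd, div_le_one (by positivity)]
    have : (1 : ℝ) * (N * d) ≤ 8 * (K + 1) * (N * d) :=
      mul_le_mul_of_nonneg_right (by linarith) (by positivity)
    linarith
  have htot := total D H L K hNS q0 q1 r0 r1
  have hlow : (L.card : ℝ) * (1 / (32 * (K + 1) * N * d * (2 * K * x) ^ K : ℝ)) ≤ q * H.card := by
    refine le_trans ?_ htot
    rw [← nsmul_eq_mul, ← sum_const]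
    refine sum_le_sum (fun v hv => ?_)
    exact vb D H L K v hv hK1 hN1 hx hQ1 hQ2 hr hd hK hH (mem_filter.1 hv).2 q ρ hqd hρd
  have cH : (N : ℝ) * H.card ≤ Fintype.card V := by exact_mod_cast hHc
  have cL : (Fintype.card V : ℝ) ≤ x * L.card := by exact_mod_cast hLc
  have cn : (0 : ℝ) < Fintype.card V := by exact_mod_cast hn
  rw [hqd, mul_one_div, div_mul_eq_mul_div, one_mul, div_le_div_iff₀ (by positivity) (by positivity)] at hlow
  have cQ : (Q : ℝ) = 64 * (K + 1) * x * (2 * K * x) ^ K := by rw [hQ]; push_cast; ring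
  rw [cQ] at hlow
  set W : ℝ := 32 * (K + 1) * d * (2 * K * x) ^ K with hW
  have hWp : 0 < W := by positivity
  have h1 : W * (2 * (x * L.card)) ≤ W * (N * H.card) := by
    rw [hW]; linarith
  have h2 := le_of_mul_le_mul_left h1 hWp
  linarith

lemma core (D : Deg G d) (K P J : ℕ) (hK1 : 1 ≤ K) (hP : 1 ≤ P) (hJ : 1 ≤ J) (hNS : NoSparse G K)
    (hND : NoDense G P) {r Q : ℕ} (hQ : Q = 64 * (K + 1) * (16 * J) * (2 * K * (16 * J)) ^ K)
    (hr : 16 * Q ^ K * K ^ 2 * (16 * J) ^ 2 ≤ r) (hrP : 4096 * P < r) (hd : Q ^ K ≤ d) (hdP : 64 * P ≤ d)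
    (hn : 0 < Fintype.card V) (hK : KST G d (r ^ 2))
    (hJd : 32 * ((4 * d) ^ P * (d + 1)) ≤ 2 ^ J)
    (hsum : d * Fintype.card V ≤ 4 * ∑ v, (D.Nb v).card) : False := by
  have hd1 : 1 ≤ d := by omega
  set n := Fintype.card V with hndef
  set Hinf := univ.filter (fun u => 2 ^ J * d ≤ fd D u) with hHinf
  have hfdH : ∀ (M : ℕ) (X : Finset V), (∀ u ∈ X, M * d ≤ fd D u) → M * X.card ≤ n := by
    intro M X hX
    have h1 : X.card * (M * d) ≤ d * n := by
      refine le_trans ?_ (sum_fd_le D X)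
      rw [← smul_eq_mul, ← sum_const]
      exact sum_le_sum hX
    have h2 : d * (M * X.card) ≤ d * n := by nlinarith
    exact Nat.le_of_mul_le_mul_left h2 hd1
  have hHc : 2 ^ J * Hinf.card ≤ n := hfdH _ _ (fun u hu => (mem_filter.1 hu).2)
  by_cases hc : d * n ≤ 8 * ∑ v, (D.Nb v ∩ Hinf).card
  · set L := univ.filter (fun v => d ≤ 16 * (D.Nb v ∩ Hinf).card) with hL
    have hLc : n ≤ 16 * L.card := by
      have h1 : 16 * ∑ v, (D.Nb v ∩ Hinf).card ≤ d * n + 16 * L.card * d := by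
        rw [mul_sum]
        calc _ ≤ ∑ v, (d + if d ≤ 16 * (D.Nb v ∩ Hinf).card then 16 * d else 0) := by
              refine sum_le_sum (fun v _ => ?_)
              have : (D.Nb v ∩ Hinf).card ≤ d := Tb_card D Hinf v
              split_ifs with h <;> omega
          _ = _ := by
              rw [sum_add_distrib, ← sum_filter, sum_const, sum_const, smul_eq_mul, smul_eq_mul, card_univ]
              ring
      have h2 : d * n ≤ d * (16 * L.card) := by nlinarith
      exact Nat.le_of_mul_le_mul_left h2 hd1
    have hrr : r ≤ r ^ 2 := Nat.le_self_pow (by norm_num) r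
    have h3 := case1 D hd1 hND Hinf L (fun v hv =>
      indep_in hK hP (by omega) hdP _ (Tb_card D Hinf v) (mem_filter.1 hv).2)
    have h4 : 32 * L.card ≤ n := by
      calc 32 * L.card ≤ 32 * ((4 * d) ^ P * (d + 1) * Hinf.card) := Nat.mul_le_mul_left _ h3
        _ = 32 * ((4 * d) ^ P * (d + 1)) * Hinf.card := by ring
        _ ≤ 2 ^ J * Hinf.card := Nat.mul_le_mul_right _ hJd
        _ ≤ n := hHc
    omega
  · push Not at hc
    set Hi : ℕ → Finset V := fun i => univ.filter (fun u => fd D u < 2 ^ (i + 1) * d ∧ (i = 0 ∨ 2 ^ i * d ≤ fd D u))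
      with hHi
    have hcov : ∀ u, u ∈ Hinf ∨ ∃ i ∈ range J, u ∈ Hi i := by
      intro u
      by_cases hu : 2 ^ J * d ≤ fd D u
      · left; exact mem_filter.2 ⟨mem_univ _, hu⟩
      · right
        push Not at hu
        have hex : ∃ i, fd D u < 2 ^ (i + 1) * d := ⟨J - 1, by rwa [Nat.sub_add_cancel hJ]⟩
        refine ⟨Nat.find hex, mem_range.2 ?_, mem_filter.2 ⟨mem_univ _, Nat.find_spec hex, ?_⟩⟩
        · have : Nat.find hex ≤ J - 1 := Nat.find_min' hex (by rwa [Nat.sub_add_cancel hJ])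
          omega
        · by_cases h0 : Nat.find hex = 0
          · left; exact h0
          · right
            have := Nat.find_min hex (show Nat.find hex - 1 < Nat.find hex by omega)
            rw [Nat.sub_add_cancel (by omega)] at this
            omega
    have hcard : ∀ v, (D.Nb v).card ≤ (D.Nb v ∩ Hinf).card + ∑ i ∈ range J, (D.Nb v ∩ Hi i).card := by
      intro v
      have hsub : D.Nb v ⊆ (D.Nb v ∩ Hinf) ∪ (range J).biUnion (fun i => D.Nb v ∩ Hi i) := by
        intro u hu
        rcases hcov u with h | ⟨i, hi, h⟩
        · exact mem_union_left _ (mem_inter.2 ⟨hu, h⟩)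
        · exact mem_union_right _ (mem_biUnion.2 ⟨i, hi, mem_inter.2 ⟨hu, h⟩⟩)
      exact (card_le_card hsub).trans ((card_union_le _ _).trans (Nat.add_le_add_left card_biUnion_le _))
    have htot : ∑ v, (D.Nb v).card ≤ ∑ v, (D.Nb v ∩ Hinf).card + ∑ i ∈ range J, ∑ v, (D.Nb v ∩ Hi i).card := by
      rw [sum_comm, ← sum_add_distrib]
      exact sum_le_sum (fun v _ => hcard v)
    have hlow : d * n ≤ ∑ i ∈ range J, 8 * ∑ v, (D.Nb v ∩ Hi i).card := by
      rw [← mul_sum]; omega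
    have hex : ∃ i ∈ range J, 2 * (d * n) ≤ 16 * J * ∑ v, (D.Nb v ∩ Hi i).card := by
      by_contra hcon
      push Not at hcon
      have h1 : ∑ i ∈ range J, (16 * J * ∑ v, (D.Nb v ∩ Hi i).card) < ∑ i ∈ range J, 2 * (d * n) :=
        sum_lt_sum_of_nonempty ⟨0, mem_range.2 (by omega)⟩ hcon
      rw [sum_const, card_range, smul_eq_mul, ← mul_sum] at h1
      rw [← mul_sum] at hlow
      have h2 := Nat.mul_le_mul_left (2 * J) hlow
      nlinarith
    obtain ⟨i, -, hi⟩ := hex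
    refine case2_false D (Hi i) K hK1 hNS (N := 2 ^ i) (Nat.one_le_two_pow) (x := 16 * J) (by omega) hQ hr hd hn hK
      ?_ ?_ hi
    · intro a ha
      have := (mem_filter.1 ha).2.1
      rw [pow_succ] at this
      nlinarith
    · rcases Nat.eq_zero_or_pos i with h0 | h0
      · rw [h0, pow_zero, one_mul]; exact card_le_univ _
      · refine hfdH _ _ (fun u hu => ?_)
        rcases (mem_filter.1 hu).2.2 with h | h
        · omega
        · exact h

end case2c
end PolyDeg

namespace PolyDeg
open Finset
open scoped Classical

lemma exp_beats (c : ℕ) : ∃ C : ℕ, 1 ≤ C ∧ ∀ s, 2 ≤ s → c * (s * C) ^ c ≤ s ^ C := by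
  have h := tendsto_pow_const_div_const_pow_of_one_lt c (show (1 : ℝ) < 2 by norm_num)
  have hε : (0 : ℝ) < 1 / ((c + 1) * 2 ^ c) := by positivity
  have h2 := (h.eventually (gt_mem_nhds hε)).and (Filter.eventually_ge_atTop (c + 1))
  obtain ⟨C, hC, hCc⟩ := h2.exists
  refine ⟨C, by omega, fun s hs => ?_⟩
  rw [div_lt_div_iff₀ (by positivity) (by positivity), one_mul] at hC
  have h3 : C ^ c * ((c + 1) * 2 ^ c) < 2 ^ C := by exact_mod_cast hC
  have h4 : c * C ^ c ≤ 2 ^ (C - c) := by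
    have e : 2 ^ C = 2 ^ (C - c) * 2 ^ c := by rw [← pow_add]; congr 1; omega
    rw [e] at h3
    have : (c * C ^ c) * 2 ^ c ≤ 2 ^ (C - c) * 2 ^ c := by
      refine le_trans ?_ h3.le
      nlinarith [Nat.zero_le (C ^ c * 2 ^ c)]
    exact Nat.le_of_mul_le_mul_right this (by positivity)
  calc c * (s * C) ^ c = (c * C ^ c) * s ^ c := by rw [mul_pow]; ring
    _ ≤ s ^ (C - c) * s ^ c := Nat.mul_le_mul_right _ (h4.trans (Nat.pow_le_pow_left hs _))
    _ = s ^ C := by rw [← pow_add]; congr 1; omega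

def fP (c0 y : ℕ) : ℕ := c0 * y ^ c0
def fJ (c0 y : ℕ) : ℕ := (y + 3) * fP c0 y + y + 7
def fQ (K c0 y : ℕ) : ℕ := 64 * (K + 1) * (16 * fJ c0 y) * (2 * K * (16 * fJ c0 y)) ^ K
def fr (K c0 y : ℕ) : ℕ := 16 * fQ K c0 y ^ K * K ^ 2 * (16 * fJ c0 y) ^ 2 + 4096 * fP c0 y + 1
def fF (K c0 c y : ℕ) : ℕ := c * (y * fr K c0 y ^ 2) ^ c + fQ K c0 y ^ K + 64 * fP c0 y

lemma fF_PB (K c0 c : ℕ) : PB (fF K c0 c) := by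
  have hP : PB (fP c0) := (PB.const c0).mul (PB.id.pow c0)
  have hJ : PB (fJ c0) := (((PB.id.add (PB.const 3)).mul hP).add PB.id).add (PB.const 7)
  have h16 : PB (fun y => 16 * fJ c0 y) := (PB.const 16).mul hJ
  have hQ : PB (fQ K c0) :=
    ((PB.const (64 * (K + 1))).mul h16).mul (((PB.const (2 * K)).mul h16).pow K)
  have hr : PB (fr K c0) :=
    (((((PB.const 16).mul (hQ.pow K)).mul (PB.const (K ^ 2))).mul (h16.pow 2)).add
      ((PB.const 4096).mul hP)).add (PB.const 1)
  exact (((PB.const c).mul ((PB.id.mul (hr.pow 2)).pow c)).add (hQ.pow K)).add ((PB.const 64).mul hP)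

lemma main_deg (K c0 : ℕ) (hK1 : 1 ≤ K) (hc0 : 1 ≤ c0) : ∃ C : ℕ, 1 ≤ C ∧ ∀ s, 2 ≤ s →
    ∀ (V : Type) [Fintype V] (G : SimpleGraph V), KFree G s → NoSparse G K →
    NoDense G (fP c0 (s * C)) → 0 < Fintype.card V → ∀ D : Deg G (2 * s ^ C),
    2 * s ^ C * Fintype.card V ≤ 4 * ∑ v, (D.Nb v).card → False := by
  obtain ⟨c, hc⟩ := kst K
  obtain ⟨c1, hc1⟩ := fF_PB K c0 c
  obtain ⟨C, hC1, hC⟩ := exp_beats c1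
  refine ⟨C, hC1, fun s hs V _ G hKF hNS hND hn D hsum => ?_⟩
  set y := s * C with hy
  have hy1 : 1 ≤ y := Nat.mul_pos (by omega) hC1
  have hsy : s ≤ y := Nat.le_mul_of_pos_right _ hC1
  have hF : fF K c0 c y ≤ s ^ C := (hc1 y hy1).trans (hC s hs)
  have hP1 : 1 ≤ fP c0 y := Nat.mul_pos hc0 (Nat.one_le_pow _ _ hy1)
  have hFd : fF K c0 c y ≤ 2 * s ^ C := by omega
  have hr1 : 1 ≤ fr K c0 y := by unfold fr; omega
  have hkst : KST G (2 * s ^ C) (fr K c0 y ^ 2) := by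
    refine hc V G s (2 * s ^ C) _ (by omega) (Nat.one_le_pow _ _ hr1) hKF hNS ?_
    refine le_trans ?_ hFd
    unfold fF
    have : c * (s * fr K c0 y ^ 2) ^ c ≤ c * (y * fr K c0 y ^ 2) ^ c := by gcongr
    omega
  refine core D K (fP c0 y) (fJ c0 y) hK1 hP1 (by unfold fJ; omega) hNS hND (r := fr K c0 y)
    (Q := fQ K c0 y) rfl (by unfold fr; omega) (by unfold fr; omega) ?_ ?_ hn hkst ?_ hsum
  · unfold fF at hFd; omega
  · unfold fF at hFd; omega
  · have hs2 : s ^ C ≤ 2 ^ y := by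
      rw [hy, pow_mul]
      exact Nat.pow_le_pow_left (Nat.lt_two_pow_self).le _
    have h1 : 2 * s ^ C ≤ 2 ^ (y + 1) := by rw [pow_succ]; omega
    have h4 : 4 * (2 * s ^ C) ≤ 2 ^ (y + 3) := by rw [pow_succ, pow_succ, pow_succ]; omega
    have h5 : 2 * s ^ C + 1 ≤ 2 ^ (y + 2) := by
      have : 1 ≤ 2 ^ y := Nat.one_le_two_pow
      rw [pow_succ, pow_succ]; omega
    calc 32 * ((4 * (2 * s ^ C)) ^ fP c0 y * (2 * s ^ C + 1))
        ≤ 2 ^ 5 * ((2 ^ (y + 3)) ^ fP c0 y * 2 ^ (y + 2)) := by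
          gcongr
          norm_num
      _ = 2 ^ fJ c0 y := by
          rw [← pow_mul, ← pow_add, ← pow_add]
          congr 1
          unfold fJ
          ring

lemma degen {V : Type} [Fintype V] (G : SimpleGraph V) (d : ℕ)
    (h : ∀ W : Finset V, W.Nonempty → ∃ u ∈ W, (W.filter (fun w => G.Adj u w)).card ≤ d) :
    ∃ D : Deg G d, 2 * ∑ v, (D.Nb v).card = ∑ v, (univ.filter (fun w => G.Adj v w)).card := by
  have key : ∀ (k : ℕ) (W : Finset V), W.card = k → ∃ f : V → ℕ, (∀ u ∈ W, f u < k) ∧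
      (∀ u ∈ W, ∀ v ∈ W, f u = f v → u = v) ∧
      ∀ v ∈ W, (W.filter (fun u => G.Adj v u ∧ f u < f v)).card ≤ d := by
    intro k
    induction k with
    | zero =>
      intro W hW
      rw [card_eq_zero] at hW
      subst hW
      exact ⟨fun _ => 0, by simp, by simp, by simp⟩
    | succ k ih =>
      intro W hW
      obtain ⟨u, hu, hud⟩ := h W (card_pos.1 (by omega))
      obtain ⟨f, f1, f2, f3⟩ := ih (W.erase u) (by rw [card_erase_of_mem hu]; omega)
      have g0 : ∀ x, x ≠ u → Function.update f u k x = f x := fun x hx => Function.update_of_ne hx _ _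
      have gu : Function.update f u k u = k := Function.update_self _ _ _
      have mem : ∀ x ∈ W, x ≠ u → x ∈ W.erase u := fun x hx hxu => mem_erase.2 ⟨hxu, hx⟩
      refine ⟨Function.update f u k, ?_, ?_, ?_⟩
      · intro x hx
        by_cases hxu : x = u
        · rw [hxu, gu]; omega
        · rw [g0 x hxu]; have := f1 x (mem x hx hxu); omega
      · intro x hx z hz hxz
        by_cases hxu : x = u <;> by_cases hzu : z = u
        · rw [hxu, hzu]
        · rw [hxu, gu, g0 z hzu] at hxz; have := f1 z (mem z hz hzu); omega
        · rw [hzu, gu, g0 x hxu] at hxz; have := f1 x (mem x hx hxu); omega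
        · rw [g0 x hxu, g0 z hzu] at hxz; exact f2 x (mem x hx hxu) z (mem z hz hzu) hxz
      · intro v hv
        by_cases hvu : v = u
        · refine le_trans (card_le_card ?_) hud
          intro w hw
          rw [mem_filter] at hw ⊢
          rw [hvu] at hw
          exact ⟨hw.1, hw.2.1⟩
        · refine le_trans (card_le_card ?_) (f3 v (mem v hv hvu))
          intro w hw
          rw [mem_filter, g0 v hvu] at hw
          have hv' := f1 v (mem v hv hvu)
          have hwu : w ≠ u := by
            rintro rfl
            rw [gu] at hw
            omega
          rw [g0 w hwu] at hw
          exact mem_filter.2 ⟨mem w hw.1 hwu, hw.2⟩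
  obtain ⟨f, -, f2, f3⟩ := key _ univ rfl
  have hlt : ∀ u v, G.Adj u v → f u < f v ∨ f v < f u := by
    intro u v huv
    have : f u ≠ f v := fun e => huv.ne (f2 u (mem_univ _) v (mem_univ _) e)
    omega
  refine ⟨⟨fun v => univ.filter (fun u => G.Adj v u ∧ f u < f v), f, ?_, ?_, ?_⟩, ?_⟩
  · intro u v
    simp only [mem_filter, mem_univ, true_and]
    constructor
    · intro huv
      rcases hlt u v huv with h | h
      · exact Or.inl ⟨huv.symm, h⟩
      · exact Or.inr ⟨huv, h⟩
    · rintro (h | h)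
      · exact h.1.symm
      · exact h.1
  · intro u v hu
    exact (mem_filter.1 hu).2.2
  · intro v
    exact f3 v (mem_univ _)
  · have e1 : ∀ v, (univ.filter (fun w => G.Adj v w)).card =
        (univ.filter (fun w => G.Adj v w ∧ f w < f v)).card +
        (univ.filter (fun w => G.Adj v w ∧ f v < f w)).card := by
      intro v
      rw [← card_union_of_disjoint]
      · congr 1
        ext w
        simp only [mem_filter, mem_univ, true_and, mem_union]
        constructor
        · intro hvw
          rcases hlt v w hvw with h | h
          · exact Or.inr ⟨hvw, h⟩
          · exact Or.inl ⟨hvw, h⟩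
        · rintro (h | h) <;> exact h.1
      · rw [Finset.disjoint_left]
        intro w h1 h2
        have := (mem_filter.1 h1).2.2
        have := (mem_filter.1 h2).2.2
        omega
    have e2 : ∑ v, (univ.filter (fun w => G.Adj v w ∧ f v < f w)).card =
        ∑ v, (univ.filter (fun w => G.Adj v w ∧ f w < f v)).card := by
      simp_rw [card_filter]
      rw [sum_comm]
      refine sum_congr rfl (fun v _ => sum_congr rfl (fun w _ => ?_))
      rw [G.adj_comm]
    simp_rw [e1]
    rw [sum_add_distrib, e2]
    ring

end PolyDeg


namespace PolyDeg
open Finset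
open scoped Classical

lemma two_edges {n m : ℕ} (G : SimpleGraph (Fin n)) (φ : Fin m ↪ Fin n) :
    2 * (G.comap φ).edgeSet.ncard =
      ∑ w ∈ univ.map φ, ((univ.map φ).filter (fun x => G.Adj w x)).card := by
  have h1 := (G.comap φ).sum_degrees_eq_twice_card_edges
  rw [Set.ncard_eq_toFinset_card', Set.toFinset_card, ← SimpleGraph.edgeFinset_card, ← h1, sum_map]
  refine sum_congr rfl (fun x _ => ?_)
  rw [← SimpleGraph.card_neighborFinset_eq_degree, SimpleGraph.neighborFinset_eq_filter, filter_map, card_map]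
  rfl

lemma two_edges' {n : ℕ} (G : SimpleGraph (Fin n)) :
    2 * G.edgeSet.ncard = ∑ w, (univ.filter (fun x => G.Adj w x)).card := by
  have h := two_edges G (Function.Embedding.refl _)
  have e : G.comap (Function.Embedding.refl (Fin n)) = G := rfl
  rw [e, map_refl] at h
  exact h

lemma mem_emb {n m : ℕ} {W : Finset (Fin n)} {φ : Fin m ↪ Fin n} (h : univ.map φ = W) (x : Fin m) : φ x ∈ W := by
  rw [← h]
  exact mem_map_of_mem _ (mem_univ _)

lemma exists_emb' {n s : ℕ} (W : Finset (Fin n)) (h : W.card = s) : ∃ φ : Fin s ↪ Fin n, univ.map φ = W :=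
  ⟨(W.orderEmbOfFin h).toEmbedding, W.map_orderEmbOfFin_univ h⟩

lemma exists_emb {n : ℕ} (W : Finset (Fin n)) : ∃ φ : Fin W.card ↪ Fin n, univ.map φ = W :=
  ⟨(W.orderEmbOfFin rfl).toEmbedding, W.map_orderEmbOfFin_univ rfl⟩

lemma induced_copy {n m : ℕ} (G : SimpleGraph (Fin n)) (φ : Fin m ↪ Fin n) :
    HasInducedCopy G (G.comap φ) := by
  refine ⟨Set.range φ, ⟨RelIso.symm ⟨Equiv.ofInjective φ φ.injective, ?_⟩⟩⟩
  intro a b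
  simp

lemma copy_comap {n m : ℕ} {W : Type} {G : SimpleGraph (Fin n)} (φ : Fin m ↪ Fin n) {H : SimpleGraph W}
    (h : HasSubgraphCopy (G.comap φ) H) : HasSubgraphCopy G H := by
  obtain ⟨f, hf⟩ := h
  exact ⟨⟨fun x => φ (f x), fun {a b} hab => f.map_rel hab⟩, fun a b hab => hf (φ.injective hab)⟩

lemma kfree_of {n s : ℕ} {G : SimpleGraph (Fin n)}
    (h : ¬ HasSubgraphCopy G (completeBipartiteGraph (Fin s) (Fin s))) : KFree G s := by
  intro X Y hX hY hXY
  apply h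
  obtain ⟨e, he⟩ := exists_emb' X hX
  obtain ⟨g, hg⟩ := exists_emb' Y hY
  have heX : ∀ i, e i ∈ X := fun i => mem_emb he i
  have hgY : ∀ i, g i ∈ Y := fun i => mem_emb hg i
  have hadj : ∀ i j, G.Adj (e i) (g j) := fun i j => hXY _ (heX i) _ (hgY j)
  refine ⟨⟨Sum.elim e g, ?_⟩, ?_⟩
  · rintro (a | a) (b | b) hab
    · simp at hab
    · exact hadj a b
    · exact (hadj b a).symm
    · simp at hab
  · rintro (a | a) (b | b) hab
    · exact congrArg _ (e.injective hab)
    · exact ((hadj a b).ne hab).elim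
    · exact ((hadj b a).ne hab.symm).elim
    · exact congrArg _ (g.injective hab)

lemma bip_avg {n : ℕ} (G : SimpleGraph (Fin n)) (A B : Finset (Fin n)) (P : ℕ) (hP : 1 ≤ P)
    (hA : Indep G A) (hB : Indep G B) (hAB : A.card ≤ B.card) (hBn : B.Nonempty)
    (hdeg : ∀ b ∈ B, P ≤ (A.filter (fun a => G.Adj b a)).card) :
    ∃ φ : Fin (A ∪ B).card ↪ Fin n, univ.map φ = A ∪ B ∧ (G.comap φ).Colorable 2 ∧
      (P : ℝ) ≤ avgDeg (G.comap φ) := by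
  have hdis : Disjoint A B := by
    rw [Finset.disjoint_left]
    intro x hxA hxB
    have h1 := hdeg x hxB
    obtain ⟨a, ha⟩ := card_pos.1 (show 0 < (A.filter (fun a => G.Adj x a)).card by omega)
    rw [mem_filter] at ha
    exact hA x hxA a ha.1 ha.2
  obtain ⟨φ, hφ⟩ := exists_emb (A ∪ B)
  refine ⟨φ, hφ, ?_, ?_⟩
  · refine ⟨SimpleGraph.Coloring.mk (fun x => if φ x ∈ A then (0 : Fin 2) else 1) ?_⟩
    intro x z hxz
    have hx : φ x ∈ A ∪ B := mem_emb hφ x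
    have hz : φ z ∈ A ∪ B := mem_emb hφ z
    rw [mem_union] at hx hz
    have hadj : G.Adj (φ x) (φ z) := hxz
    by_cases h1 : φ x ∈ A <;> by_cases h2 : φ z ∈ A
    · exact (hA _ h1 _ h2 hadj).elim
    · simp [h1, h2]
    · simp [h1, h2]
    · exact (hB _ (hx.resolve_left h1) _ (hz.resolve_left h2) hadj).elim
  · have h2e := two_edges G φ
    rw [hφ, sum_union hdis] at h2e
    have hb : P * B.card ≤ ∑ b ∈ B, (A.filter (fun a => G.Adj b a)).card := by
      rw [mul_comm, ← smul_eq_mul, ← sum_const]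
      exact sum_le_sum hdeg
    have hsw : ∑ b ∈ B, (A.filter (fun a => G.Adj b a)).card =
        ∑ a ∈ A, (B.filter (fun b => G.Adj a b)).card := by
      simp_rw [card_filter]
      rw [sum_comm]
      refine sum_congr rfl (fun a _ => sum_congr rfl (fun b _ => ?_))
      rw [G.adj_comm]
    have h1 : ∑ b ∈ B, (A.filter (fun a => G.Adj b a)).card ≤
        ∑ b ∈ B, ((A ∪ B).filter (fun a => G.Adj b a)).card :=
      sum_le_sum (fun b _ => card_le_card (filter_subset_filter _ subset_union_left))
    have h2 : ∑ a ∈ A, (B.filter (fun b => G.Adj a b)).card ≤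
        ∑ b ∈ A, ((A ∪ B).filter (fun a => G.Adj b a)).card :=
      sum_le_sum (fun b _ => card_le_card (filter_subset_filter _ subset_union_right))
    have h3 : 2 * (P * B.card) ≤ 2 * (G.comap φ).edgeSet.ncard := by omega
    have hcard : (A ∪ B).card ≤ 2 * B.card := by
      rw [card_union_of_disjoint hdis]; omega
    have hpos : 0 < (A ∪ B).card := by
      have := card_pos.2 hBn
      rw [card_union_of_disjoint hdis]; omega
    unfold avgDeg
    rw [Fintype.card_fin, le_div_iff₀ (by exact_mod_cast hpos)]
    have h4 : P * (A ∪ B).card ≤ 2 * (G.comap φ).edgeSet.ncard := by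
      refine le_trans ?_ h3
      have := Nat.mul_le_mul_left P hcard
      linarith
    exact_mod_cast h4

lemma noDense_of (𝒢 : ∀ n : ℕ, SimpleGraph (Fin n) → Prop)
    (hered : ∀ n (G : SimpleGraph (Fin n)), 𝒢 n G →
      ∀ m (H : SimpleGraph (Fin m)), HasInducedCopy G H → 𝒢 m H)
    (p : Polynomial ℝ)
    (hbip : ∀ s : ℕ, 0 < s → ∀ n (G : SimpleGraph (Fin n)), 𝒢 n G → G.Colorable 2 →
      ¬ HasSubgraphCopy G (completeBipartiteGraph (Fin s) (Fin s)) →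
      avgDeg G ≤ p.eval (s : ℝ))
    {n s P : ℕ} (hs : 0 < s) (hP : 1 ≤ P) (hPp : p.eval (s : ℝ) < P) (G : SimpleGraph (Fin n))
    (hG : 𝒢 n G) (hK : ¬ HasSubgraphCopy G (completeBipartiteGraph (Fin s) (Fin s))) : NoDense G P := by
  intro A B hA hB hAB hBn hdeg
  obtain ⟨φ, -, hcol, havg⟩ := bip_avg G A B P hP hA hB hAB hBn hdeg
  have := hbip s hs _ _ (hered n G hG _ _ (induced_copy G φ)) hcol (fun h => hK (copy_comap φ h))
  linarith

lemma noSparse_of (𝒢 : ∀ n : ℕ, SimpleGraph (Fin n) → Prop)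
    (hered : ∀ n (G : SimpleGraph (Fin n)), 𝒢 n G →
      ∀ m (H : SimpleGraph (Fin m)), HasInducedCopy G H → 𝒢 m H)
    (p : Polynomial ℝ)
    (hbip : ∀ s : ℕ, 0 < s → ∀ n (G : SimpleGraph (Fin n)), 𝒢 n G → G.Colorable 2 →
      ¬ HasSubgraphCopy G (completeBipartiteGraph (Fin s) (Fin s)) →
      avgDeg G ≤ p.eval (s : ℝ))
    {n K : ℕ} (hP : 1 ≤ K) (hPp : p.eval (2 : ℝ) < K) (G : SimpleGraph (Fin n))
    (hG : 𝒢 n G) : NoSparse G K := by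
  intro A B hA hB hAB hBn hdeg hC4
  obtain ⟨φ, hφ, hcol, havg⟩ := bip_avg G A B K hP hA hB hAB hBn hdeg
  have h2 : ¬ HasSubgraphCopy (G.comap φ) (completeBipartiteGraph (Fin 2) (Fin 2)) := by
    rintro ⟨f, hf⟩
    have hm : ∀ x, φ x ∈ A ∨ φ x ∈ B := fun x => mem_union.1 (mem_emb hφ x)
    have had : ∀ i j : Fin 2, G.Adj (φ (f (Sum.inl i))) (φ (f (Sum.inr j))) := by
      intro i j
      have hh : (completeBipartiteGraph (Fin 2) (Fin 2)).Adj (Sum.inl i) (Sum.inr j) := by simp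
      exact f.map_rel hh
    have hnl : φ (f (Sum.inl 0)) ≠ φ (f (Sum.inl 1)) := by
      intro h
      have := hf (φ.injective h)
      simp at this
    have hnr : φ (f (Sum.inr 0)) ≠ φ (f (Sum.inr 1)) := by
      intro h
      have := hf (φ.injective h)
      simp at this
    have toB : ∀ x z, φ x ∈ A → G.Adj (φ x) (φ z) → φ z ∈ B := fun x z hx h =>
      (hm z).resolve_left (fun hz => hA _ hx _ hz h)
    have toA : ∀ x z, φ x ∈ B → G.Adj (φ x) (φ z) → φ z ∈ A := fun x z hx h =>
      (hm z).resolve_right (fun hz => hB _ hx _ hz h)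
    rcases hm (f (Sum.inl 0)) with h0 | h0
    · have r0 := toB _ _ h0 (had 0 0)
      have r1 := toB _ _ h0 (had 0 1)
      have l1 := toA _ _ r0 (had 1 0).symm
      exact hC4 _ r0 _ r1 hnr _ h0 _ l1 hnl (had 0 0).symm (had 1 0).symm (had 0 1).symm (had 1 1).symm
    · have r0 := toA _ _ h0 (had 0 0)
      have r1 := toA _ _ h0 (had 0 1)
      have l1 := toB _ _ r0 (had 1 0).symm
      exact hC4 _ h0 _ l1 hnl _ r0 _ r1 hnr (had 0 0) (had 0 1) (had 1 0) (had 1 1)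
  have := hbip 2 (by norm_num) _ _ (hered n G hG _ _ (induced_copy G φ)) hcol h2
  have e : ((2 : ℕ) : ℝ) = 2 := by norm_num
  rw [e] at this
  linarith

lemma poly_bound (p : Polynomial ℝ) : ∃ c : ℕ, 1 ≤ c ∧ ∀ x : ℕ, 1 ≤ x → p.eval (x : ℝ) < (c * x ^ c : ℕ) := by
  obtain ⟨k, hk⟩ := exists_nat_gt (∑ i ∈ range (p.natDegree + 1), |p.coeff i|)
  refine ⟨k + p.natDegree + 1, by omega, fun x hx => ?_⟩
  have hx' : (1 : ℝ) ≤ x := by exact_mod_cast hx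
  rw [Polynomial.eval_eq_sum_range]
  calc ∑ i ∈ range (p.natDegree + 1), p.coeff i * (x : ℝ) ^ i
      ≤ ∑ i ∈ range (p.natDegree + 1), |p.coeff i| * (x : ℝ) ^ p.natDegree := by
        refine sum_le_sum (fun i hi => ?_)
        have hi' : i ≤ p.natDegree := by rw [mem_range] at hi; omega
        calc p.coeff i * (x : ℝ) ^ i ≤ |p.coeff i| * (x : ℝ) ^ i :=
              mul_le_mul_of_nonneg_right (le_abs_self _) (by positivity)
          _ ≤ _ := mul_le_mul_of_nonneg_left (pow_le_pow_right₀ hx' hi') (abs_nonneg _)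
    _ = (∑ i ∈ range (p.natDegree + 1), |p.coeff i|) * (x : ℝ) ^ p.natDegree := by rw [sum_mul]
    _ < k * (x : ℝ) ^ p.natDegree := mul_lt_mul_of_pos_right hk (by positivity)
    _ ≤ ((k + p.natDegree + 1 : ℕ) : ℝ) * (x : ℝ) ^ (k + p.natDegree + 1) := by
        have h1 : (k : ℝ) ≤ ((k + p.natDegree + 1 : ℕ) : ℝ) := by exact_mod_cast (by omega)
        have h2 : (x : ℝ) ^ p.natDegree ≤ (x : ℝ) ^ (k + p.natDegree + 1) := pow_le_pow_right₀ hx' (by omega)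
        gcongr
    _ = _ := by push_cast; ring

/-- The degeneracy reduction: a vertex-minimal dense graph of the class is impossible. -/
lemma final_nat (𝒢 : ∀ n : ℕ, SimpleGraph (Fin n) → Prop)
    (hered : ∀ n (G : SimpleGraph (Fin n)), 𝒢 n G →
      ∀ m (H : SimpleGraph (Fin m)), HasInducedCopy G H → 𝒢 m H)
    (p : Polynomial ℝ)
    (hbip : ∀ s : ℕ, 0 < s → ∀ n (G : SimpleGraph (Fin n)), 𝒢 n G → G.Colorable 2 →
      ¬ HasSubgraphCopy G (completeBipartiteGraph (Fin s) (Fin s)) →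
      avgDeg G ≤ p.eval (s : ℝ)) :
    ∃ C : ℕ, ∀ s : ℕ, 2 ≤ s → ∀ n (G : SimpleGraph (Fin n)), 𝒢 n G →
      ¬ HasSubgraphCopy G (completeBipartiteGraph (Fin s) (Fin s)) →
      2 * G.edgeSet.ncard ≤ s ^ C * n := by
  obtain ⟨c0, hc0, hp⟩ := poly_bound p
  obtain ⟨K0, hK0⟩ := exists_nat_gt (p.eval (2 : ℝ))
  obtain ⟨C, hC1, hC⟩ := main_deg (K0 + 1) c0 (by omega) hc0
  refine ⟨C, fun s hs => ?_⟩
  by_contra hcon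
  have hex : ∃ n, ∃ G : SimpleGraph (Fin n), 𝒢 n G ∧
      ¬ HasSubgraphCopy G (completeBipartiteGraph (Fin s) (Fin s)) ∧ s ^ C * n < 2 * G.edgeSet.ncard := by
    push Not at hcon
    obtain ⟨n, G, h1, h2, h3⟩ := hcon
    exact ⟨n, G, h1, h2, h3⟩
  obtain ⟨G, hG, hGK, hGe⟩ := Nat.find_spec hex
  have hmin := fun m => Nat.find_min hex (m := m)
  generalize Nat.find hex = n at G hG hGK hGe hmin
  set E := s ^ C with hE
  have hE1 : 1 ≤ E := Nat.one_le_pow _ _ (by omega)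
  rw [two_edges'] at hGe
  have hsub : ∀ W : Finset (Fin n), W.card < n →
      ∑ w ∈ W, (W.filter (fun x => G.Adj w x)).card ≤ E * W.card := by
    intro W hW
    obtain ⟨φ, hφ⟩ := exists_emb W
    have h := two_edges G φ
    rw [hφ] at h
    rw [← h]
    by_contra hlt
    push Not at hlt
    exact hmin _ hW ⟨G.comap φ, hered n G hG _ _ (induced_copy G φ), fun h => hGK (copy_comap φ h), hlt⟩
  have hdeg : ∀ W : Finset (Fin n), W.Nonempty → ∃ u ∈ W, (W.filter (fun w => G.Adj u w)).card ≤ 2 * E := by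
    intro W hW
    by_contra hno
    push Not at hno
    have hge : W.card * (2 * E + 1) ≤ ∑ w ∈ W, (W.filter (fun x => G.Adj w x)).card := by
      rw [← smul_eq_mul, ← sum_const]
      exact sum_le_sum (fun w hw => hno w hw)
    have hWc : 0 < W.card := card_pos.2 hW
    by_cases hWn : W.card < n
    · have := hsub W hWn
      nlinarith
    · have hWu : W = univ := by
        rw [← card_eq_iff_eq_univ, Fintype.card_fin]
        have := card_le_univ W
        rw [Fintype.card_fin] at this
        omega
      subst hWu
      rw [card_univ, Fintype.card_fin] at hWc
      -- a vertex of minimum degree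
      obtain ⟨u, -, hu⟩ := exists_min_image univ (fun w => (univ.filter (fun x => G.Adj w x)).card) hW
      have hu1 := hno u (mem_univ _)
      set δ := (univ.filter (fun x => G.Adj u x)).card with hδ
      have hδn : δ < n := by
        have : univ.filter (fun x => G.Adj u x) ⊂ univ := by
          rw [ssubset_univ_iff]
          intro h
          have : u ∈ univ.filter (fun x => G.Adj u x) := by rw [h]; exact mem_univ _
          exact G.loopless.irrefl u (mem_filter.1 this).2
        have := card_lt_card this
        rwa [card_univ, Fintype.card_fin] at this
      have h1 : n * δ ≤ ∑ w, (univ.filter (fun x => G.Adj w x)).card := by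
        calc n * δ = ∑ w : Fin n, δ := by rw [sum_const, card_univ, Fintype.card_fin, smul_eq_mul]
          _ ≤ _ := sum_le_sum (fun w hw => hu w hw)
      have h2 : ∑ w, (univ.filter (fun x => G.Adj w x)).card ≤ E * (n - 1) + 2 * δ := by
        have h3 := hsub (univ.erase u) (by rw [card_erase_of_mem (mem_univ _), card_univ, Fintype.card_fin]; omega)
        rw [card_erase_of_mem (mem_univ _), card_univ, Fintype.card_fin] at h3
        have h4 : ∑ w ∈ univ.erase u, (univ.filter (fun x => G.Adj w x)).card ≤
            ∑ w ∈ univ.erase u, ((univ.erase u).filter (fun x => G.Adj w x)).card + δ := by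
          have h5 : δ = ∑ w ∈ univ.erase u, if G.Adj u w then 1 else 0 := by
            rw [← card_filter, hδ]
            congr 1
            ext x
            simp only [mem_filter, mem_univ, true_and, mem_erase, ne_eq, and_true]
            exact ⟨fun h => ⟨h.ne', h⟩, fun h => h.2⟩
          rw [h5, ← sum_add_distrib]
          refine sum_le_sum (fun w _ => ?_)
          split_ifs with h
          · have : univ.filter (fun x => G.Adj w x) ⊆ insert u ((univ.erase u).filter (fun x => G.Adj w x)) := by
              intro x hx
              by_cases hxu : x = u
              · rw [hxu]; exact mem_insert_self _ _
              · exact mem_insert_of_mem (mem_filter.2 ⟨mem_erase.2 ⟨hxu, mem_univ _⟩, (mem_filter.1 hx).2⟩)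
            exact (card_le_card this).trans (card_insert_le _ _)
          · rw [add_zero]
            refine card_le_card ?_
            intro x hx
            have hxa := (mem_filter.1 hx).2
            refine mem_filter.2 ⟨mem_erase.2 ⟨?_, mem_univ _⟩, hxa⟩
            rintro rfl
            exact h hxa.symm
        rw [← add_sum_erase _ _ (mem_univ u)]
        omega
      obtain ⟨k, rfl⟩ : ∃ k, n = k + 3 := ⟨n - 3, by omega⟩
      have h6 : k + 3 - 1 = k + 2 := by omega
      rw [h6] at h2
      nlinarith
  obtain ⟨D, hD⟩ := degen G (2 * E) hdeg
  have hn : 0 < n := by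
    by_contra h0
    have h0 : n = 0 := by omega
    subst h0
    simp at hGe
  refine hC s hs (Fin n) G (kfree_of hGK) (noSparse_of 𝒢 hered p hbip (by omega) ?_ G hG)
    (noDense_of 𝒢 hered p hbip (by omega) ?_ ?_ G hG hGK) (by rwa [Fintype.card_fin]) D ?_
  · push_cast; linarith
  · unfold fP
    exact Nat.mul_pos hc0 (Nat.one_le_pow _ _ (Nat.mul_pos (by omega) hC1))
  · refine (hp s (by omega)).trans_le ?_
    unfold fP
    have : c0 * s ^ c0 ≤ c0 * (s * C) ^ c0 := by
      gcongr
      exact Nat.le_mul_of_pos_right _ hC1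
    exact_mod_cast this
  · rw [Fintype.card_fin]
    have e : 2 * E * n = 2 * (E * n) := by ring
    rw [e]
    omega

end PolyDeg

/-- If `𝒢` is a hereditary class of graphs such that for some polynomial `p`
every bipartite `K_{s,s}`-subgraph-free graph in `𝒢` has average degree at most `p(s)`,
then there is a polynomial `p'` such that every `K_{s,s}`-subgraph-free graph in `𝒢`
has average degree at most `p'(s)`. -/
theorem stmt_2 (𝒢 : ∀ n : ℕ, SimpleGraph (Fin n) → Prop)
    (hered : ∀ n (G : SimpleGraph (Fin n)), 𝒢 n G →
      ∀ m (H : SimpleGraph (Fin m)), HasInducedCopy G H → 𝒢 m H)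
    (p : Polynomial ℝ)
    (hbip : ∀ s : ℕ, 0 < s → ∀ n (G : SimpleGraph (Fin n)), 𝒢 n G → G.Colorable 2 →
      ¬ HasSubgraphCopy G (completeBipartiteGraph (Fin s) (Fin s)) →
      avgDeg G ≤ p.eval (s : ℝ)) :
    ∃ p' : Polynomial ℝ, ∀ s : ℕ, 0 < s → ∀ n (G : SimpleGraph (Fin n)), 𝒢 n G →
      ¬ HasSubgraphCopy G (completeBipartiteGraph (Fin s) (Fin s)) →
      avgDeg G ≤ p'.eval (s : ℝ) := by
  obtain ⟨C, hC⟩ := PolyDeg.final_nat 𝒢 hered p hbip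
  refine ⟨Polynomial.X ^ C, fun s hs n G hG hK => ?_⟩
  rw [Polynomial.eval_pow, Polynomial.eval_X]
  rcases Nat.eq_zero_or_pos n with hn | hn
  · subst hn
    unfold avgDeg
    rw [Fintype.card_fin]
    simp only [CharP.cast_eq_zero, div_zero]
    positivity
  have hn' : (0 : ℝ) < n := by exact_mod_cast hn
  have key : 2 * G.edgeSet.ncard ≤ s ^ C * n := by
    rcases Nat.lt_or_ge s 2 with h | h
    · have h1 : s = 1 := by omega
      subst h1
      have hKF := PolyDeg.kfree_of hK
      have : G.edgeSet = ∅ := by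
        rw [SimpleGraph.edgeSet_eq_empty]
        ext a b
        simp only [SimpleGraph.bot_adj, iff_false]
        intro hab
        refine hKF {a} {b} (by simp) (by simp) ?_
        intro x hx y hy
        rw [Finset.mem_singleton] at hx hy
        rw [hx, hy]; exact hab
      rw [this]
      simp
    · exact hC s h n G hG hK
  unfold avgDeg
  rw [Fintype.card_fin, div_le_iff₀ hn']
  exact_mod_cast key
end

section
/- For every bipartite graph H, there exist constants 0 < ε ≤ 1/2 and c > 1, depending only on H, such that for every integer s ≥ 1 and every positive integer n, every n-vertex graph that contains no K_{s,s} subgraph and no induced subgraph isomorphic to H has at most c·s^4·n^{2−ε} edges. -/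
open SimpleGraph

/-- `ExtremalBound H ε c` : for every integer `s ≥ 1`, every finite graph on a positive number
`n` of vertices with no `K_{s,s}` subgraph and no induced copy of `H` has at most
`c·s⁴·n^(2-ε)` edges. -/
def ExtremalBound {VH : Type} (H : SimpleGraph VH) (ε c : ℝ) : Prop :=
  ∀ s : ℕ, 1 ≤ s → ∀ (V : Type) [Fintype V], ∀ G : SimpleGraph V,
    0 < Fintype.card V →
    ¬ HasSubgraphCopy G (completeBipartiteGraph (Fin s) (Fin s)) →
    ¬ HasInducedCopy G H →
    (G.edgeSet.ncard : ℝ) ≤ c * (s : ℝ) ^ 4 * (Fintype.card V : ℝ) ^ ((2 : ℝ) - ε)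
open Finset Classical in
noncomputable def clX {V : Type} (G : SimpleGraph V) (v : V) (X : Finset V) : Finset V :=
  X.filter (fun x => x ≠ v ∧ ¬ G.Adj v x)

open Finset Classical in
lemma few_bad {V : Type} [Fintype V] (G : SimpleGraph V) (s : ℕ) (hs : 1 ≤ s)
    (hK : ¬ HasSubgraphCopy G (completeBipartiteGraph (Fin s) (Fin s)))
    (X : Finset V) (hX : 4 * s ≤ #X) :
    #(univ.filter fun v => 4 * s * #(clX G v X) < #X) < s := by
  by_contra hcon
  push Not at hcon
  obtain ⟨S, hSsub, hS⟩ := Finset.exists_subset_card_eq hcon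
  set Y := X.filter (fun x => ∀ v ∈ S, G.Adj v x) with hY
  have hcover : X ⊆ (S.biUnion (fun v => clX G v X) ∪ S) ∪ Y := by
    intro x hx
    simp only [mem_union, mem_biUnion, clX, mem_filter, hY]
    by_cases h1 : x ∈ S
    · tauto
    by_cases h2 : ∀ v ∈ S, G.Adj v x
    · tauto
    push Not at h2
    obtain ⟨v, hv, hvx⟩ := h2
    left; left
    exact ⟨v, hv, hx, fun h => h1 (h ▸ hv), hvx⟩
  have h1 : #X ≤ ∑ v ∈ S, #(clX G v X) + s + #Y := by
    calc #X ≤ _ := card_le_card hcover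
      _ ≤ #(S.biUnion (fun v => clX G v X) ∪ S) + #Y := card_union_le _ _
      _ ≤ #(S.biUnion (fun v => clX G v X)) + #S + #Y := by
        gcongr; exact card_union_le _ _
      _ ≤ _ := by rw [hS]; gcongr; exact card_biUnion_le
  have h2 : ∑ v ∈ S, 4 * s * #(clX G v X) ≤ ∑ v ∈ S, #X := by
    apply sum_le_sum
    intro v hv
    have := hSsub hv
    simp only [mem_filter] at this
    exact this.2.le
  rw [← mul_sum, sum_const, hS, smul_eq_mul] at h2
  have h3 : 4 * ∑ v ∈ S, #(clX G v X) ≤ #X := by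
    have : s * (4 * ∑ v ∈ S, #(clX G v X)) ≤ s * #X := by linarith
    exact Nat.le_of_mul_le_mul_left this hs
  have h4 : s ≤ #Y := by omega
  obtain ⟨Z, hZsub, hZ⟩ := Finset.exists_subset_card_eq h4
  apply hK
  let e1 := (S.equivFinOfCardEq hS).symm
  let e2 := (Z.equivFinOfCardEq hZ).symm
  have hadj : ∀ i j, G.Adj (e1 i : V) (e2 j : V) := by
    intro i j
    have := hZsub (e2 j).2
    simp only [hY, mem_filter] at this
    exact this.2 _ (e1 i).2
  refine ⟨⟨Sum.elim (fun i => (e1 i : V)) (fun j => (e2 j : V)), ?_⟩, ?_⟩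
  · rintro (a | a) (b | b) h
    · simp at h
    · exact hadj a b
    · exact (hadj b a).symm
    · simp at h
  · rintro (a | a) (b | b) h
    · have h : (e1 a : V) = e1 b := h
      simpa using h
    · have h : (e1 a : V) = e2 b := h
      exact absurd h (hadj a b).ne
    · have h : (e2 a : V) = e1 b := h
      exact absurd h.symm (hadj b a).ne
    · have h : (e2 a : V) = e2 b := h
      simpa using h

open Finset Classical in
noncomputable def itrans {V : Type} [Fintype V] (G : SimpleGraph V) (m : ℕ)
    (W : Fin m → Finset V) : Finset (Fin m → V) :=
  (Fintype.piFinset W).filter (fun f => ∀ i j, i ≠ j → f i ≠ f j ∧ ¬ G.Adj (f i) (f j))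

open Finset Classical in
lemma many_trans {V : Type} [Fintype V] (G : SimpleGraph V) (s : ℕ) (hs : 1 ≤ s)
    (hK : ¬ HasSubgraphCopy G (completeBipartiteGraph (Fin s) (Fin s))) (w : ℕ) (m : ℕ)
    (hm : m ≤ w) (W : Fin m → Finset V) (hW : ∀ b, w * (4 * s) ^ m ≤ #(W b)) :
    w ^ m ≤ #(itrans G m W) := by
  induction m with
  | zero =>
    simp only [pow_zero]
    apply Finset.card_pos.2
    exact ⟨Fin.elim0, by simp [itrans]; exact Subsingleton.elim _ _⟩
  | succ m ih =>
    have h4s : 4 * s ≤ w * (4 * s) ^ (m+1) := by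
      rw [pow_succ]
      have hw0 : 0 < w := by omega
      have : 0 < w * (4 * s) ^ m := by positivity
      nlinarith
    set B := fun b : Fin m => univ.filter fun v => 4 * s * #(clX G v (W b.succ)) < #(W b.succ)
    have hB : ∀ b, #(B b) ≤ s := fun b =>
      (few_bad G s hs hK (W b.succ) (h4s.trans (hW _))).le
    set P := W 0 \ univ.biUnion B with hP
    have hPc : w ≤ #P := by
      have h1 : #(univ.biUnion B) ≤ m * s := by
        calc _ ≤ ∑ b, #(B b) := card_biUnion_le
          _ ≤ ∑ b : Fin m, s := sum_le_sum (fun b _ => hB b)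
          _ = _ := by simp
      have h2 := le_card_sdiff (univ.biUnion B) (W 0)
      have h3 : w * (4 * s) ≤ w * (4 * s) ^ (m+1) := by
        gcongr
        exact Nat.le_self_pow (by omega) _
      have h4 := hW 0
      have h5 : m * s ≤ w * s := by gcongr; omega
      have h6 : w ≤ w * s := Nat.le_mul_of_pos_right _ hs
      have h7 : w * (4 * s) = 4 * (w * s) := by ring
      rw [hP]
      omega
    let t : V → Finset (Fin m → V) := fun v => itrans G m (fun b => clX G v (W b.succ))
    have ht : ∀ v ∈ P, w ^ m ≤ #(t v) := by
      intro v hv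
      apply ih (by omega)
      intro b
      simp only [hP, mem_sdiff, mem_biUnion, mem_univ, true_and, not_exists, B, mem_filter, not_lt] at hv
      have h1 := hv.2 b
      have h2 := (hW b.succ).trans h1
      have h3 : (4 * s) * (w * (4 * s) ^ m) ≤ 4 * s * #(clX G v (W b.succ)) := by
        calc _ = w * (4 * s) ^ (m+1) := by ring
          _ ≤ _ := h2
      exact Nat.le_of_mul_le_mul_left h3 (by omega)
    calc w ^ (m+1) = w * w ^ m := by ring
      _ ≤ #P * w ^ m := by gcongr
      _ = ∑ v ∈ P, w ^ m := by simp
      _ ≤ ∑ v ∈ P, #(t v) := sum_le_sum ht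
      _ = #(P.sigma t) := (card_sigma _ _).symm
      _ ≤ _ := by
        apply card_le_card_of_injOn (fun x => (Fin.cons x.1 x.2 : Fin (m+1) → V))
        · rintro ⟨v, f⟩ hx
          simp only [coe_sigma, Set.mem_sigma_iff, mem_coe, t, itrans, mem_filter,
            Fintype.mem_piFinset, clX] at hx
          obtain ⟨hv, hf, hf2⟩ := hx
          simp only [mem_coe, itrans, mem_filter, Fintype.mem_piFinset]
          refine ⟨?_, ?_⟩
          · intro a
            refine Fin.cases ?_ (fun i => ?_) a
            · simpa using (mem_sdiff.1 hv).1
            · simpa using (hf i).1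
          · intro i j
            refine Fin.cases ?_ (fun i => ?_) i <;> refine Fin.cases ?_ (fun j => ?_) j
            · simp
            · intro _
              simpa using ⟨(hf j).2.1.symm, (hf j).2.2⟩
            · intro _
              simpa using ⟨(hf i).2.1, fun h => (hf i).2.2 h.symm⟩
            · intro hij
              simpa using hf2 i j (fun h => hij (by rw [h]))
        · rintro ⟨v, f⟩ _ ⟨v', f'⟩ _ h
          have := Fin.cons_inj.1 h
          simpa using this

open Finset Classical in
noncomputable def cand {V : Type} [Fintype V] (G : SimpleGraph V) {k : ℕ}
    (R : SimpleGraph (Fin k)) (f : Fin k → V) (b : Fin k) (j : ℕ) : Finset V :=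
  univ.filter (fun v => (∀ a, R.Adj b a → G.Adj v (f a)) ∧
    ∀ a : Fin k, a.val < j → ¬ R.Adj b a → v ≠ f a ∧ ¬ G.Adj (f a) v)

open Finset Classical in
lemma cand_succ_adj {V : Type} [Fintype V] (G : SimpleGraph V) {k : ℕ}
    (R : SimpleGraph (Fin k)) (f : Fin k → V) (b j : Fin k) (h : R.Adj b j) :
    cand G R f b (j.val + 1) = cand G R f b j.val := by
  ext v
  simp only [cand, mem_filter, mem_univ, true_and]
  refine and_congr_right fun _ => ⟨fun h1 a ha => h1 a (by omega), fun h1 a ha hr => ?_⟩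
  by_cases haj : a = j
  · subst haj; exact absurd h hr
  · exact h1 a (by have : a.val ≠ j.val := fun h => haj (Fin.ext h)
                   omega) hr

open Finset Classical in
lemma cand_succ_not {V : Type} [Fintype V] (G : SimpleGraph V) {k : ℕ}
    (R : SimpleGraph (Fin k)) (f : Fin k → V) (b j : Fin k) (h : ¬ R.Adj b j) :
    cand G R f b (j.val + 1) = clX G (f j) (cand G R f b j.val) := by
  ext v
  simp only [cand, clX, mem_filter, mem_univ, true_and]
  constructor
  · rintro ⟨h1, h2⟩
    exact ⟨⟨h1, fun a ha => h2 a (by omega)⟩, h2 j (by omega) h⟩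
  · rintro ⟨⟨h1, h2⟩, h3⟩
    refine ⟨h1, fun a ha hr => ?_⟩
    by_cases haj : a = j
    · subst haj; exact h3
    · exact h2 a (by have : a.val ≠ j.val := fun h => haj (Fin.ext h)
                     omega) hr

open Finset Classical in
lemma cand_congr {V : Type} [Fintype V] (G : SimpleGraph V) {k : ℕ}
    (R : SimpleGraph (Fin k)) (f f' : Fin k → V) (b j : Fin k) (h : ¬ R.Adj b j)
    (hf : ∀ a, a ≠ j → f a = f' a) :
    cand G R f b j.val = cand G R f' b j.val := by
  ext v
  simp only [cand, mem_filter, mem_univ, true_and]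
  apply and_congr
  · refine forall_congr' fun a => ?_
    by_cases haj : a = j
    · subst haj; simp [h]
    · rw [hf a haj]
  · refine forall_congr' fun a => ?_
    by_cases haj : a = j
    · subst haj; simp
    · rw [hf a haj]

open Finset Classical in
noncomputable def badF {V : Type} [Fintype V] (G : SimpleGraph V) (s : ℕ) {m : ℕ}
    (R : SimpleGraph (Fin (m+1))) (U : Finset V) (b j : Fin (m+1)) : Finset (Fin (m+1) → V) :=
  (Fintype.piFinset (fun _ => U)).filter (fun f => ¬ R.Adj b j ∧
    4 * s ≤ #(cand G R f b j.val) ∧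
    4 * s * #(clX G (f j) (cand G R f b j.val)) < #(cand G R f b j.val))

open Finset Classical in
lemma card_badF {V : Type} [Fintype V] (G : SimpleGraph V) (s : ℕ) (hs : 1 ≤ s)
    (hK : ¬ HasSubgraphCopy G (completeBipartiteGraph (Fin s) (Fin s))) {m : ℕ}
    (R : SimpleGraph (Fin (m+1))) (U : Finset V) (b j : Fin (m+1)) :
    #(badF G s R U b j) ≤ s * #U ^ m := by
  have key := Finset.card_le_mul_card_image_of_maps_to
    (f := fun f : Fin (m+1) → V => (j.removeNth f : Fin m → V))
    (s := badF G s R U b j) (t := Fintype.piFinset (fun _ : Fin m => U))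
    (by
      intro f hf
      simp only [badF, mem_filter, Fintype.mem_piFinset] at hf
      simp only [Fintype.mem_piFinset]
      intro a
      exact hf.1 _) s
    (by
      intro g hg
      rcases Finset.eq_empty_or_nonempty ((badF G s R U b j).filter
        (fun f => (j.removeNth f : Fin m → V) = g)) with h0 | ⟨f0, hf0⟩
      · rw [h0]; simp
      · simp only [mem_filter, badF] at hf0
        obtain ⟨⟨_, hR, h4, _⟩, hg0⟩ := hf0
        refine le_trans ?_ (few_bad G s hs hK (cand G R f0 b j.val) h4).le
        have hag : ∀ f : Fin (m+1) → V, (j.removeNth f : Fin m → V) = g →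
            ∀ a, a ≠ j → f a = f0 a := by
          intro f hf a ha
          obtain ⟨i, rfl⟩ := Fin.exists_succAbove_eq ha
          exact congrFun (hf.trans hg0.symm) i
        apply card_le_card_of_injOn (fun f => f j)
        · intro f hf
          simp only [mem_coe, mem_filter, badF] at hf
          obtain ⟨⟨_, _, _, h5⟩, hgf⟩ := hf
          rw [cand_congr G R f f0 b j hR (hag f hgf)] at h5
          simpa using h5
        · intro f hf f' hf' hff
          simp only [mem_coe, mem_filter] at hf hf'
          funext a
          by_cases haj : a = j
          · subst haj; exact hff
          · rw [hag f hf.2 a haj, hag f' hf'.2 a haj])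
  rwa [Fintype.card_piFinset_const] at key

open Finset Classical in
lemma embed_core {V : Type} [Fintype V] (G : SimpleGraph V) (s : ℕ) (hs : 1 ≤ s)
    (hK : ¬ HasSubgraphCopy G (completeBipartiteGraph (Fin s) (Fin s))) (m D Q : ℕ)
    (hD : (m+1)^2 + 2*(m+1) + 1 ≤ D) (hQ : Q = (m+2)^2 * (4*s)^D)
    (R : SimpleGraph (Fin (m+1))) (U : Finset V) (hU : #U = Q)
    (hcom : ∀ f : Fin (m+1) → V, (∀ i, f i ∈ U) → Q ≤ #(univ.filter fun v => ∀ a, G.Adj v (f a))) :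
    ∃ f g : Fin (m+1) → V, (∀ i j, i ≠ j → f i ≠ f j ∧ ¬ G.Adj (f i) (f j)) ∧
      (∀ i j, i ≠ j → g i ≠ g j ∧ ¬ G.Adj (g i) (g j)) ∧
      ∀ a b, (R.Adj b a → G.Adj (g b) (f a)) ∧
        (¬ R.Adj b a → g b ≠ f a ∧ ¬ G.Adj (f a) (g b)) := by
  have h4s : 1 ≤ 4 * s := by omega
  set w := (m+2)^2 * (4*s)^(D-(m+1)) with hw
  have hwQ : w * (4*s)^(m+1) = Q := by
    rw [hw, hQ, mul_assoc, ← pow_add]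
    congr 2
    have : m + 1 ≤ D := by nlinarith
    omega
  have hpow1 : ∀ e, 1 ≤ (4*s)^e := fun e => Nat.one_le_pow _ _ h4s
  have hw1 : m + 1 ≤ w := by
    have := hpow1 (D-(m+1))
    nlinarith
  have hmany := many_trans G s hs hK w (m+1) hw1 (fun _ => U) (fun _ => by rw [hwQ, hU])
  set B := (univ : Finset (Fin (m+1) × Fin (m+1))).biUnion (fun p => badF G s R U p.1 p.2)
  have hB : #B ≤ (m+1)^2 * (s * Q^m) := by
    calc #B ≤ ∑ p : Fin (m+1) × Fin (m+1), #(badF G s R U p.1 p.2) := card_biUnion_le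
      _ ≤ ∑ p : Fin (m+1) × Fin (m+1), s * Q^m := by
        apply sum_le_sum
        intro p _
        rw [← hU]
        exact card_badF G s hs hK R U p.1 p.2
      _ = _ := by
        rw [sum_const, card_univ, Fintype.card_prod, Fintype.card_fin, smul_eq_mul]; ring
  have hlt : #B < #(itrans G (m+1) (fun _ => U)) := by
    refine lt_of_le_of_lt hB (lt_of_lt_of_le ?_ hmany)
    have h1 : s * (4*s)^((m+1)*m) ≤ (4*s)^(D-(m+1)) := by
      calc s * (4*s)^((m+1)*m) ≤ (4*s) * (4*s)^((m+1)*m) := by gcongr; omega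
        _ = (4*s)^((m+1)*m+1) := by ring
        _ ≤ _ := by
          apply Nat.pow_le_pow_right h4s
          apply Nat.le_sub_of_add_le
          nlinarith
    have h2 : (m+1)^2 * (s * (4*s)^((m+1)*m)) < w := by
      calc _ ≤ (m+1)^2 * (4*s)^(D-(m+1)) := by gcongr
        _ < w := by
          rw [hw]
          apply Nat.mul_lt_mul_of_pos_right _ (hpow1 _)
          nlinarith
    calc (m+1)^2 * (s * Q^m) = ((m+1)^2 * (s * (4*s)^((m+1)*m))) * w^m := by
          rw [← hwQ, mul_pow, ← pow_mul]; ring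
      _ < w * w^m := Nat.mul_lt_mul_of_pos_right h2 (Nat.pow_pos (by omega))
      _ = _ := by ring
  obtain ⟨f, hf, hfB⟩ := Finset.exists_mem_notMem_of_card_lt_card hlt
  simp only [itrans, mem_filter, Fintype.mem_piFinset] at hf
  obtain ⟨hfU, hfI⟩ := hf
  have hgood : ∀ b j, f ∉ badF G s R U b j := by
    intro b j h
    exact hfB (mem_biUnion.2 ⟨(b, j), mem_univ _, h⟩)
  have hsize : ∀ b : Fin (m+1), ∀ j : ℕ, j ≤ m+1 → Q ≤ #(cand G R f b j) * (4*s)^j := by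
    intro b j
    induction j with
    | zero =>
      intro _
      refine (hcom f hfU).trans ?_
      rw [pow_zero, mul_one]
      apply card_le_card
      intro v
      simp only [cand, mem_filter, mem_univ, true_and]
      intro hv
      exact ⟨fun a _ => hv a, fun a ha => absurd ha (by omega)⟩
    | succ j ih =>
      intro hj
      have ih := ih (by omega)
      by_cases hR : R.Adj b ⟨j, by omega⟩
      · have := cand_succ_adj G R f b ⟨j, by omega⟩ hR
        simp only at this
        rw [this]
        refine ih.trans ?_
        gcongr
        omega
      · have := cand_succ_not G R f b ⟨j, by omega⟩ hR
        simp only at this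
        rw [this]
        have h4 : 4 * s ≤ #(cand G R f b j) := by
          have h5 : (4*s) * (4*s)^j ≤ #(cand G R f b j) * (4*s)^j := by
            refine le_trans ?_ ih
            rw [hQ]
            calc (4*s) * (4*s)^j = 1 * (4*s)^(j+1) := by ring
              _ ≤ _ := by
                gcongr
                · nlinarith
                · nlinarith
          exact Nat.le_of_mul_le_mul_right h5 (hpow1 _)
        have hg := hgood b ⟨j, by omega⟩
        simp only [badF, mem_filter, Fintype.mem_piFinset, not_and, not_lt] at hg
        have hg := hg hfU hR h4
        calc Q ≤ #(cand G R f b j) * (4*s)^j := ih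
          _ ≤ _ := Nat.mul_le_mul_right _ hg
          _ = _ := by ring
  have hW : ∀ b, (m+1) * (4*s)^(m+1) ≤ #(cand G R f b (m+1)) := by
    intro b
    have h1 := hsize b (m+1) le_rfl
    rw [← hwQ] at h1
    have h2 := Nat.le_of_mul_le_mul_right h1 (hpow1 _)
    refine le_trans ?_ h2
    rw [hw]
    gcongr
    · nlinarith
    · apply Nat.le_sub_of_add_le
      nlinarith
  have hmany2 := many_trans G s hs hK (m+1) (m+1) le_rfl (fun b => cand G R f b (m+1)) hW
  obtain ⟨g, hg⟩ := Finset.card_pos.1 (lt_of_lt_of_le (Nat.pow_pos (by omega)) hmany2)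
  simp only [itrans, mem_filter, Fintype.mem_piFinset, cand, mem_univ, true_and] at hg
  refine ⟨f, g, hfI, hg.2, fun a b => ⟨fun h => (hg.1 b).1 a h, fun h => (hg.1 b).2 a a.2 h⟩⟩

open Finset Classical in
lemma embed_H {V : Type} [Fintype V] (G : SimpleGraph V) {VH : Type} [Fintype VH]
    (H : SimpleGraph VH) (hH : H.Colorable 2) (s : ℕ) (hs : 1 ≤ s)
    (hK : ¬ HasSubgraphCopy G (completeBipartiteGraph (Fin s) (Fin s))) (m D Q : ℕ)
    (hm : m = Fintype.card VH)
    (hD : (m+1)^2 + 2*(m+1) + 1 ≤ D) (hQ : Q = (m+2)^2 * (4*s)^D)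
    (U : Finset V) (hU : Q ≤ #U)
    (hcom : ∀ f : Fin (m+1) → V, (∀ i, f i ∈ U) → Q ≤ #(univ.filter fun v => ∀ a, G.Adj v (f a))) :
    HasInducedCopy G H := by
  obtain ⟨C⟩ := hH
  obtain ⟨U', hU'sub, hU'⟩ := Finset.exists_subset_card_eq hU
  let e : VH ↪ Fin (m+1) :=
    ((Fintype.equivFinOfCardEq hm.symm).toEmbedding).trans Fin.castSuccEmb
  obtain ⟨f, g, hf, hg, hfg⟩ := embed_core G s hs hK m D Q hD hQ (H.map e) U' hU'
    (fun f hf => hcom f (fun i => hU'sub (hf i)))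
  have hadj : ∀ a b, (H.map e).Adj (e a) (e b) ↔ H.Adj a b := fun a b =>
    SimpleGraph.map_adj_apply
  have hne : ∀ a b, f (e a) ≠ g (e b) := by
    intro a b
    by_cases h : (H.map e).Adj (e b) (e a)
    · exact ((hfg _ _).1 h).ne.symm
    · exact ((hfg _ _).2 h).1.symm
  have hfgadj : ∀ a b, G.Adj (f (e a)) (g (e b)) ↔ H.Adj a b := by
    intro a b
    rw [← hadj]
    constructor
    · intro h
      by_contra h'
      exact ((hfg _ _).2 (fun h2 => h' h2.symm)).2 h
    · intro h
      exact ((hfg _ _).1 h.symm).symm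
  have hff : ∀ a b, ¬ G.Adj (f (e a)) (f (e b)) := by
    intro a b
    by_cases h : e a = e b
    · rw [h]; exact G.loopless.irrefl _
    · exact (hf _ _ h).2
  have hgg : ∀ a b, ¬ G.Adj (g (e a)) (g (e b)) := by
    intro a b
    by_cases h : e a = e b
    · rw [h]; exact G.loopless.irrefl _
    · exact (hg _ _ h).2
  have hfi : ∀ a b, f (e a) = f (e b) → a = b := by
    intro a b h
    by_contra hab
    exact (hf _ _ (fun h' => hab (e.injective h'))).1 h
  have hgi : ∀ a b, g (e a) = g (e b) → a = b := by
    intro a b h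
    by_contra hab
    exact (hg _ _ (fun h' => hab (e.injective h'))).1 h
  have hcol : ∀ x, C x ≠ 0 → C x = 1 := by
    intro x h
    have : ∀ y : Fin 2, y ≠ 0 → y = 1 := by decide
    exact this _ h
  have hsame : ∀ a b, C a = C b → ¬ H.Adj a b := fun a b h h' => C.valid h' h
  let φ : VH → V := fun x => if C x = 0 then f (e x) else g (e x)
  have hφ0 : ∀ x, C x = 0 → φ x = f (e x) := fun x h => if_pos h
  have hφ1 : ∀ x, C x ≠ 0 → φ x = g (e x) := fun x h => if_neg h
  have hinj : Function.Injective φ := by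
    intro a b h
    by_cases ha : C a = 0 <;> by_cases hb : C b = 0
    · rw [hφ0 a ha, hφ0 b hb] at h; exact hfi _ _ h
    · rw [hφ0 a ha, hφ1 b hb] at h; exact absurd h (hne _ _)
    · rw [hφ1 a ha, hφ0 b hb] at h; exact absurd h.symm (hne _ _)
    · rw [hφ1 a ha, hφ1 b hb] at h; exact hgi _ _ h
  have hφadj : ∀ a b, G.Adj (φ a) (φ b) ↔ H.Adj a b := by
    intro a b
    by_cases ha : C a = 0 <;> by_cases hb : C b = 0
    · rw [hφ0 a ha, hφ0 b hb]
      exact iff_of_false (hff _ _) (hsame _ _ (ha.trans hb.symm))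
    · rw [hφ0 a ha, hφ1 b hb]; exact hfgadj _ _
    · rw [hφ1 a ha, hφ0 b hb, G.adj_comm, H.adj_comm]; exact hfgadj _ _
    · rw [hφ1 a ha, hφ1 b hb]
      exact iff_of_false (hgg _ _) (hsame _ _ ((hcol _ ha).trans (hcol _ hb).symm))
  refine ⟨Set.range φ, ⟨RelIso.symm ⟨Equiv.ofInjective φ hinj, ?_⟩⟩⟩
  intro a b
  simpa using hφadj a b

open Finset Classical in
lemma drc {V : Type} [Fintype V] (G : SimpleGraph V) (k t Q : ℕ)
    (hno : ∀ U : Finset V, Q ≤ #U → ∃ f : Fin k → V, (∀ i, f i ∈ U) ∧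
      #(univ.filter fun v => ∀ a, G.Adj v (f a)) < Q) :
    ∑ v, G.degree v ^ t ≤ Q * Fintype.card V ^ t + Fintype.card V ^ (k+1) * Q ^ t := by
  set n := Fintype.card V with hn
  let UT : (Fin t → V) → Finset V := fun T => univ.filter fun v => ∀ i, G.Adj v (T i)
  let F : Finset (Fin k → V) :=
    univ.filter fun f => #(univ.filter fun v => ∀ a, G.Adj v (f a)) < Q
  let BT : (Fin t → V) → Finset (Fin k → V) := fun T => F.filter fun f => ∀ i, f i ∈ UT T
  have h1 : ∀ T, #(UT T) ≤ Q + n * #(BT T) := by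
    intro T
    by_cases h : Q ≤ #(UT T)
    · obtain ⟨f, hf, hfQ⟩ := hno _ h
      have hpos : 0 < #(BT T) := card_pos.2 ⟨f, by simp only [BT, F, mem_filter, mem_univ, true_and]; exact ⟨hfQ, hf⟩⟩
      have : #(UT T) ≤ n := card_le_univ _
      nlinarith
    · have : 0 ≤ n * #(BT T) := Nat.zero_le _
      omega
  have h2 : ∑ T, #(UT T) = ∑ v, G.degree v ^ t := by
    have := sum_card_bipartiteAbove_eq_sum_card_bipartiteBelow
      (s := (univ : Finset (Fin t → V))) (t := (univ : Finset V))
      (fun T v => ∀ i, G.Adj v (T i))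
    refine Eq.trans this (sum_congr rfl fun v _ => ?_)
    rw [← G.card_neighborFinset_eq_degree, ← Fintype.card_piFinset_const]
    congr 1
    ext T
    simp [Fintype.mem_piFinset]
  have h3 : ∑ T, #(BT T) ≤ n ^ k * Q ^ t := by
    have := sum_card_bipartiteAbove_eq_sum_card_bipartiteBelow
      (s := (univ : Finset (Fin t → V))) (t := F)
      (fun T f => ∀ i, f i ∈ UT T)
    refine le_trans (Eq.le this) ?_
    calc _ ≤ ∑ f ∈ F, Q ^ t := by
          apply sum_le_sum
          intro f hf
          simp only [F, mem_filter, mem_univ, true_and] at hf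
          calc _ ≤ #(Fintype.piFinset (fun _ : Fin t => univ.filter fun v => ∀ a, G.Adj v (f a))) := by
                apply card_le_card
                intro T
                simp only [mem_bipartiteBelow, Fintype.mem_piFinset, UT, mem_filter, mem_univ, true_and]
                intro h i a
                exact (h a i).symm
            _ = _ := Fintype.card_piFinset_const _ _
            _ ≤ _ := Nat.pow_le_pow_left hf.le _
      _ = #F * Q ^ t := by simp
      _ ≤ _ := by
        gcongr
        refine (card_le_univ _).trans ?_
        simp [hn]
  calc ∑ v, G.degree v ^ t = ∑ T, #(UT T) := h2.symm
    _ ≤ ∑ T, (Q + n * #(BT T)) := sum_le_sum fun T _ => h1 T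
    _ = Q * n ^ t + n * ∑ T, #(BT T) := by
      rw [sum_add_distrib, mul_sum]; simp [hn, mul_comm]
    _ ≤ Q * n ^ t + n * (n ^ k * Q ^ t) := by gcongr
    _ = _ := by ring

lemma final_arith (n x s C e : ℝ) (D d k : ℕ) (hD : D = d + 1) (hk : k + 2 ≤ D)
    (hx : 1 ≤ x) (hn : x ^ (D^2) = n) (hs : 1 ≤ s) (hC : 1 ≤ C) (hen : e ≤ n^2)
    (hlow : 2 * C * s^4 * (n^2 / x) < e)
    (hup : e ^ D ≤ n^d * (C * s^D * n^D + n^(k+1) * (C * s^D)^D)) : False := by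
  have hn1 : 1 ≤ n := by rw [← hn]; exact one_le_pow₀ hx
  have hx0 : 0 < x := by linarith
  have hn0 : 0 < n := by linarith
  have hs4 : s ≤ s^4 := le_self_pow₀ hs (by norm_num)
  have hsx : s ≤ x := by
    have h1 : 2 * C * s^4 * (n^2 / x) < n^2 := hlow.trans_le hen
    have h2 : 2 * C * s^4 * (n^2 / x) = (2 * C * s^4) / x * n^2 := by ring
    rw [h2] at h1
    have h3 : (2 * C * s^4) / x < 1 := by
      by_contra h
      push Not at h
      have : 0 < n^2 := by positivity
      nlinarith
    rw [div_lt_one hx0] at h3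
    have h4 : 0 < s^4 := by positivity
    nlinarith
  have hxD : x ^ D ≤ n := by
    rw [← hn]; exact pow_le_pow_right₀ hx (by nlinarith)
  have hsD : s ^ (D^2) ≤ n := by
    rw [← hn]; exact pow_le_pow_left₀ (by linarith) hsx _
  have h1 : (2 * C * s^4 * n^2) ^ D < x ^ D * e ^ D := by
    rw [← mul_pow]
    apply pow_lt_pow_left₀ _ (by positivity) (by omega)
    have : 2 * C * s^4 * (n^2 / x) * x = 2 * C * s^4 * n^2 := by field_simp
    nlinarith
  have h2 : (2 * C * s^4 * n^2) ^ D < n * (n^d * (C * s^D * n^D + n^(k+1) * (C * s^D)^D)) := by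
    refine h1.trans_le ?_
    have hpos : 0 ≤ n^d * (C * s^D * n^D + n^(k+1) * (C * s^D)^D) := by positivity
    have he : 0 ≤ e := le_trans (by positivity) hlow.le
    exact mul_le_mul hxD hup (by positivity) hn0.le
  have hP : (2 * C * s^4 * n^2) ^ D = (2*C)^D * (s^4)^D * n^(2*D) := by
    rw [mul_pow, mul_pow, ← pow_mul n]
  have hN : n * (n^d * (C * s^D * n^D + n^(k+1) * (C * s^D)^D))
      = C * s^D * n^(2*D) + C^D * (s^(D^2) * n^(D+k+1)) := by
    rw [mul_pow C, ← pow_mul s, ← sq, hD]; ring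
  rw [hP, hN] at h2
  have hn2D : 0 < n^(2*D) := by positivity
  have hsDD : s^D ≤ (s^4)^D := pow_le_pow_left₀ (by linarith) hs4 _
  have hsD1 : 1 ≤ s^D := one_le_pow₀ hs
  have hA : 2 * C ≤ (2*C)^D := le_self_pow₀ (by linarith) (by omega)
  have hB : 2 * C^D ≤ (2*C)^D := by
    rw [mul_pow]
    gcongr
    exact le_self_pow₀ (by norm_num) (by omega)
  have h3 : 2 * (C * s^D * n^(2*D)) ≤ (2*C)^D * (s^4)^D * n^(2*D) := by
    calc _ = (2 * C) * s^D * n^(2*D) := by ring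
      _ ≤ _ := by gcongr
  have h4 : s^(D^2) * n^(D+k+1) ≤ n^(2*D) := by
    calc _ ≤ n * n^(D+k+1) := by gcongr
      _ = n^(D+k+2) := by ring
      _ ≤ _ := pow_le_pow_right₀ hn1 (by omega)
  have h5 : 2 * (C^D * (s^(D^2) * n^(D+k+1))) ≤ (2*C)^D * (s^4)^D * n^(2*D) := by
    calc _ = (2 * C^D) * 1 * (s^(D^2) * n^(D+k+1)) := by ring
      _ ≤ (2*C)^D * (s^4)^D * n^(2*D) := by
        gcongr
        linarith
  linarith

/-- For every bipartite graph `H` there are constants `0 < ε ≤ 1/2` and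
`c > 1` such that for every `s ≥ 1`, every `n`-vertex graph (`n ≥ 1`) with no `K_{s,s}`
subgraph and no induced copy of `H` has at most `c·s⁴·n^(2-ε)` edges. -/
theorem stmt_3 {VH : Type} [Fintype VH] (H : SimpleGraph VH) (hH : H.Colorable 2) :
    ∃ ε c : ℝ, 0 < ε ∧ ε ≤ 1 / 2 ∧ 1 < c ∧ ExtremalBound H ε c := by
  classical
  set m := Fintype.card VH with hm
  set D := 2 * (m+2)^2 with hD
  set C : ℝ := ((m:ℝ)+2)^2 * 4^D with hC
  have hD8 : 8 ≤ D := by nlinarith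
  have hC1 : 1 ≤ C := by
    have h1 : (1:ℝ) ≤ ((m:ℝ)+2)^2 := one_le_pow₀ (by linarith [(Nat.cast_nonneg m : (0:ℝ) ≤ m)])
    have h2 : (1:ℝ) ≤ 4^D := one_le_pow₀ (by norm_num)
    nlinarith
  have hDR : (8:ℝ) ≤ D := by exact_mod_cast hD8
  refine ⟨1 / (D:ℝ)^2, 2 * C, by positivity, ?_, by linarith, ?_⟩
  · apply one_div_le_one_div_of_le (by norm_num)
    nlinarith
  intro s hs V _ G hV hK hI
  by_contra hcon
  push Not at hcon
  set n : ℝ := (Fintype.card V : ℝ) with hn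
  have hn0 : 0 < n := by rw [hn]; exact_mod_cast hV
  have hn1 : 1 ≤ n := by rw [hn]; exact_mod_cast hV
  set Q := (m+2)^2 * (4*s)^D with hQ
  have hcard : G.edgeSet.ncard = G.edgeFinset.card := by
    rw [← SimpleGraph.coe_edgeFinset, Set.ncard_coe_finset]
  have hsum := drc G (m+1) D Q (by
    intro U hU
    by_contra h
    push Not at h
    exact hI (embed_H G H hH s hs hK m D Q hm (by nlinarith) hQ U hU h))
  obtain ⟨d, hd⟩ : ∃ d, D = d + 1 := ⟨D - 1, by omega⟩
  have hdeg := G.sum_degrees_eq_twice_card_edges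
  have hup : G.edgeFinset.card ^ D ≤ Fintype.card V ^ d *
      (Q * Fintype.card V ^ D + Fintype.card V ^ (m+1+1) * Q ^ D) := by
    calc G.edgeFinset.card ^ D ≤ (∑ v, G.degree v) ^ D := by
          rw [hdeg]; gcongr; omega
      _ ≤ Fintype.card V ^ d * ∑ v, G.degree v ^ D := by
          rw [hd]
          have := pow_sum_le_card_mul_sum_pow (s := (Finset.univ : Finset V))
            (f := fun v => G.degree v) (fun _ _ => Nat.zero_le _) d
          simpa using this
      _ ≤ _ := by gcongr
  have hup' : ((G.edgeFinset.card : ℝ)) ^ D ≤ n^d * (C * (s:ℝ)^D * n^D + n^(m+1+1) * (C * (s:ℝ)^D)^D) := by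
    have h1 : C * (s:ℝ)^D = (Q : ℝ) := by
      rw [hC, hQ]; push_cast; rw [mul_pow]; ring
    rw [h1, hn]
    exact_mod_cast hup
  refine final_arith n (n ^ (1 / (D:ℝ)^2)) s C G.edgeFinset.card D d (m+1) hd (by nlinarith)
    (Real.one_le_rpow hn1 (by positivity)) ?_ (by exact_mod_cast hs) hC1 ?_ ?_ hup'
  · rw [← Real.rpow_natCast, ← Real.rpow_mul hn0.le]
    have : 1 / (D:ℝ)^2 * ((D^2 : ℕ) : ℝ) = 1 := by
      push_cast; field_simp
    rw [this, Real.rpow_one]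
  · have h1 : G.edgeFinset.card ≤ (Fintype.card V) ^ 2 :=
      (SimpleGraph.card_edgeFinset_le_card_choose_two).trans (Nat.choose_le_pow _ _)
    rw [hn]
    exact_mod_cast h1
  · rw [Real.rpow_sub hn0, hcard] at hcon
    have h2 : n ^ (2:ℝ) = n ^ 2 := by exact_mod_cast Real.rpow_natCast n 2
    rw [h2] at hcon
    exact hcon
end
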